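/- Let p₁ and p₂ be primes with {p₁ mod 4, p₂ mod 4} = {1, 3}, let m ≥ 1, set N = p₁^m p₂, and let p be a prime such that ord_{p₁^m}(p) = φ(p₁^m), ord_{p₂}(p) = p₂ − 1, and f := ord_N(p) = φ(N)/2. Let q = p^f, let γ be a primitive element of F_q, let C_i = γ^i⟨γ^N⟩ (0 ≤ i ≤ N−1) be the cyclotomic classes of order N, and let D = ⋃_{i=0}^{p₁^{m−1}−1} C_{i p₂}. Assume there is b ∈ {1, −1} such that p₁ = 2p^{h/2} + (−1)^{(p₁−1)/2} b, p₂ = 2p^{h/2} − (−1)^{(p₁−1)/2} b, h is even, and 1 + p₁p₂ = 4p^h, where h is the class number of Q(√(−p₁p₂)). Then 0 ∉ D, −D = D, and the Cayley graph Cay(F_q, D) is a strongly regular graph. -/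

import Mathlib

open scoped Classical Pointwise

/-- The cyclotomic class `C_i = γ^i ⟨γ^N⟩ = {γ^{i+Nk} : k ∈ ℤ}` of order `N` of a finite
field, with respect to the primitive element `γ`. -/
def cycClass {F : Type*} [Field F] (γ : Fˣ) (N i : ℕ) : Set F :=
  {x : F | ∃ k : ℤ, x = ((γ ^ ((i : ℤ) + (N : ℤ) * k) : Fˣ) : F)}

/-- The Cayley graph on the additive group `G` with connection set `D`. -/
def cayley {G : Type*} [AddGroup G] (D : Set G) : SimpleGraph G :=
  SimpleGraph.fromRel fun x y => x - y ∈ D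

section PartA
open HurwitzZeta Filter Topology

lemma aux_rpow_diff {n x s : ℝ} (hn : 1 ≤ n) (hx0 : 0 < x) (hx1 : x < 1) (hs1 : 1 ≤ s) (hs2 : s ≤ 2) :
    |(n + x) ^ (-s) - (n + 1 - x) ^ (-s)| ≤ 2 / n ^ 2 := by
  have hs : -s ≤ 0 := by linarith
  have a1 : (n + x) ^ (-s) ≤ n ^ (-s) := Real.rpow_le_rpow_of_nonpos (by linarith) (by linarith) hs
  have a2 : (n + 1) ^ (-s) ≤ (n + x) ^ (-s) :=
    Real.rpow_le_rpow_of_nonpos (by linarith) (by linarith) hs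
  have b1 : (n + 1 - x) ^ (-s) ≤ n ^ (-s) :=
    Real.rpow_le_rpow_of_nonpos (by linarith) (by linarith) hs
  have b2 : (n + 1) ^ (-s) ≤ (n + 1 - x) ^ (-s) :=
    Real.rpow_le_rpow_of_nonpos (by linarith) (by linarith) hs
  have key : n ^ (-s) - (n + 1) ^ (-s) ≤ 2 / n ^ 2 := by
    have e : (n + 1) ^ (-s) = n ^ (-s) * (n / (n + 1)) ^ s := by
      rw [Real.div_rpow (by linarith) (by linarith), Real.rpow_neg (by linarith),
        Real.rpow_neg (by linarith)]
      have : n ^ s ≠ 0 := (Real.rpow_pos_of_pos (by linarith) _).ne'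
      field_simp
    have h1 : (n / (n + 1)) ^ (2 : ℝ) ≤ (n / (n + 1)) ^ s :=
      Real.rpow_le_rpow_of_exponent_ge (by positivity) (by rw [div_le_one (by linarith)]; linarith) hs2
    have h2 : n ^ (-s) ≤ n ^ (-1 : ℝ) := Real.rpow_le_rpow_of_exponent_le hn (by linarith)
    have h3 : (0 : ℝ) < n ^ (-s) := Real.rpow_pos_of_pos (by linarith) _
    rw [Real.rpow_two] at h1
    rw [Real.rpow_neg_one] at h2
    have h4 : 1 - (n / (n + 1)) ^ 2 ≤ 2 / n := by
      rw [div_pow, sub_le_iff_le_add, ← sub_le_iff_le_add', le_div_iff₀ (by positivity)]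
      have : (1 - 2 / n) * (n + 1) ^ 2 = n ^ 2 - 3 - 2 / n := by field_simp; ring
      rw [this]
      have : 0 < 2 / n := by positivity
      linarith
    rw [e]
    calc n ^ (-s) - n ^ (-s) * (n / (n + 1)) ^ s = n ^ (-s) * (1 - (n / (n + 1)) ^ s) := by ring
      _ ≤ n ^ (-s) * (2 / n) := by apply mul_le_mul_of_nonneg_left _ h3.le; linarith
      _ ≤ n⁻¹ * (2 / n) := by apply mul_le_mul_of_nonneg_right h2; positivity
      _ = 2 / n ^ 2 := by field_simp
  rw [abs_le]; constructor <;> linarith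

lemma hurwitzOdd_one {x : ℝ} (hx0 : 0 < x) (hx1 : x < 1) :
    hurwitzZetaOdd (x : UnitAddCircle) 1 = Real.pi / 2 * Complex.cot (Real.pi * x) := by
  set t : ℝ → ℕ → ℂ := fun s n => ((((n + x) ^ (-s) - (n + 1 - x) ^ (-s)) / 2 : ℝ) : ℂ) with ht
  have hsum : ∀ s : ℝ, 1 < s → HasSum (t s) (hurwitzZetaOdd (x : UnitAddCircle) s) := by
    intro s hs
    have := hasSum_nat_hurwitzZetaOdd_of_mem_Icc (a := x) ⟨hx0.le, hx1.le⟩ (s := (s : ℂ)) (by simpa using hs)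
    convert this using 2 with n
    simp only [ht]
    have e1 : (0 : ℝ) ≤ n + x := by positivity
    have e2 : (0 : ℝ) ≤ n + 1 - x := by have : (0 : ℝ) ≤ n := by positivity
                                        linarith
    push_cast
    rw [Complex.ofReal_cpow e1, Complex.ofReal_cpow e2]
    push_cast
    rw [Complex.cpow_neg, Complex.cpow_neg, one_div, one_div]
  set bound : ℕ → ℝ := fun n => (if n = 0 then x ^ (-2 : ℝ) + (1 - x) ^ (-2 : ℝ) else 0) + 2 / (n : ℝ) ^ 2 with hb
  have hbs : Summable bound := by
    apply Summable.add
    · exact (hasSum_ite_eq 0 (x ^ (-2 : ℝ) + (1 - x) ^ (-2 : ℝ))).summable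
    · have := (Real.summable_one_div_nat_pow (p := 2)).2 (by norm_num)
      simpa [div_eq_mul_inv] using this.mul_left 2
  have hbound : ∀ s : ℝ, 1 ≤ s → s ≤ 2 → ∀ n, ‖t s n‖ ≤ bound n := by
    intro s h1 h2 n
    simp only [ht, hb, Complex.norm_real, Real.norm_eq_abs, abs_div, abs_two]
    rcases Nat.eq_zero_or_pos n with rfl | hn
    · simp only [if_pos, Nat.cast_zero, zero_add]
      have e1 : x ^ (-s) ≤ x ^ (-2 : ℝ) := Real.rpow_le_rpow_of_exponent_ge hx0 hx1.le (by linarith)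
      have e2 : (1 - x) ^ (-s) ≤ (1 - x) ^ (-2 : ℝ) :=
        Real.rpow_le_rpow_of_exponent_ge (by linarith) (by linarith) (by linarith)
      have e3 : 0 < x ^ (-s) := Real.rpow_pos_of_pos hx0 _
      have e4 : 0 < (1 - x) ^ (-s) := Real.rpow_pos_of_pos (by linarith) _
      have : |x ^ (-s) - (1 - x) ^ (-s)| ≤ x ^ (-2 : ℝ) + (1 - x) ^ (-2 : ℝ) := by
        rw [abs_le]; constructor <;> linarith
      have h5 := abs_nonneg (x ^ (-s) - (1 - x) ^ (-s))
      have h6 : (2 : ℝ) / 0 ^ 2 = 0 := by norm_num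
      rw [h6]
      linarith
    · have hn' : (1 : ℝ) ≤ n := by exact_mod_cast hn
      have := aux_rpow_diff hn' hx0 hx1 h1 h2
      simp only [hn.ne', if_false, zero_add]
      have h5 := abs_nonneg (((n : ℝ) + x) ^ (-s) - (n + 1 - x) ^ (-s))
      linarith
  have hlim : Tendsto (fun s : ℝ => ∑' n, t s n) (𝓝[>] 1) (𝓝 (∑' n, t 1 n)) := by
    apply tendsto_tsum_of_dominated_convergence hbs
    · intro n
      apply Tendsto.mono_left _ nhdsWithin_le_nhds
      have e1 : (n : ℝ) + x ≠ 0 := by positivity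
      have e2 : (n : ℝ) + 1 - x ≠ 0 := by
        have : (0 : ℝ) ≤ n := by positivity
        linarith
      have : Continuous (fun s : ℝ => t s n) := by
        apply Complex.continuous_ofReal.comp
        apply Continuous.div_const
        apply Continuous.sub
        · exact Continuous.rpow continuous_const continuous_neg (fun _ => Or.inl e1)
        · exact Continuous.rpow continuous_const continuous_neg (fun _ => Or.inl e2)
      exact this.tendsto 1
    · have : Set.Ioo (1 : ℝ) 2 ∈ 𝓝[>] (1 : ℝ) := Ioo_mem_nhdsGT (by norm_num)
      filter_upwards [this] with s hs n
      exact hbound s hs.1.le hs.2.le n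
  have hlim2 : Tendsto (fun s : ℝ => ∑' n, t s n) (𝓝[>] 1) (𝓝 (hurwitzZetaOdd (x : UnitAddCircle) 1)) := by
    have h1 : Tendsto (fun s : ℝ => hurwitzZetaOdd (x : UnitAddCircle) (s : ℂ)) (𝓝[>] 1)
        (𝓝 (hurwitzZetaOdd (x : UnitAddCircle) ((1 : ℝ) : ℂ))) := by
      apply Tendsto.mono_left _ nhdsWithin_le_nhds
      exact ((differentiable_hurwitzZetaOdd _).continuous.comp Complex.continuous_ofReal).tendsto 1
    rw [Complex.ofReal_one] at h1
    apply h1.congr'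
    filter_upwards [self_mem_nhdsWithin] with s hs
    exact (hsum s hs).tsum_eq.symm
  rw [tendsto_nhds_unique hlim2 hlim]
  -- evaluate
  have hsm : Summable (t 1) := Summable.of_norm_bounded hbs (hbound 1 le_rfl (by norm_num))
  have hxc : (x : ℂ) ∈ Complex.integerComplement := by
    rintro ⟨k, hk⟩
    have hk' : (k : ℝ) = x := by exact_mod_cast hk
    rw [← hk'] at hx0 hx1
    have h0 : (0 : ℤ) < k := by exact_mod_cast hx0
    have h1 : k < (1 : ℤ) := by exact_mod_cast hx1
    omega
  have hcot := tendsto_logDeriv_euler_cot_sub hxc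
  have ht1 := hsm.hasSum.tendsto_sum_nat.comp (tendsto_add_atTop_nat 1)
  have hpart : ∀ n : ℕ, ∑ i ∈ Finset.range (n + 1), t 1 i =
      (1 / (x : ℂ) + ∑ j ∈ Finset.range n, cotTerm x j) / 2 - 1 / (2 * ((n : ℂ) + 1 - x)) := by
    have hne : ∀ n : ℕ, ((n : ℂ) + 1 - x) ≠ 0 := fun n h => by
      have : ((n : ℝ) + 1 - x) = 0 := by exact_mod_cast h
      have h0 : (0 : ℝ) ≤ n := by positivity
      linarith
    have hne2 : ∀ n : ℕ, ((n : ℂ) + x) ≠ 0 := fun n h => by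
      have : ((n : ℝ) + x) = 0 := by exact_mod_cast h
      have h0 : (0 : ℝ) ≤ n := by positivity
      linarith
    have htv : ∀ n : ℕ, t 1 n = (1 / ((n : ℂ) + x) - 1 / ((n : ℂ) + 1 - x)) / 2 := by
      intro n
      simp only [ht, Real.rpow_neg_one]; push_cast; simp
    intro n
    induction n with
    | zero =>
      simp only [zero_add, Finset.range_one, Finset.sum_singleton, htv, Finset.range_zero, Finset.sum_empty]
      have a := hne 0; have b := hne2 0
      simp only [Nat.cast_zero, zero_add] at a b ⊢
      field_simp
      ring
    | succ n ih =>
      rw [Finset.sum_range_succ, ih, Finset.sum_range_succ, htv]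
      have a := hne n; have b := hne2 (n+1); have c := hne (n+1)
      have d := hne2 0
      simp only [cotTerm]
      push_cast at *
      have a' : (x : ℂ) - (n + 1) ≠ 0 := by
        intro h; apply a; rw [← neg_eq_zero, ← h]; ring
      have b' : (x : ℂ) + (n + 1) ≠ 0 := by
        intro h; apply b; rw [← h]; ring
      have e1 : 1 / ((x : ℂ) - (n + 1)) = - (1 / ((n : ℂ) + 1 - x)) := by
        rw [← neg_sub, div_neg]
      have e2 : 1 / ((x : ℂ) + (n + 1)) = 1 / ((n : ℂ) + 1 + x) := by rw [add_comm]
      have e3 : ∀ z : ℂ, 1 / (2 * z) = (1 / z) / 2 := fun z => by rw [one_div, mul_inv]; ring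
      rw [e1, e2, e3, e3]
      ring
  have hz : Tendsto (fun n : ℕ => 1 / (2 * ((n : ℂ) + 1 - x))) atTop (𝓝 0) := by
    have h1 : Tendsto (fun n : ℕ => (1 / (2 * ((n : ℝ) + 1 - x)))) atTop (𝓝 0) := by
      apply Tendsto.div_atTop tendsto_const_nhds
      apply Tendsto.const_mul_atTop (by norm_num)
      have : Tendsto (fun n : ℕ => (n : ℝ) + (1 - x)) atTop atTop :=
        tendsto_atTop_add_const_right _ _ tendsto_natCast_atTop_atTop
      refine this.congr fun n => by ring
    have h2 := (Complex.continuous_ofReal.tendsto 0).comp h1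
    simp only [Complex.ofReal_zero] at h2
    refine h2.congr fun n => ?_
    simp
  have hR : Tendsto (fun n : ℕ => ∑ i ∈ Finset.range (n + 1), t 1 i) atTop
      (𝓝 ((1 / (x : ℂ) + (Real.pi * Complex.cot (Real.pi * x) - 1 / x)) / 2 - 0)) := by
    simp_rw [hpart]
    exact ((hcot.const_add _).div_const 2).sub hz
  rw [tendsto_nhds_unique ht1 hR]
  ring
end PartA

section PartB
open ZMod Complex DirichletCharacter

lemma geom_aux {z : ℂ} (d : ℕ) (hz : z ^ d = 1) (hz1 : z ≠ 1) :
    ∑ b ∈ Finset.range d, (b : ℂ) * z ^ b = d / (z - 1) := by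
  have key : ∀ n : ℕ, (z - 1) * ∑ b ∈ Finset.range n, (b : ℂ) * z ^ b
      = n * z ^ n - z * ∑ b ∈ Finset.range n, z ^ b := by
    intro n
    induction n with
    | zero => simp
    | succ n ih =>
      rw [Finset.sum_range_succ, mul_add, ih, Finset.sum_range_succ]
      push_cast; ring
  have h1 : z - 1 ≠ 0 := sub_ne_zero.2 hz1
  have h2 : ∑ b ∈ Finset.range d, z ^ b = 0 := by
    rw [geom_sum_eq hz1, hz]; simp
  have := key d
  rw [h2, hz] at this
  field_simp
  rw [mul_comm]; rw [this]; ring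

lemma sum_val_range {d : ℕ} [NeZero d] (g : ℕ → ℂ) :
    ∑ b : ZMod d, g b.val = ∑ b ∈ Finset.range d, g b := by
  rw [← Fin.sum_univ_eq_sum_range]
  obtain ⟨n, rfl⟩ : ∃ n, d = n + 1 := ⟨d - 1, by have := NeZero.pos d; omega⟩
  rfl

lemma L_one_norm {d : ℕ} [NeZero d] (hd : 1 < d) (χ : DirichletCharacter ℂ d) (hprim : χ.IsPrimitive)
    (hodd : χ.Odd) (hinv : χ⁻¹ = χ) :
    ‖χ.LFunction 1‖ * (d * Real.sqrt d) = Real.pi * ‖∑ b : ZMod d, χ b * (b.val : ℂ)‖ := by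
  set τ := gaussSum χ stdAddChar with hτ
  have hχn : ∀ a, χ (-a) = - χ a := fun a => by
    rw [hodd.eval_neg]
  have hF : ∀ a, dft (χ : ZMod d → ℂ) a = - τ * χ a := by
    intro a
    rw [hprim.fourierTransform_eq_inv_mul_gaussSum, hinv, hχn]; ring
  have hττ : τ ^ 2 = - d := by
    have h1 := congrFun (dft_dft (χ : ZMod d → ℂ)) 1
    have h2 : dft (χ : ZMod d → ℂ) = fun a => - τ * χ a := funext hF
    rw [h2, ZMod.dft_const_mul] at h1
    simp only [hF, hχn, map_one] at h1
    have : τ ^ 2 = -(τ * (-(τ * 1))) := by ring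
    simp only [smul_eq_mul, mul_one] at h1
    linear_combination h1
  have hτn : ‖τ‖ = Real.sqrt d := by
    have : ‖τ‖ ^ 2 = d := by rw [← norm_pow, hττ]; simp
    rw [← this, Real.sqrt_sq (norm_nonneg _)]
  have hτ0 : τ ≠ 0 := by
    intro h; rw [h] at hττ
    have : (d : ℂ) ≠ 0 := by exact_mod_cast NeZero.ne d
    apply this; linear_combination hττ
  set c : ZMod d → ℂ := fun a => Complex.cot (Real.pi * ((a.val : ℝ) / (d : ℝ) : ℝ)) with hc
  have hχ0 : χ 0 = 0 := by
    apply MulChar.map_nonunit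
    have : Fact (1 < d) := ⟨hd⟩
    simp
  have hL : χ.LFunction 1 = (d : ℂ)⁻¹ * (Real.pi / 2 * ∑ a, χ a * c a) := by
    rw [DirichletCharacter.LFunction, ZMod.LFunction_def_odd (fun a => hχn a)]
    rw [Complex.cpow_neg_one]
    congr 1
    rw [Finset.mul_sum]
    apply Finset.sum_congr rfl
    intro a _
    by_cases ha : a = 0
    · rw [ha, hχ0]; ring
    · rw [toAddCircle_apply, hurwitzOdd_one]
      · simp only [hc]; push_cast; ring
      · have : 0 < a.val := Nat.pos_of_ne_zero (by rwa [Ne, ZMod.val_eq_zero])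
        have := NeZero.pos d
        positivity
      · have := NeZero.pos d
        rw [div_lt_one (by positivity)]
        exact_mod_cast ZMod.val_lt a
  have hsum0 : ∑ a, χ a = 0 := by
    have h1 : ∑ a, χ a = ∑ a, χ (-a) := (Equiv.sum_comp (Equiv.neg (ZMod d)) χ).symm
    simp only [hχn, Finset.sum_neg_distrib] at h1
    linear_combination h1 / 2
  have hb : ∀ a : ZMod d, a ≠ 0 → ∑ b : ZMod d, (b.val : ℂ) * stdAddChar (a * b) = d * (-1/2 - I / 2 * c a) := by
    intro a ha
    set z : ℂ := stdAddChar a with hz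
    have hz1 : z ≠ 1 := by
      intro h
      apply ha
      have := ZMod.injective_stdAddChar (N := d)
      apply this
      rw [← hz, h, AddChar.map_zero_eq_one]
    have hzd : z ^ d = 1 := by
      rw [hz, ← AddChar.map_nsmul_eq_pow]; simp
    have h1 : ∀ b : ZMod d, (b.val : ℂ) * stdAddChar (a * b) = (fun n : ℕ => (n : ℂ) * z ^ n) b.val := by
      intro b
      simp only
      rw [hz, ← AddChar.map_nsmul_eq_pow, nsmul_eq_mul, ZMod.natCast_zmod_val, mul_comm a b]
    rw [Finset.sum_congr rfl (fun b _ => h1 b), sum_val_range (fun n : ℕ => (n : ℂ) * z ^ n), geom_aux d hzd hz1]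
    have h2 : c a = (z + 1) / (I * (1 - z)) := by
      simp only [hc]
      rw [Complex.cot_pi_eq_exp_ratio]
      have : z = Complex.exp (2 * Real.pi * I * ((a.val : ℝ) / (d : ℝ) : ℝ)) := by
        have h3 := ZMod.stdAddChar_coe (N := d) (a.val : ℤ)
        rw [hz]
        simp only [Int.cast_natCast, ZMod.natCast_zmod_val] at h3
        rw [h3]; push_cast
        congr 1; ring
      rw [this]
    rw [h2]
    have h3 : z - 1 ≠ 0 := sub_ne_zero.2 hz1
    have h4 : 1 - z ≠ 0 := sub_ne_zero.2 (Ne.symm hz1)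
    field_simp
    have : (1 - z)  = - (z - 1) := by ring
    ring
  have hS : (- τ) * ∑ b : ZMod d, χ b * (b.val : ℂ) = d * (I / 2) * ∑ a, χ a * c a := by
    have h1 : (- τ) * ∑ b : ZMod d, χ b * (b.val : ℂ) =
        ∑ b : ZMod d, ∑ a : ZMod d, χ a * ((b.val : ℂ) * stdAddChar (-a * b)) := by
      rw [Finset.mul_sum]
      apply Finset.sum_congr rfl
      intro b _
      rw [← mul_assoc, ← hF, dft_apply, Finset.sum_mul]
      apply Finset.sum_congr rfl
      intro a _
      simp only [smul_eq_mul, neg_mul]; ring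
    rw [h1, Finset.sum_comm]
    simp_rw [← Finset.mul_sum]
    rw [← Equiv.sum_comp (Equiv.neg (ZMod d))]
    have h2 : ∀ a : ZMod d, χ (-a) * ∑ b : ZMod d, (b.val : ℂ) * stdAddChar (-(-a) * b)
        = d / 2 * χ a + d * (I / 2) * (χ a * c a) := by
      intro a
      by_cases ha : a = 0
      · subst ha; simp [hχ0]
      · rw [neg_neg, hb a ha, hχn]; ring
    simp only [Equiv.neg_apply]
    rw [Finset.sum_congr rfl (fun a _ => h2 a), Finset.sum_add_distrib, ← Finset.mul_sum, hsum0,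
      ← Finset.mul_sum]
    ring
  have hd0 : (0 : ℝ) < d := by exact_mod_cast NeZero.pos d
  have hS' := congrArg norm hS
  rw [hL]
  simp only [norm_mul, norm_neg, hτn, norm_div, norm_I, norm_inv, Complex.norm_natCast, Complex.norm_real, Real.norm_eq_abs, abs_of_pos Real.pi_pos, Complex.norm_ofNat] at hS' ⊢
  set A := ‖∑ a, χ a * c a‖
  set B := ‖∑ b : ZMod d, χ b * (b.val : ℂ)‖
  have hs : Real.sqrt d * Real.sqrt d = d := Real.mul_self_sqrt hd0.le
  have hs0 : 0 < Real.sqrt d := Real.sqrt_pos.2 hd0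
  have hA : A = 2 * B / Real.sqrt d := by
    field_simp
    have h9 : Real.sqrt d * (Real.sqrt d * A) = Real.sqrt d * (2 * B) := by
      rw [← mul_assoc, hs]; linarith
    have := mul_left_cancel₀ hs0.ne' h9
    linarith
  rw [hA]; field_simp
end PartB

section PartC
open NumberTheorySymbols

lemma jacobi_val (d : ℕ) [NeZero d] (a : ℤ) : J(((a : ZMod d).val : ℤ) | d) = J(a | d) := by
  rw [ZMod.val_intCast, ← jacobiSym.mod_left]

noncomputable def jchi (d : ℕ) [NeZero d] : DirichletCharacter ℂ d where
  toFun a := ((J((a.val : ℤ) | d) : ℤ) : ℂ)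
  map_one' := by
    have := jacobi_val d 1
    rw [Int.cast_one] at this
    rw [this, jacobiSym.one_left]; simp
  map_mul' a b := by
    rw [ZMod.val_mul]
    push_cast
    rw [← jacobiSym.mod_left, jacobiSym.mul_left]; push_cast; rfl
  map_nonunit' a ha := by
    have : J((a.val : ℤ) | d) = 0 := by
      rw [jacobiSym.eq_zero_iff_not_coprime]
      intro h
      apply ha
      have h2 : a.val.Coprime d := by rw [Int.gcd_natCast_natCast] at h; exact h
      have := (ZMod.isUnit_iff_coprime a.val d).2 h2
      rwa [ZMod.natCast_zmod_val] at this
    change ((J((a.val : ℤ) | d) : ℤ) : ℂ) = 0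
    rw [this]; simp

lemma jchi_apply (d : ℕ) [NeZero d] (a : ZMod d) : jchi d a = ((J((a.val : ℤ) | d) : ℤ) : ℂ) := rfl

lemma jchi_int (d : ℕ) [NeZero d] (a : ℤ) : jchi d (a : ZMod d) = ((J(a | d) : ℤ) : ℂ) := by
  rw [jchi_apply, jacobi_val]

lemma jchi_nat (d : ℕ) [NeZero d] (a : ℕ) : jchi d (a : ZMod d) = ((J((a : ℤ) | d) : ℤ) : ℂ) := by
  rw [← jchi_int]; simp

lemma jchi_odd (d : ℕ) [NeZero d] (h : d % 4 = 3) : (jchi d).Odd := by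
  have h1 := jchi_int d (-1)
  rw [jacobiSym.at_neg_one (Nat.odd_iff.2 (by omega)), ZMod.χ₄_nat_three_mod_four h] at h1
  simpa [DirichletCharacter.Odd] using h1

lemma jchi_inv (d : ℕ) [NeZero d] : (jchi d)⁻¹ = jchi d := by
  apply MulChar.IsQuadratic.inv
  intro a
  rw [jchi_apply]
  rcases jacobiSym.trichotomy (a.val : ℤ) d with h | h | h <;> rw [h] <;> simp

lemma exists_u {p₁ p₂ : ℕ} (hp₁ : p₁.Prime) (hp₂ : p₂.Prime) (hne : p₁ ≠ p₂) (h2 : p₂ ≠ 2) :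
    ∃ u : ℤ, J(u | p₁ * p₂) = -1 ∧ (u : ZMod p₁) = 1 := by
  have := Fact.mk hp₁
  have := Fact.mk hp₂
  obtain ⟨a, ha⟩ := quadraticChar_exists_neg_one (F := ZMod p₂) (by rwa [ZMod.ringChar_zmod_n])
  obtain ⟨k, hk1, hk2⟩ := Nat.chineseRemainder ((Nat.coprime_primes hp₁ hp₂).2 hne) 1 a.val
  refine ⟨k, ?_, ?_⟩
  · rw [jacobiSym.mul_right, ← jacobiSym.legendreSym.to_jacobiSym,
      ← jacobiSym.legendreSym.to_jacobiSym, legendreSym, legendreSym]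
    have e1 : ((k : ℤ) : ZMod p₁) = 1 := by
      have := (ZMod.natCast_eq_natCast_iff _ _ _).2 hk1
      simpa using this
    have e2 : ((k : ℤ) : ZMod p₂) = a := by
      have := (ZMod.natCast_eq_natCast_iff _ _ _).2 hk2
      simpa using this
    rw [e1, e2, ha]; simp
  · have := (ZMod.natCast_eq_natCast_iff _ _ _).2 hk1
    simpa using this

lemma jchi_prim_aux {p₁ p₂ d : ℕ} [NeZero d] (hd : d = p₁ * p₂) (hp₁ : p₁.Prime) (hp₂ : p₂.Prime) (hne : p₁ ≠ p₂) (h2 : p₂ ≠ 2)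
     (c : ℕ) (hc : (jchi d).FactorsThrough c) (hdv : c ∣ p₁) : False := by
  obtain ⟨u, hu1, hu2⟩ := exists_u hp₁ hp₂ hne h2
  obtain ⟨hcd, χ₀, h0⟩ := hc
  have hu1' : J(u | d) = -1 := by rw [hd]; exact hu1
  have h3 := jchi_int d u
  have hun : IsUnit (u : ZMod d) := by
    by_contra hn
    rw [MulChar.map_nonunit _ hn, hu1'] at h3
    simp at h3
  obtain ⟨v, hv⟩ := hun
  rw [← hv, h0, DirichletCharacter.changeLevel_eq_cast_of_dvd, hv, hu1'] at h3
  have h4 : ((u : ZMod d).cast : ZMod c) = 1 := by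
    have e : ((u : ZMod d).cast : ZMod c) = (u : ZMod c) := ZMod.cast_intCast hcd u
    rw [e]
    have e2 := congrArg (ZMod.castHom hdv (ZMod c)) hu2
    rw [map_one, map_intCast] at e2
    exact e2
  rw [h4] at h3
  simp at h3
  norm_num at h3

lemma jchi_prim {p₁ p₂ d : ℕ} [NeZero d] (hd : d = p₁ * p₂) (hp₁ : p₁.Prime) (hp₂ : p₂.Prime) (hne : p₁ ≠ p₂)
    (h1 : p₁ ≠ 2) (h2 : p₂ ≠ 2) : (jchi d).IsPrimitive := by
  have hf := (jchi d).factorsThrough_conductor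
  have hdv : (jchi d).conductor ∣ p₁ * p₂ := hd ▸ (jchi d).conductor_dvd_level
  rw [DirichletCharacter.isPrimitive_def]
  set c := (jchi d).conductor
  by_cases hc1 : p₁ ∣ c
  · by_cases hc2 : p₂ ∣ c
    · apply Nat.dvd_antisymm
      · rw [hd]; exact hdv
      · rw [hd]
        exact Nat.Coprime.mul_dvd_of_dvd_of_dvd ((Nat.coprime_primes hp₁ hp₂).2 hne) hc1 hc2
    · exact (jchi_prim_aux hd hp₁ hp₂ hne h2 c hf
        (Nat.Coprime.dvd_of_dvd_mul_right ((Nat.Prime.coprime_iff_not_dvd hp₂).2 hc2).symm hdv)).elim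
  · exact (jchi_prim_aux (hd.trans (mul_comm _ _)) hp₂ hp₁ hne.symm h1 c hf
        (Nat.Coprime.dvd_of_dvd_mul_left ((Nat.Prime.coprime_iff_not_dvd hp₁).2 hc1).symm hdv)).elim

/-- The bound on the character sum in terms of `L(1,χ)`. -/
lemma jsum_eq_L {p₁ p₂ d : ℕ} [NeZero d] (hd : d = p₁ * p₂) (hp₁ : p₁.Prime) (hp₂ : p₂.Prime) 
    (h3 : d % 4 = 3) :
    ‖(jchi d).LFunction 1‖ * (d * Real.sqrt d) =
      Real.pi * |((∑ b ∈ Finset.range d, J((b : ℤ) | d) * (b : ℤ) : ℤ) : ℝ)| := by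
  have hne : p₁ ≠ p₂ := by
    rintro rfl
    rw [hd, Nat.mul_mod] at h3
    have : p₁ % 4 < 4 := Nat.mod_lt _ (by norm_num)
    interval_cases p₁ % 4 <;> omega
  have h1 : p₁ ≠ 2 := by rintro rfl; omega
  have h2 : p₂ ≠ 2 := by rintro rfl; omega
  rw [L_one_norm (by have := hp₁.two_le; have := hp₂.two_le; rw [hd]; nlinarith) _
    (jchi_prim hd hp₁ hp₂ hne h1 h2) (jchi_odd d h3) (jchi_inv d)]
  congr 1
  have : ∑ b : ZMod d, jchi d b * (b.val : ℂ) = (((∑ b ∈ Finset.range d, J((b : ℤ) | d) * (b : ℤ) : ℤ) : ℝ) : ℂ) := by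
    simp_rw [jchi_apply]
    rw [sum_val_range (fun n : ℕ => ((J((n : ℤ) | d) : ℤ) : ℂ) * (n : ℂ))]
    push_cast; rfl
  rw [this, Complex.norm_real, Real.norm_eq_abs]
end PartC

section PartD
open NumberField Ideal

variable {K : Type*} [Field K] [NumberField K]

noncomputable def idc (K : Type*) [Field K] [NumberField K] (n : ℕ) : ℕ := Nat.card {I : Ideal (𝓞 K) // absNorm I = n}

instance idfin (n : ℕ) : Finite {I : Ideal (𝓞 K) // absNorm I = n} :=
  finite_setOfPred_absNorm_eq n

lemma idc_supermul {m n : ℕ} (h : m.Coprime n) : idc K m * idc K n ≤ idc K (m * n) := by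
  unfold idc
  rw [← Nat.card_prod]
  have key : ∀ I J : Ideal (𝓞 K), absNorm I = m → absNorm J = n →
      I = I * J ⊔ Ideal.span {(m : 𝓞 K)} := by
    intro I J hI hJ
    apply le_antisymm
    · have h1 : J ⊔ Ideal.span {(m : 𝓞 K)} = ⊤ := by
        rw [Ideal.eq_top_iff_one]
        have h2 : IsCoprime (n : ℤ) (m : ℤ) := Nat.isCoprime_iff_coprime.2 h.symm
        obtain ⟨a, b, hab⟩ := h2
        have h3 : (1 : 𝓞 K) = a * n + b * m := by exact_mod_cast hab.symm
        rw [h3]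
        apply Submodule.add_mem_sup
        · apply Ideal.mul_mem_left
          rw [← hJ]; exact absNorm_mem J
        · apply Ideal.mul_mem_left
          exact Ideal.mem_span_singleton_self _
      calc I = I * (J ⊔ Ideal.span {(m : 𝓞 K)}) := by rw [h1, Ideal.mul_top]
        _ = I * J ⊔ I * Ideal.span {(m : 𝓞 K)} := Ideal.mul_sup _ _ _
        _ ≤ _ := sup_le_sup_left Ideal.mul_le_right _
    · apply sup_le Ideal.mul_le_left
      rw [← hI]; exact span_singleton_absNorm_le I
  apply Nat.card_le_card_of_injective
    (fun x : {I : Ideal (𝓞 K) // absNorm I = m} × {I : Ideal (𝓞 K) // absNorm I = n} =>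
      (⟨x.1.1 * x.2.1, by rw [map_mul, x.1.2, x.2.2]⟩ : {I : Ideal (𝓞 K) // absNorm I = m * n}))
  rintro ⟨⟨I, hI⟩, ⟨J, hJ⟩⟩ ⟨⟨I', hI'⟩, ⟨J', hJ'⟩⟩ heq
  simp only [Subtype.mk.injEq] at heq
  have e1 : I = I' := by rw [key I J hI hJ, key I' J' hI' hJ', heq]
  have e2 : J = J' := by
    have k1 : ∀ I J : Ideal (𝓞 K), absNorm I = m → absNorm J = n →
      J = I * J ⊔ Ideal.span {(n : 𝓞 K)} := by
      intro I J hI hJ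
      apply le_antisymm
      · have h1 : I ⊔ Ideal.span {(n : 𝓞 K)} = ⊤ := by
          rw [Ideal.eq_top_iff_one]
          have h2 : IsCoprime (m : ℤ) (n : ℤ) := Nat.isCoprime_iff_coprime.2 h
          obtain ⟨a, b, hab⟩ := h2
          have h3 : (1 : 𝓞 K) = a * m + b * n := by exact_mod_cast hab.symm
          rw [h3]
          apply Submodule.add_mem_sup
          · apply Ideal.mul_mem_left
            rw [← hI]; exact absNorm_mem I
          · apply Ideal.mul_mem_left
            exact Ideal.mem_span_singleton_self _
        calc J = (I ⊔ Ideal.span {(n : 𝓞 K)}) * J := by rw [h1, Ideal.top_mul]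
          _ = I * J ⊔ Ideal.span {(n : 𝓞 K)} * J := Ideal.sup_mul _ _ _
          _ ≤ _ := sup_le_sup_left Ideal.mul_le_left _
      · apply sup_le Ideal.mul_le_right
        rw [← hJ]; exact span_singleton_absNorm_le J
    rw [k1 I J hI hJ, k1 I' J' hI' hJ', heq]
  subst e1; subst e2; rfl

lemma idc_pos_of {n : ℕ} (I : Ideal (𝓞 K)) (h : absNorm I = n) : 1 ≤ idc K n := by
  unfold idc
  have : Nonempty {I : Ideal (𝓞 K) // absNorm I = n} := ⟨⟨I, h⟩⟩
  exact Nat.card_pos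

lemma norm_span_pair {ℓ : ℕ} (hℓ : ℓ.Prime) (h2 : Module.finrank ℚ K = 2) {β β' : 𝓞 K}
    (hmul : (ℓ : 𝓞 K) ∣ β * β') (hβ : ¬ (ℓ : 𝓞 K) ∣ β) (hβ' : ¬ (ℓ : 𝓞 K) ∣ β') :
    absNorm (Ideal.span {(ℓ : 𝓞 K), β}) = ℓ := by
  set I := Ideal.span {(ℓ : 𝓞 K), β} with hI
  have hle : Ideal.span {(ℓ : 𝓞 K)} ≤ I := Ideal.span_mono (by simp)
  have hn : absNorm (Ideal.span {(ℓ : 𝓞 K)}) = ℓ ^ 2 := by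
    rw [absNorm_span_natCast, RingOfIntegers.rank, h2]
  have hdvd : absNorm I ∣ ℓ ^ 2 := hn ▸ absNorm_dvd_absNorm_of_le hle
  obtain ⟨k, hk, hk2⟩ := (Nat.dvd_prime_pow hℓ).1 hdvd
  have : k = 0 ∨ k = 1 ∨ k = 2 := by omega
  rcases this with rfl | rfl | rfl
  · exfalso
    rw [pow_zero, absNorm_eq_one_iff, Ideal.eq_top_iff_one, hI, Ideal.mem_span_pair] at hk2
    obtain ⟨a, b, hab⟩ := hk2
    apply hβ'
    have : β' = ℓ * (a * β') + b * (β * β') := by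
      linear_combination - β' * hab
    rw [this]
    exact dvd_add (dvd_mul_right _ _) (hmul.mul_left _)
  · simpa using hk2
  · exfalso
    obtain ⟨J, hJ⟩ := Ideal.dvd_iff_le.2 hle
    rw [hJ, map_mul, hk2] at hn
    have hJ1 : absNorm J = 1 := by
      have : 0 < ℓ ^ 2 := pow_pos hℓ.pos 2
      exact Nat.eq_of_mul_eq_mul_left this (by rw [hn, mul_one])
    rw [absNorm_eq_one_iff] at hJ1
    rw [hJ1, Ideal.mul_top] at hJ
    apply hβ
    rw [← Ideal.mem_span_singleton, hJ, hI]
    exact Ideal.subset_span (by simp)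

lemma idc_split {ℓ : ℕ} (hℓ : ℓ.Prime) {P Q : Ideal (𝓞 K)} (hP : absNorm P = ℓ) (hQ : absNorm Q = ℓ)
    (hne : P ≠ Q) (k : ℕ) : k + 1 ≤ idc K (ℓ ^ k) := by
  have hPp : P.IsPrime := isPrime_of_irreducible_absNorm (by rw [hP]; exact hℓ)
  have hQp : Q.IsPrime := isPrime_of_irreducible_absNorm (by rw [hQ]; exact hℓ)
  have hP0 : P ≠ ⊥ := by rintro rfl; simp at hP; exact hℓ.ne_zero hP.symm
  have hQ0 : Q ≠ ⊥ := by rintro rfl; simp at hQ; exact hℓ.ne_zero hQ.symm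
  have hQm : Q.IsMaximal := hQp.isMaximal hQ0
  have key : ∀ i j : ℕ, i < j → j ≤ k → P ^ i * Q ^ (k - i) ≠ P ^ j * Q ^ (k - j) := by
    intro i j hij hj h
    have hji : j - i ≠ 0 := by omega
    have e : P ^ j = P ^ i * P ^ (j - i) := by rw [← pow_add]; congr 1; omega
    rw [e, mul_assoc] at h
    have h1 := mul_left_cancel₀ (pow_ne_zero i (by simpa using hP0)) h
    have h2 : Q ^ (k - i) ≤ P := by
      rw [h1]
      refine Ideal.mul_le_left.trans (Ideal.pow_le_self hji)
    have h3 : Q ≤ P := hPp.le_of_pow_le h2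
    exact hne (hQm.eq_of_le hPp.ne_top h3).symm
  have : Nat.card (Fin (k + 1)) ≤ idc K (ℓ ^ k) := by
    apply Nat.card_le_card_of_injective (fun i : Fin (k+1) =>
      (⟨P ^ (i : ℕ) * Q ^ (k - i), by
        rw [map_mul, map_pow, map_pow, hP, hQ, ← pow_add]; congr 1; omega⟩ :
        {I : Ideal (𝓞 K) // absNorm I = ℓ ^ k}))
    intro i j h
    simp only [Subtype.mk.injEq] at h
    by_contra hij
    rcases lt_or_gt_of_ne hij with h' | h'
    · exact key i j h' (by omega) h
    · exact key j i h' (by omega) h.symm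
  simpa using this
end PartD

section PartE
open NumberField Ideal

variable {K : Type*} [Field K] [NumberField K]

lemma quad_exists_ab {d : ℕ} {α : K} (hα : α ^ 2 = -(d : K)) (hK : Algebra.adjoin ℚ {α} = ⊤) (x : K) :
    ∃ a b : ℚ, x = a + b * α := by
  have hx : x ∈ Algebra.adjoin ℚ {α} := hK ▸ Algebra.mem_top
  induction hx using Algebra.adjoin_induction with
  | mem x h => exact ⟨0, 1, by simp [Set.mem_singleton_iff.1 h]⟩
  | algebraMap r => exact ⟨r, 0, by simp⟩
  | add x y _ _ hx hy =>
    obtain ⟨a, b, rfl⟩ := hx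
    obtain ⟨a', b', rfl⟩ := hy
    exact ⟨a + a', b + b', by push_cast; ring⟩
  | mul x y _ _ hx hy =>
    obtain ⟨a, b, rfl⟩ := hx
    obtain ⟨a', b', rfl⟩ := hy
    exact ⟨a * a' - b * b' * d, a * b' + a' * b, by
      push_cast; linear_combination (b : K) * b' * hα⟩

lemma emb_conj {d : ℕ} (hd : 0 < d) {α : K} (hα : α ^ 2 = -(d : K)) (φ : K →+* ℂ) :
    (starRingEnd ℂ) (φ α) = - φ α := by
  have h1 : (φ α) ^ 2 = -(d : ℂ) := by rw [← map_pow, hα]; simp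
  have h2 : ((starRingEnd ℂ) (φ α)) ^ 2 = (φ α) ^ 2 := by
    rw [← map_pow, h1]; simp
  rcases sq_eq_sq_iff_eq_or_eq_neg.1 h2 with h | h
  · exfalso
    obtain ⟨r, hr⟩ := Complex.conj_eq_iff_real.1 h
    rw [hr] at h1
    have h3 : r ^ 2 = -(d : ℝ) := by exact_mod_cast h1
    have h4 : (0 : ℝ) < d := by exact_mod_cast hd
    nlinarith [sq_nonneg r]
  · exact h

lemma quad_ne_rat {d : ℕ} (hd : 0 < d) {α : K} (hα : α ^ 2 = -(d : K)) (a : ℚ) : α ≠ a := by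
  rintro rfl
  have h3 : a ^ 2 = -(d : ℚ) := by exact_mod_cast hα
  have h4 : (0 : ℚ) < d := by exact_mod_cast hd
  nlinarith [sq_nonneg a]

lemma quad_basis {d : ℕ} (hd : 0 < d) {α : K} (hα : α ^ 2 = -(d : K)) (hK : Algebra.adjoin ℚ {α} = ⊤) :
    ∃ b : Module.Basis (Fin 2) ℚ K, b 0 = 1 ∧ b 1 = α := by
  have hli : LinearIndependent ℚ ![(1 : K), α] := by
    rw [LinearIndependent.pair_iff]
    intro s t hst
    have ht : t = 0 := by
      by_contra ht
      apply quad_ne_rat hd hα (-s / t)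
      have ht' : (t : K) ≠ 0 := by exact_mod_cast ht
      rw [Rat.smul_def, Rat.smul_def, mul_one] at hst
      push_cast
      field_simp
      linear_combination hst
    subst ht
    refine ⟨?_, rfl⟩
    rw [zero_smul, add_zero, Rat.smul_def, mul_one] at hst
    exact_mod_cast hst
  have hsp : ⊤ ≤ Submodule.span ℚ (Set.range ![(1 : K), α]) := by
    intro x _
    obtain ⟨a, b, rfl⟩ := quad_exists_ab hα hK x
    simp only [Matrix.range_cons, Matrix.range_empty, Set.union_empty]
    rw [Set.singleton_union, Submodule.mem_span_pair]
    exact ⟨a, b, by simp [Rat.smul_def]⟩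
  refine ⟨Module.Basis.mk hli hsp, ?_, ?_⟩ <;> simp

lemma quad_finrank {d : ℕ} (hd : 0 < d) {α : K} (hα : α ^ 2 = -(d : K)) (hK : Algebra.adjoin ℚ {α} = ⊤) :
    Module.finrank ℚ K = 2 := by
  obtain ⟨b, -, -⟩ := quad_basis hd hα hK
  rw [Module.finrank_eq_card_basis b]; simp

lemma quad_trace {d : ℕ} (hd : 0 < d) {α : K} (hα : α ^ 2 = -(d : K)) (hK : Algebra.adjoin ℚ {α} = ⊤) :
    Algebra.trace ℚ K α = 0 := by
  obtain ⟨b, h0, h1⟩ := quad_basis hd hα hK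
  rw [Algebra.trace_eq_matrix_trace b, Matrix.trace_fin_two, Algebra.leftMulMatrix_eq_repr_mul,
    Algebra.leftMulMatrix_eq_repr_mul, h0, h1, mul_one]
  nth_rewrite 1 [← h1]
  have : α * α = (-(d : ℚ)) • b 0 := by
    rw [h0, Rat.smul_def]; push_cast; rw [← hα]; ring
  rw [this, map_smul]
  simp

lemma quad_integral {d : ℕ} (hd : 0 < d) {α : K} (hα : α ^ 2 = -(d : K)) (y : 𝓞 K) {a b : ℚ}
    (hy : (y : K) = a + b * α) : ∃ n : ℤ, 2 * a = n := by
  obtain ⟨φ⟩ : Nonempty (K →+* ℂ) := inferInstance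
  have h1 : IsIntegral ℤ (φ (y : K)) := map_isIntegral_int φ y.isIntegral_coe
  have h2 : IsIntegral ℤ ((starRingEnd ℂ) (φ (y : K))) := map_isIntegral_int (starRingEnd ℂ) h1
  have h3 := h1.add h2
  rw [hy, map_add, map_mul, map_add, map_mul, emb_conj hd hα φ] at h3
  simp only [map_ratCast] at h3
  have h4 : IsIntegral ℤ (((2 * a : ℚ)) : ℂ) := by
    have e : (((2 * a : ℚ)) : ℂ) = ↑a + ↑b * φ α + (↑a + ↑b * -φ α) := by push_cast; ring
    rw [e]; exact h3
  have h5 : IsIntegral ℤ (2 * a : ℚ) := by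
    have := (isIntegral_algebraMap_iff (A := ℚ) (B := ℂ) (R := ℤ) (x := 2 * a) (algebraMap ℚ ℂ).injective).1
    apply this; simpa using h4
  obtain ⟨n, hn⟩ := IsIntegrallyClosed.isIntegral_iff.1 h5
  exact ⟨n, by rw [← hn]; simp⟩

lemma quad_alphaO {d : ℕ} {α : K} (hα : α ^ 2 = -(d : K)) : ∃ A : 𝓞 K, (A : K) = α ∧ A ^ 2 = -(d : 𝓞 K) := by
  have hi : IsIntegral ℤ α := by
    apply IsIntegral.of_pow (n := 2) (by norm_num)
    rw [hα]
    have := isIntegral_algebraMap (R := ℤ) (A := K) (x := -(d : ℤ))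
    simpa using this
  obtain ⟨A, hA⟩ : ∃ A : 𝓞 K, (A : K) = α := ⟨⟨α, hi⟩, rfl⟩
  refine ⟨A, hA, ?_⟩
  have : algebraMap (𝓞 K) K (A ^ 2) = algebraMap (𝓞 K) K (-(d : 𝓞 K)) := by
    have hA' : algebraMap (𝓞 K) K A = α := hA
    rw [map_pow, hA', hα]; simp
  exact RingOfIntegers.ext this

lemma quad_places {d : ℕ} (hd : 0 < d) {α : K} (hα : α ^ 2 = -(d : K)) (hK : Algebra.adjoin ℚ {α} = ⊤) :
    InfinitePlace.nrRealPlaces K = 0 ∧ InfinitePlace.nrComplexPlaces K = 1 := by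
  have h0 : InfinitePlace.nrRealPlaces K = 0 := by
    rw [nrRealPlaces_eq_zero_iff]
    refine ⟨fun w => ?_⟩
    rw [← InfinitePlace.not_isReal_iff_isComplex]
    rintro ⟨φ, hφ, -⟩
    have h1 := RingHom.congr_fun hφ α
    have h2 : (starRingEnd ℂ) (φ α) = φ α := h1
    rw [emb_conj hd hα] at h2
    have h3 : φ α = 0 := by linear_combination -h2/2
    have h4 : α = 0 := by simpa using h3
    exact quad_ne_rat hd hα 0 (by simpa using h4)
  refine ⟨h0, ?_⟩
  have := InfinitePlace.card_add_two_mul_card_eq_rank K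
  rw [h0, quad_finrank hd hα hK] at this
  omega

lemma quad_regulator {d : ℕ} (hd : 0 < d) {α : K} (hα : α ^ 2 = -(d : K)) (hK : Algebra.adjoin ℚ {α} = ⊤) :
    Units.regulator K = 1 := by
  obtain ⟨h1, h2⟩ := quad_places hd hα hK
  have hc : Fintype.card (InfinitePlace K) = 1 := by
    rw [InfinitePlace.card_eq_nrRealPlaces_add_nrComplexPlaces, h1, h2]
  have hr : Units.rank K = 0 := by
    rw [Units.rank, hc]
  have : IsEmpty (Fin (Units.rank K)) := by rw [hr]; infer_instance
  rw [Units.regulator_eq_regOfFamily_fundSystem, Units.regOfFamily_eq_det']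
  have : IsEmpty {w : InfinitePlace K // w ≠ Units.dirichletUnitTheorem.w₀} :=
    (Units.equivFinRank K).symm.isEmpty
  rw [Matrix.det_isEmpty]; simp

lemma quad_discr {d : ℕ} (hd : 0 < d) (hsq : Squarefree d) {α : K} (hα : α ^ 2 = -(d : K)) (hK : Algebra.adjoin ℚ {α} = ⊤) :
    (d : ℤ) ≤ |discr K| := by
  obtain ⟨A, hA, hA2⟩ := quad_alphaO hα
  have h2 := quad_finrank hd hα hK
  have hcard : Fintype.card (Module.Free.ChooseBasisIndex ℤ (𝓞 K)) = 2 := by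
    rw [← Module.finrank_eq_card_basis (RingOfIntegers.basis K), RingOfIntegers.rank, h2]
  set B := (RingOfIntegers.basis K).reindex (Fintype.equivFinOfCardEq hcard)
  have hB := discr_eq_discr K B
  set v : Fin 2 → 𝓞 K := ![1, A] with hv
  have hvB : v = Matrix.vecMul (⇑B) ((B.toMatrix v).map (algebraMap ℤ (𝓞 K))) := by
    ext1 j
    rw [Matrix.vecMul, dotProduct]
    conv_lhs => rw [← B.sum_toMatrix_smul_self v j]
    apply Finset.sum_congr rfl
    intro i _
    rw [Matrix.map_apply, Algebra.smul_def, mul_comm]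
  have h3 := Algebra.discr_of_matrix_vecMul (A := ℤ) (⇑B) (B.toMatrix v)
  rw [← hvB, hB] at h3
  have ht : ∀ x : 𝓞 K, ((Algebra.trace ℤ (𝓞 K) x : ℤ) : ℚ) = Algebra.trace ℚ K x := fun x => Algebra.coe_trace_int x
  have t1 : Algebra.trace ℤ (𝓞 K) 1 = 2 := by
    have := ht 1
    have h9 := Algebra.trace_algebraMap (R := ℚ) (S := K) 1
    rw [map_one, h2] at h9
    change _ = Algebra.trace ℚ K 1 at this
    rw [h9] at this
    have h10 : ((2 • (1:ℚ))) = ((2 : ℤ) : ℚ) := by norm_num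
    rw [h10] at this
    exact_mod_cast this
  have tA : Algebra.trace ℤ (𝓞 K) A = 0 := by
    have := ht A
    rw [hA, quad_trace hd hα hK] at this
    exact_mod_cast this
  have tAA : Algebra.trace ℤ (𝓞 K) (A * A) = - 2 * d := by
    have e : A * A = (-(d : ℤ)) • (1 : 𝓞 K) := by
      rw [← pow_two, hA2]; simp
    rw [e, map_smul, t1]; simp; ring
  have h4 : Algebra.discr ℤ v = -4 * d := by
    rw [Algebra.discr_def, Matrix.det_fin_two]
    simp only [Algebra.traceMatrix_apply, Algebra.traceForm_apply, hv]
    simp [t1, tA, tAA]; ring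
  rw [h4] at h3
  set t := (B.toMatrix v).det
  have h5 : (4 * d : ℤ) = t ^ 2 * |discr K| := by
    have := congrArg abs h3
    rw [abs_mul, abs_mul, abs_pow, sq_abs] at this
    simpa using this
  rcases Int.even_or_odd' t with ⟨s, hs | hs⟩
  · rw [hs] at h5
    have h6 : (d : ℤ) = s * s * |discr K| := by nlinarith
    have hu : IsUnit s := (Int.squarefree_natCast.2 hsq) s ⟨_, h6⟩
    rcases Int.isUnit_iff.1 hu with h | h <;> rw [h] at h6 <;> linarith
  · have h7 : t * t ∣ (d : ℤ) := by
      have h8 : t * t ∣ 4 * (d : ℤ) := ⟨|discr K|, by rw [h5]; ring⟩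
      have hc : IsCoprime (t * t) (4 : ℤ) := by
        have : IsCoprime t 2 := by
          refine ⟨1, -s, by rw [hs]; ring⟩
        have h9 : IsCoprime t (2 * 2) := IsCoprime.mul_right this this
        norm_num at h9
        exact IsCoprime.mul_left h9 h9
      exact hc.dvd_of_dvd_mul_left h8
    have hu : IsUnit t := (Int.squarefree_natCast.2 hsq) t h7
    rcases Int.isUnit_iff.1 hu with h | h <;> rw [h] at h5 <;> linarith
end PartE

section PartF
open NumberField Ideal NumberTheorySymbols

variable {K : Type*} [Field K] [NumberField K]

lemma not_dvd_aux {d : ℕ} (hd : 0 < d) {α : K} (hα : α ^ 2 = -(d : K)) {ℓ : ℕ} (hℓ : ℓ.Prime)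
    (x : 𝓞 K) (r t : ℚ) (hx : (x : K) = r + t * α) (hr : ∀ n : ℤ, 2 * r ≠ n * ℓ) : ¬ (ℓ : 𝓞 K) ∣ x := by
  rintro ⟨y, hy⟩
  have hℓ0 : (ℓ : K) ≠ 0 := by exact_mod_cast hℓ.ne_zero
  have hℓ1 : (ℓ : ℚ) ≠ 0 := by exact_mod_cast hℓ.ne_zero
  have h1 : algebraMap (𝓞 K) K x = ℓ * algebraMap (𝓞 K) K y := by rw [hy, map_mul]; simp
  have h2 : (y : K) = ((r / ℓ : ℚ) : K) + ((t / ℓ : ℚ) : K) * α := by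
    have hx' : algebraMap (𝓞 K) K x = r + t * α := hx
    rw [hx'] at h1
    change algebraMap (𝓞 K) K y = _
    push_cast
    field_simp
    linear_combination -h1
  obtain ⟨n, hn⟩ := quad_integral hd hα y h2
  apply hr n
  field_simp at hn
  linarith

lemma not_dvd_A {d : ℕ} (hsq : Squarefree d) {α : K} {A : 𝓞 K}
    (hA2 : A ^ 2 = -(d : 𝓞 K)) {ℓ : ℕ} (hℓ : ℓ.Prime) (h2 : Module.finrank ℚ K = 2) : ¬ (ℓ : 𝓞 K) ∣ A := by
  rintro ⟨y, hy⟩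
  have h1 : (ℓ ^ 2 : 𝓞 K) ∣ (d : 𝓞 K) := by
    refine ⟨- y ^ 2, ?_⟩
    rw [hy] at hA2; linear_combination hA2
  have h3 : absNorm (Ideal.span {((ℓ ^ 2 : ℕ) : 𝓞 K)}) ∣ absNorm (Ideal.span {(d : 𝓞 K)}) := by
    apply absNorm_dvd_absNorm_of_le
    rw [Ideal.span_singleton_le_span_singleton]
    simpa using h1
  rw [absNorm_span_natCast, absNorm_span_natCast, RingOfIntegers.rank, h2] at h3
  have h4 : ℓ ^ 2 ∣ d := (Nat.pow_dvd_pow_iff (by norm_num)).1 h3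
  rw [pow_two] at h4
  have := Nat.isUnit_iff.1 (hsq ℓ h4)
  exact hℓ.one_lt.ne' this

lemma exists_split_odd {d : ℕ} (hd : 0 < d) (h3 : d % 4 = 3) {α : K} (hα : α ^ 2 = -(d : K))
    (hK : Algebra.adjoin ℚ {α} = ⊤) {ℓ : ℕ} (hℓ : ℓ.Prime) (hℓ2 : ℓ ≠ 2) (hJ : J((ℓ : ℤ) | d) = 1) :
    ∃ P Q : Ideal (𝓞 K), absNorm P = ℓ ∧ absNorm Q = ℓ ∧ P ≠ Q := by
  obtain ⟨A, hA, hA2⟩ := quad_alphaO hα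
  have hf := quad_finrank hd hα hK
  have := Fact.mk hℓ
  have hodd : ℓ % 2 = 1 := hℓ.eq_two_or_odd.resolve_left hℓ2
  have hL : J(-(d : ℤ) | ℓ) = 1 := by
    rw [← neg_one_mul, jacobiSym.mul_left, jacobiSym.at_neg_one (Nat.odd_iff.2 hodd)]
    have : ℓ % 4 = 1 ∨ ℓ % 4 = 3 := by omega
    rcases this with h | h
    · rw [ZMod.χ₄_nat_one_mod_four h, one_mul, ← hJ]
      exact (jacobiSym.quadratic_reciprocity_one_mod_four h (Nat.odd_iff.2 (by omega))).symm
    · have h5 := jacobiSym.quadratic_reciprocity_three_mod_four h h3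
      rw [hJ] at h5
      rw [ZMod.χ₄_nat_three_mod_four h]; linarith
  rw [← jacobiSym.legendreSym.to_jacobiSym] at hL
  have h0 : ((-(d : ℤ) : ℤ) : ZMod ℓ) ≠ 0 := by
    intro h
    rw [legendreSym, h] at hL; simp at hL
  rw [legendreSym.eq_one_iff ℓ h0] at hL
  obtain ⟨s', hs'⟩ := hL
  obtain ⟨s, rfl⟩ : ∃ s : ℤ, (s : ZMod ℓ) = s' := ⟨s'.val, by simp⟩
  have hdv : (ℓ : ℤ) ∣ s * s + d := by
    rw [← ZMod.intCast_zmod_eq_zero_iff_dvd]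
    push_cast at hs' ⊢
    rw [← hs']; ring
  have hns : ¬ (ℓ : ℤ) ∣ s := by
    intro h
    apply h0
    rw [hs']
    rw [(ZMod.intCast_zmod_eq_zero_iff_dvd s ℓ).2 h]; simp
  have hn2s : ¬ (ℓ : ℤ) ∣ 2 * s := by
    intro h
    rcases (Nat.prime_iff_prime_int.1 hℓ).dvd_or_dvd h with h | h
    · have := Int.le_of_dvd (by norm_num) h
      have := hℓ.two_le
      omega
    · exact hns h
  have hA' : algebraMap (𝓞 K) K A = α := hA
  have hd1 : ¬ (ℓ : 𝓞 K) ∣ A - (s : 𝓞 K) := by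
    apply not_dvd_aux hd hα hℓ _ (-s) 1
    · change algebraMap (𝓞 K) K _ = _
      rw [map_sub, hA']; simp; ring
    · intro n hn
      apply hn2s
      refine ⟨-n, ?_⟩
      have : (2 * -s : ℤ) = n * ℓ := by exact_mod_cast hn
      linarith
  have hd2 : ¬ (ℓ : 𝓞 K) ∣ A + (s : 𝓞 K) := by
    apply not_dvd_aux hd hα hℓ _ (s) 1
    · change algebraMap (𝓞 K) K _ = _
      rw [map_add, hA']; simp; ring
    · intro n hn
      apply hn2s
      refine ⟨n, ?_⟩
      have : (2 * s : ℤ) = n * ℓ := by exact_mod_cast hn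
      linarith
  have hm : (ℓ : 𝓞 K) ∣ (A - s) * (A + s) := by
    obtain ⟨c, hc⟩ := hdv
    refine ⟨-(c : 𝓞 K), ?_⟩
    have hc' : (s : 𝓞 K) * s + d = ℓ * c := by exact_mod_cast hc
    linear_combination hA2 - hc'
  refine ⟨_, _, norm_span_pair hℓ hf hm hd1 hd2, norm_span_pair hℓ hf (mul_comm (A - (s : 𝓞 K)) (A + s) ▸ hm) hd2 hd1, ?_⟩
  intro heq
  have hN := norm_span_pair hℓ hf hm hd1 hd2
  set P := Ideal.span {(ℓ : 𝓞 K), A - (s : 𝓞 K)} with hP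
  have m1 : A - (s : 𝓞 K) ∈ P := Ideal.subset_span (by simp)
  have m2 : A + (s : 𝓞 K) ∈ P := by rw [heq]; exact Ideal.subset_span (by simp)
  have m3 : (ℓ : 𝓞 K) ∈ P := Ideal.subset_span (by simp)
  have hcop : IsCoprime (2 * s) (ℓ : ℤ) :=
    ((Nat.prime_iff_prime_int.1 hℓ).coprime_iff_not_dvd.2 hn2s).symm
  obtain ⟨a, b, hab⟩ := hcop
  have : (1 : 𝓞 K) ∈ P := by
    have e : (1 : 𝓞 K) = a * ((A + s) - (A - s)) + b * ℓ := by
      have : ((1 : ℤ) : 𝓞 K) = ((a * (2 * s) + b * ℓ : ℤ) : 𝓞 K) := by rw [hab]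
      push_cast at this
      rw [this]; ring
    rw [e]
    exact P.add_mem (P.mul_mem_left _ (P.sub_mem m2 m1)) (P.mul_mem_left _ m3)
  rw [(Ideal.eq_top_iff_one P).2 this, absNorm_top] at hN
  exact hℓ.one_lt.ne hN

lemma exists_split_two {d : ℕ} (hd : 0 < d) (h7 : d % 8 = 7) {α : K} (hα : α ^ 2 = -(d : K))
    (hK : Algebra.adjoin ℚ {α} = ⊤) :
    ∃ P Q : Ideal (𝓞 K), absNorm P = 2 ∧ absNorm Q = 2 ∧ P ≠ Q := by
  have hf := quad_finrank hd hα hK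
  obtain ⟨k, hk⟩ : ∃ k : ℕ, d + 1 = 8 * k := ⟨(d + 1) / 8, by omega⟩
  have hkK : (d : K) + 1 = 8 * k := by exact_mod_cast hk
  have hw : ((1 + α) / 2) ^ 2 - (1 + α) / 2 + 2 * k = 0 := by
    field_simp
    linear_combination hα - hkK
  have hi : IsIntegral ℤ ((1 + α) / 2) := by
    refine ⟨Polynomial.X ^ 2 - Polynomial.X + Polynomial.C (2 * k : ℤ), ?_, ?_⟩
    · monicity!
    · simp only [Polynomial.eval₂_add, Polynomial.eval₂_sub, Polynomial.eval₂_pow, Polynomial.eval₂_X, Polynomial.eval₂_C]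
      rw [← hw]; simp
  obtain ⟨W, hW⟩ : ∃ W : 𝓞 K, (W : K) = (1 + α) / 2 := ⟨⟨_, hi⟩, rfl⟩
  have hW' : algebraMap (𝓞 K) K W = (1 + α) / 2 := hW
  have hW2 : W * (W - 1) = ((2 : ℕ) : 𝓞 K) * (- k) := by
    have : algebraMap (𝓞 K) K (W * (W - 1)) = algebraMap (𝓞 K) K (((2 : ℕ) : 𝓞 K) * (- k)) := by
      simp only [map_mul, map_sub, map_one, hW', map_neg, map_natCast]
      push_cast
      linear_combination hw
    exact RingOfIntegers.ext this
  have hd1 : ¬ ((2 : ℕ) : 𝓞 K) ∣ W := by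
    apply not_dvd_aux hd hα Nat.prime_two _ (1/2) (1/2)
    · change algebraMap (𝓞 K) K _ = _
      rw [hW']; push_cast; ring
    · intro n hn
      have : (1 : ℤ) = n * 2 := by
        have h : (1 : ℚ) = n * 2 := by push_cast at hn; linarith
        exact_mod_cast h
      omega
  have hd2 : ¬ ((2 : ℕ) : 𝓞 K) ∣ W - 1 := by
    apply not_dvd_aux hd hα Nat.prime_two _ (-1/2) (1/2)
    · change algebraMap (𝓞 K) K _ = _
      rw [map_sub, hW']; push_cast; simp; ring
    · intro n hn
      have : (-1 : ℤ) = n * 2 := by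
        have h : (-1 : ℚ) = n * 2 := by push_cast at hn; linarith
        exact_mod_cast h
      omega
  have hm : ((2 : ℕ) : 𝓞 K) ∣ W * (W - 1) := ⟨_, hW2⟩
  have hm' : ((2 : ℕ) : 𝓞 K) ∣ (W - 1) * W := by rw [mul_comm]; exact hm
  refine ⟨_, _, norm_span_pair Nat.prime_two hf hm hd1 hd2, norm_span_pair Nat.prime_two hf hm' hd2 hd1, ?_⟩
  intro heq
  have hN := norm_span_pair Nat.prime_two hf hm hd1 hd2
  set P := Ideal.span {((2 : ℕ) : 𝓞 K), W} with hP
  have m1 : W ∈ P := Ideal.subset_span (by simp)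
  have m2 : W - 1 ∈ P := by rw [heq]; exact Ideal.subset_span (by simp)
  have : (1 : 𝓞 K) ∈ P := by
    have e : (1 : 𝓞 K) = W - (W - 1) := by ring
    rw [e]; exact P.sub_mem m1 m2
  rw [(Ideal.eq_top_iff_one P).2 this, absNorm_top] at hN
  norm_num at hN

lemma zetaMul_pp {d : ℕ} [NeZero d] {ℓ : ℕ} (hℓ : ℓ.Prime) (k : ℕ) :
    (jchi d).zetaMul (ℓ ^ k) = ∑ i ∈ Finset.range (k + 1), ((J((ℓ : ℤ) | d) : ℤ) : ℂ) ^ i := by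
  simp only [DirichletCharacter.zetaMul, ArithmeticFunction.coe_zeta_mul_apply, Nat.sum_divisors_prime_pow hℓ]
  apply Finset.sum_congr rfl
  intro i _
  have : (ℓ ^ i) ≠ 0 := pow_ne_zero _ hℓ.ne_zero
  simp only [toArithmeticFunction, ArithmeticFunction.coe_mk, this, if_false]
  rw [← jchi_nat, ← map_pow]; push_cast; rfl

lemma coeff_bound_pp {d : ℕ} [NeZero d] (hsq : Squarefree d) (h3 : d % 4 = 3) {α : K} (hα : α ^ 2 = -(d : K))
    (hK : Algebra.adjoin ℚ {α} = ⊤) {ℓ : ℕ} (hℓ : ℓ.Prime) (k : ℕ) :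
    ‖(jchi d).zetaMul (ℓ ^ k)‖ ≤ idc K (ℓ ^ k) := by
  have hd : 0 < d := NeZero.pos d
  have hf := quad_finrank hd hα hK
  rw [zetaMul_pp hℓ]
  rcases jacobiSym.trichotomy (ℓ : ℤ) d with h | h | h
  · rw [h]
    have e : ‖∑ i ∈ Finset.range (k + 1), (((0 : ℤ) : ℂ)) ^ i‖ = 1 := by
      rw [Finset.sum_range_succ']; simp
    rw [e]
    obtain ⟨A, hA, hA2⟩ := quad_alphaO hα
    rw [jacobiSym.eq_zero_iff_not_coprime] at h
    have hdv : ℓ ∣ d := by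
      by_contra hn
      apply h
      rw [Int.gcd_natCast_natCast]
      exact (Nat.Prime.coprime_iff_not_dvd hℓ).2 hn
    have hnd := not_dvd_A (α := α) hsq hA2 hℓ hf
    have hm : (ℓ : 𝓞 K) ∣ A * A := by
      obtain ⟨c, hc⟩ := hdv
      refine ⟨-(c : 𝓞 K), ?_⟩
      rw [← pow_two, hA2, hc]; push_cast; ring
    have hP := norm_span_pair hℓ hf hm hnd hnd
    have := idc_pos_of (n := ℓ ^ k) ((Ideal.span {(ℓ : 𝓞 K), A}) ^ k) (by rw [map_pow, hP])
    exact_mod_cast this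
  · have hPQ : ∃ P Q : Ideal (𝓞 K), absNorm P = ℓ ∧ absNorm Q = ℓ ∧ P ≠ Q := by
      by_cases h2 : ℓ = 2
      · subst h2
        apply exists_split_two hd _ hα hK
        have h8 := jacobiSym.at_two (b := d) (Nat.odd_iff.2 (by omega))
        push_cast at h
        rw [h, ZMod.χ₈_nat_eq_if_mod_eight] at h8
        have : d % 8 = 3 ∨ d % 8 = 7 := by omega
        rcases this with h' | h'
        · exfalso
          have : ¬ (d % 2 = 0) := by omega
          simp [this, h'] at h8
        · exact h'
      · exact exists_split_odd hd h3 hα hK hℓ h2 h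
    obtain ⟨P, Q, hP, hQ, hne⟩ := hPQ
    have := idc_split hℓ hP hQ hne k
    rw [h]
    simp only [Int.cast_one, one_pow, Finset.sum_const, Finset.card_range, nsmul_eq_mul, mul_one]
    rw [Complex.norm_natCast]
    exact_mod_cast this
  · rw [h]
    push_cast
    rw [neg_one_geom_sum]
    split_ifs with hk
    · simp
    · have hk2 : Even k := by
        rw [Nat.even_add_one] at hk; push Not at hk; exact hk
      obtain ⟨j, hj⟩ := hk2
      have := idc_pos_of (n := ℓ ^ k) (Ideal.span {((ℓ ^ j : ℕ) : 𝓞 K)}) (by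
        rw [absNorm_span_natCast, RingOfIntegers.rank, hf, ← pow_mul, hj]; congr 1; ring)
      simp only [norm_one]
      exact_mod_cast this

lemma coeff_bound {d : ℕ} [NeZero d] (hsq : Squarefree d) (h3 : d % 4 = 3) {α : K} (hα : α ^ 2 = -(d : K))
    (hK : Algebra.adjoin ℚ {α} = ⊤) (n : ℕ) :
    ‖(jchi d).zetaMul n‖ ≤ idc K n := by
  induction n using Nat.recOnPosPrimePosCoprime with
  | prime_pow ℓ k hℓ _ => exact coeff_bound_pp hsq h3 hα hK hℓ k
  | zero => simp
  | one => 
    have := coeff_bound_pp hsq h3 hα hK Nat.prime_two 0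
    simpa using this
  | coprime a b ha hb hab iha ihb =>
    rw [(jchi d).isMultiplicative_zetaMul.map_mul_of_coprime hab, norm_mul]
    calc _ ≤ (idc K a : ℝ) * idc K b := mul_le_mul iha ihb (norm_nonneg _) (by positivity)
      _ ≤ _ := by exact_mod_cast idc_supermul hab
end PartF

section PartG
open NumberField Ideal NumberTheorySymbols Filter Topology

variable {K : Type*} [Field K] [NumberField K]

lemma zetaMul_LSeries {d : ℕ} [NeZero d] (χ : DirichletCharacter ℂ d) {s : ℂ} (hs : 1 < s.re) :
    riemannZeta s * χ.LFunction s = LSeries χ.zetaMul s := by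
  rw [DirichletCharacter.zetaMul, ← ArithmeticFunction.coe_mul, LSeries_convolution']
  · rw [χ.LFunction_eq_LSeries hs]
    congr 1
    · simp_rw [← ArithmeticFunction.LSeries_zeta_eq_riemannZeta hs, ← ArithmeticFunction.natCoe_apply]
    · exact LSeries_congr χ.apply_eq_toArithmeticFunction_apply s
  · exact ArithmeticFunction.LSeriesSummable_zeta_iff.mpr hs
  · exact (LSeriesSummable_congr _ fun h ↦ (χ.apply_eq_toArithmeticFunction_apply h).symm).mpr <|
      ZMod.LSeriesSummable_of_one_lt_re χ hs

lemma dedekind_norm (s : ℝ) (hsum : LSeriesSummable (fun n ↦ (idc K n : ℂ)) s) {g : ℕ → ℂ}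
    (hg : ∀ n, ‖g n‖ ≤ idc K n) : ‖LSeries g s‖ ≤ ‖dedekindZeta K s‖ := by
  set r : ℕ → ℝ := fun n => if n = 0 then 0 else (idc K n : ℝ) / (n : ℝ) ^ s with hr
  have hr0 : ∀ n, 0 ≤ r n := by
    intro n; simp only [hr]; split_ifs
    · exact le_rfl
    · positivity
  have h1 : ∀ n, LSeries.term (fun n ↦ (idc K n : ℂ)) s n = ((r n : ℝ) : ℂ) := by
    intro n
    rw [LSeries.term_def]
    simp only [hr]
    split_ifs
    · simp
    · push_cast
      rw [Complex.ofReal_cpow (by positivity)]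
      simp
  have h2 : Summable r := by
    have : Summable (fun n => ((r n : ℝ) : ℂ)) := by
      have h := hsum
      unfold LSeriesSummable at h
      exact h.congr (fun n => (h1 n))
    exact Complex.summable_ofReal.1 this
  have h3 : dedekindZeta K s = ((∑' n, r n : ℝ) : ℂ) := by
    rw [Complex.ofReal_tsum]
    change LSeries (fun n ↦ (idc K n : ℂ)) s = _
    unfold LSeries
    exact tsum_congr h1
  rw [h3, Complex.norm_real, Real.norm_of_nonneg (tsum_nonneg hr0)]
  apply tsum_of_norm_bounded h2.hasSum
  intro n
  have h4 := LSeries.norm_term_le (f := g) (g := fun n ↦ (idc K n : ℂ)) s (n := n) (by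
    rw [Complex.norm_natCast]; exact hg n)
  rw [h1, Complex.norm_real, Real.norm_of_nonneg (hr0 n)] at h4
  exact h4

lemma L_le_residue {d : ℕ} [NeZero d] (hsq : Squarefree d) (h3 : d % 4 = 3) {α : K} (hα : α ^ 2 = -(d : K))
    (hK : Algebra.adjoin ℚ {α} = ⊤) (hne : jchi d ≠ 1) :
    ‖(jchi d).LFunction 1‖ ≤ dedekindZeta_residue K := by
  have t1 := (tendsto_sub_one_mul_dedekindZeta_nhdsGT K)
  have hc : Tendsto (fun s : ℝ => (s : ℂ)) (𝓝[>] 1) (𝓝[≠] 1) := by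
    apply tendsto_nhdsWithin_of_tendsto_nhds_of_eventually_within
    · have : Tendsto (fun s : ℝ => (s : ℂ)) (𝓝 1) (𝓝 ((1 : ℝ) : ℂ)) := Complex.continuous_ofReal.tendsto 1
      rw [Complex.ofReal_one] at this
      exact this.mono_left nhdsWithin_le_nhds
    · filter_upwards [self_mem_nhdsWithin] with s hs
      have : s ≠ 1 := ne_of_gt hs
      simpa using this
  have t2 := riemannZeta_residue_one.comp hc
  have t3 : Tendsto (fun s : ℝ => (jchi d).LFunction s) (𝓝[>] 1) (𝓝 ((jchi d).LFunction 1)) := by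
    have := ((DirichletCharacter.differentiable_LFunction hne).continuous.tendsto 1)
    exact (this.mono_left nhdsWithin_le_nhds).comp hc
  have t4 := (t2.mul t3).norm
  have t5 := t1.norm
  rw [one_mul] at t4
  rw [Complex.norm_real, Real.norm_of_nonneg (dedekindZeta_residue_pos K).le] at t5
  refine le_of_tendsto_of_tendsto t4 t5 ?_
  have hnz := t1.eventually_ne (Complex.ofReal_ne_zero.2 (dedekindZeta_residue_ne_zero K))
  filter_upwards [self_mem_nhdsWithin, hnz] with s hs hs2
  have hsum : LSeriesSummable (fun n ↦ (idc K n : ℂ)) s := by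
    by_contra hns
    apply hs2
    have : dedekindZeta K s = 0 := tsum_eq_zero_of_not_summable hns
    rw [this, mul_zero]
  have hs1 : 1 < (s : ℂ).re := by simpa using hs
  simp only [Function.comp_apply]
  rw [mul_assoc, zetaMul_LSeries _ hs1, norm_mul, norm_mul]
  exact mul_le_mul_of_nonneg_left (dedekind_norm s hsum (coeff_bound hsq h3 hα hK)) (norm_nonneg _)

theorem class_bound {p₁ p₂ d : ℕ} (hd : d = p₁ * p₂) (hp₁ : p₁.Prime) (hp₂ : p₂.Prime)
    (h3 : d % 4 = 3) {α : K} (hα : α ^ 2 = -(d : K)) (hK : Algebra.adjoin ℚ {α} = ⊤) :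
    |∑ b ∈ Finset.range d, J((b : ℤ) | d) * (b : ℤ)| ≤ d * classNumber K := by
  have hd0 : 0 < d := by omega
  have : NeZero d := ⟨hd0.ne'⟩
  have hne12 : p₁ ≠ p₂ := by
    rintro rfl
    have : p₁ % 4 = 0 ∨ p₁ % 4 = 1 ∨ p₁ % 4 = 2 ∨ p₁ % 4 = 3 := by omega
    rw [hd, Nat.mul_mod] at h3
    rcases this with h | h | h | h <;> rw [h] at h3 <;> norm_num at h3
  have hsq : Squarefree d := by
    rw [hd, Nat.squarefree_mul ((Nat.coprime_primes hp₁ hp₂).2 hne12)]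
    exact ⟨hp₁.prime.squarefree, hp₂.prime.squarefree⟩
  have hne : jchi d ≠ 1 := by
    intro h
    have ho : jchi d (-1) = -1 := jchi_odd (d := d) h3
    rw [h, MulChar.one_apply (isUnit_one.neg)] at ho
    norm_num at ho
  have h1 := L_le_residue hsq h3 hα hK hne
  have h2 := jsum_eq_L hd hp₁ hp₂ h3
  obtain ⟨hr, hc⟩ := quad_places hd0 hα hK
  rw [dedekindZeta_residue_def, hr, hc, quad_regulator hd0 hα hK] at h1
  have h4 := quad_discr hd0 hsq hα hK
  have hw : 2 ≤ Units.torsionOrder K := by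
    have := Units.even_torsionOrder K
    have := Units.torsionOrder_pos K
    obtain ⟨k, hk⟩ := Units.even_torsionOrder K
    omega
  set S := ∑ b ∈ Finset.range d, J((b : ℤ) | d) * (b : ℤ) with hS
  have h4' : (d : ℝ) ≤ ((|discr K| : ℤ) : ℝ) := by exact_mod_cast h4
  have hsd : 0 < Real.sqrt d := Real.sqrt_pos.2 (by exact_mod_cast hd0)
  have h5 : ‖(jchi d).LFunction 1‖ ≤ Real.pi * classNumber K / Real.sqrt d := by
    refine h1.trans ?_
    have hw' : (2 : ℝ) ≤ Units.torsionOrder K := by exact_mod_cast hw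
    have hq : Real.sqrt d ≤ Real.sqrt ((|discr K| : ℤ) : ℝ) := Real.sqrt_le_sqrt h4'
    have hq0 : 2 * Real.sqrt d ≤ Units.torsionOrder K * Real.sqrt ((|discr K| : ℤ) : ℝ) :=
      mul_le_mul hw' hq hsd.le (by positivity)
    rw [show Real.pi * classNumber K / Real.sqrt d = (2 ^ 0 * (2 * Real.pi) ^ 1 * 1 * classNumber K) / (2 * Real.sqrt d) by
      field_simp]
    push_cast at hq0 ⊢
    gcongr
  have h6 : Real.pi * |((S : ℤ) : ℝ)| ≤ Real.pi * (d * classNumber K) := by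
    rw [← h2]
    calc _ ≤ (Real.pi * classNumber K / Real.sqrt d) * (d * Real.sqrt d) := by gcongr
      _ = _ := by field_simp
  have h7 := le_of_mul_le_mul_left h6 Real.pi_pos
  exact_mod_cast h7
end PartG

section PartH
open Polynomial

variable (E : Type*) [NormedField E] [IsUltrametricDist E]

noncomputable abbrev VV : ValuationSubring E := (NormedField.valuation (K := E)).valuationSubring

variable {E}

lemma mem_VV (x : E) : x ∈ VV E ↔ ‖x‖ ≤ 1 := by
  rw [Valuation.mem_valuationSubring_iff, NormedField.valuation_apply]
  rfl

lemma res_ne_zero_iff (x : VV E) : IsLocalRing.residue (VV E) x ≠ 0 ↔ ‖(x : E)‖ = 1 := by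
  rw [IsLocalRing.residue_ne_zero_iff_isUnit, ValuationSubring.valuation_eq_one_iff (VV E) x]
  have h1 := (mem_VV (x : E)).1 x.2
  have h2 : (VV E).valuation x = 1 ↔ NormedField.valuation (x : E) = 1 := by
    exact ((Valuation.isEquiv_valuation_valuationSubring (NormedField.valuation (K := E))).eq_one_iff_eq_one).symm
  rw [h2, NormedField.valuation_apply, ← NNReal.coe_inj]
  rfl

instance res_algClosed [IsAlgClosed E] : IsAlgClosed (IsLocalRing.ResidueField (VV E)) := by
  apply IsAlgClosed.of_exists_root
  intro P hP hirr
  obtain ⟨Q, hQ, hdeg, hQm⟩ := lifts_and_natDegree_eq_and_monic (f := IsLocalRing.residue (VV E)) (p := P)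
    ((mem_lifts P).2 (Polynomial.map_surjective _ IsLocalRing.residue_surjective P)) hP
  have hdE : (Q.map (algebraMap (VV E) E)).degree ≠ 0 := by
    rw [hQm.degree_map, degree_eq_natDegree hQm.ne_zero, hdeg]
    have := hirr.natDegree_pos
    exact_mod_cast this.ne'
  obtain ⟨x, hx⟩ := IsAlgClosed.exists_root _ hdE
  have hi : IsIntegral (VV E) x := ⟨Q, hQm, by rwa [IsRoot.def, eval_map] at hx⟩
  obtain ⟨y, rfl⟩ := IsIntegrallyClosed.isIntegral_iff.1 hi
  refine ⟨IsLocalRing.residue (VV E) y, ?_⟩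
  rw [← hQ, eval_map, eval₂_at_apply]
  have : eval y Q = 0 := by
    rw [IsRoot.def, eval_map, eval₂_at_apply] at hx
    exact (FaithfulSMul.algebraMap_injective (VV E) E) (by rw [hx, map_zero])
  rw [this, map_zero]

lemma res_charP (p : ℕ) [Fact p.Prime] (hp : ‖(p : E)‖ < 1) : CharP (IsLocalRing.ResidueField (VV E)) p := by
  have h : ((p : ℕ) : IsLocalRing.ResidueField (VV E)) = 0 := by
    by_contra hne
    have : IsLocalRing.residue (VV E) (p : VV E) ≠ 0 := by simpa using hne
    rw [res_ne_zero_iff] at this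
    have h2 : ((p : VV E) : E) = (p : E) := by simp
    rw [h2] at this
    linarith
  exact (CharP.charP_iff_prime_eq_zero Fact.out).2 h

lemma teich [IsAlgClosed E] [CharZero E] (p : ℕ) [Fact p.Prime] (hp : ‖(p : E)‖ < 1) (F : Type*) [Field F]
    [Fintype F] [CharP F p] :
    ∃ (ω : MulChar F E) (hω : ∀ x, ω x ∈ VV E) (ι : F →+* IsLocalRing.ResidueField (VV E)),
      ∀ x, IsLocalRing.residue (VV E) ⟨ω x, hω x⟩ = ι x := by
  have := res_charP p hp
  let _ : Algebra (ZMod p) F := ZMod.algebra F p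
  let _ : Algebra (ZMod p) (IsLocalRing.ResidueField (VV E)) := ZMod.algebra _ p
  let ι : F →+* IsLocalRing.ResidueField (VV E) := (IsAlgClosed.lift : F →ₐ[ZMod p] _).toRingHom
  obtain ⟨γ, hγ⟩ := IsCyclic.exists_generator (α := Fˣ)
  set n := Fintype.card Fˣ with hn
  have hn0 : 0 < n := Fintype.card_pos
  have : NeZero n := ⟨hn0.ne'⟩
  obtain ⟨θ₀, hθ₀⟩ := HasEnoughRootsOfUnity.exists_primitiveRoot E n
  have hV : ∀ x : E, x ^ n = 1 → ‖x‖ = 1 := by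
    intro x hx
    have : ‖x‖ ^ n = 1 := by rw [← norm_pow, hx, norm_one]
    exact (pow_eq_one_iff_of_nonneg (norm_nonneg _) hn0.ne').1 this
  have hθV : θ₀ ∈ VV E := (mem_VV _).2 (hV _ hθ₀.pow_eq_one).le
  have hθ' : IsPrimitiveRoot (⟨θ₀, hθV⟩ : VV E) n := IsPrimitiveRoot.coe_submonoidClass_iff.1 hθ₀
  have hprod := X_pow_sub_one_eq_prod hn0 hθ'
  have hprod2 := congrArg (fun P => eval₂ (IsLocalRing.residue (VV E)) (ι γ) P) hprod
  simp only [eval₂_sub, eval₂_pow, eval₂_X, eval₂_one, eval₂_finsetProd, eval₂_C] at hprod2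
  have hγn : (ι γ) ^ n = 1 := by
    rw [← map_pow, ← Units.val_pow_eq_pow_val, pow_card_eq_one]; simp
  rw [hγn, sub_self] at hprod2
  obtain ⟨θ, hθm, hθ⟩ := Finset.prod_eq_zero_iff.1 hprod2.symm
  rw [mem_nthRootsFinset hn0] at hθm
  have hθn : (θ : E) ^ n = 1 := by exact_mod_cast congrArg (Subtype.val) hθm
  let u : Eˣ := Units.ofPowEqOne (θ : E) n hθn hn0.ne'
  have hu : u ∈ rootsOfUnity n E := by
    rw [mem_rootsOfUnity]; ext; simp [u]
  let ω := MulChar.ofRootOfUnity (M := F) hu hγ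
  have hωγ : ω γ = θ := MulChar.ofRootOfUnity_spec hu hγ
  have hωV : ∀ x, ω x ∈ VV E := by
    intro x
    rw [mem_VV]
    by_cases hx : x = 0
    · rw [hx, MulChar.map_zero]; simp
    · apply (hV _ _).le
      rw [← map_pow]
      have : x ^ n = 1 := by rw [hn, Fintype.card_units]; exact FiniteField.pow_card_sub_one_eq_one x hx
      rw [this, map_one]
  refine ⟨ω, hωV, ι, ?_⟩
  intro x
  by_cases hx : x = 0
  · subst hx
    rw [map_zero ι]
    have : (⟨ω 0, hωV 0⟩ : VV E) = 0 := Subtype.ext (MulChar.map_zero ω)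
    rw [this, map_zero]
  · obtain ⟨k, hk⟩ := (mem_powers_iff_mem_zpowers (x := γ) (y := Units.mk0 x hx)).2 (hγ _)
    have hk' : (γ : F) ^ k = x := by
      have := congrArg Units.val hk
      simpa using this
    have : (⟨ω x, hωV x⟩ : VV E) = θ ^ k := by
      apply Subtype.ext
      simp only [← hk', map_pow, hωγ, SubmonoidClass.coe_pow]
    rw [this, map_pow, ← hk', map_pow, sub_eq_zero.1 hθ]
end PartH

section PartI

noncomputable def trF (p : ℕ) [Fact p.Prime] (F : Type*) [Field F] [CharP F p] : F →+ ZMod p :=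
  letI : Algebra (ZMod p) F := ZMod.algebra F p
  (Algebra.trace (ZMod p) F).toAddMonoidHom

lemma trF_smul (p : ℕ) [Fact p.Prime] (F : Type*) [Field F] [CharP F p] (c : ℕ) (x : F) :
    trF p F (c * x) = c * trF p F x := by
  rw [← nsmul_eq_mul, map_nsmul, nsmul_eq_mul]

lemma trF_frob (p : ℕ) [Fact p.Prime] (F : Type*) [Field F] [Fintype F] [CharP F p] (x : F) :
    trF p F (x ^ p) = trF p F x := by
  let _ : Algebra (ZMod p) F := ZMod.algebra F p
  have h := Algebra.trace_eq_of_algEquiv (FiniteField.frobeniusAlgEquivOfAlgebraic (ZMod p) F) x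
  have h2 : FiniteField.frobeniusAlgEquivOfAlgebraic (ZMod p) F x = x ^ p := by
    simp [ZMod.card]
  rw [h2] at h
  exact h

lemma trF_surj (p : ℕ) [Fact p.Prime] (F : Type*) [Field F] [Fintype F] [CharP F p] :
    ∃ x, trF p F x ≠ 0 := by
  let _ : Algebra (ZMod p) F := ZMod.algebra F p
  by_contra! h
  exact Algebra.trace_ne_zero (ZMod p) F (LinearMap.ext h)

lemma trF_sum {p f : ℕ} [Fact p.Prime] {F : Type*} [Field F] [Fintype F] [CharP F p]
    (hc : Fintype.card F = p ^ f) (x : F) :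
    (((trF p F x).val : ℕ) : F) = ∑ i ∈ Finset.range f, x ^ p ^ i := by
  let _ : Algebra (ZMod p) F := ZMod.algebra F p
  have h := FiniteField.algebraMap_trace_eq_sum_pow (ZMod p) F x
  have hf : Module.finrank (ZMod p) F = f := by
    have := Module.card_eq_pow_finrank (K := ZMod p) (V := F)
    rw [hc, ZMod.card] at this
    exact (Nat.pow_right_injective (Fact.out : p.Prime).two_le this).symm
  rw [hf, Nat.card_zmod] at h
  rw [← h]
  have : (((trF p F x).val : ℕ) : F) = algebraMap (ZMod p) F (((trF p F x).val : ℕ) : ZMod p) := (map_natCast _ _).symm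
  rw [this, ZMod.natCast_zmod_val]
  rfl

lemma sum_inv_tr {p f : ℕ} [Fact p.Prime] {F : Type*} [Field F] [Fintype F] [CharP F p]
    (hc : Fintype.card F = p ^ f) (hf : 0 < f) :
    ∑ x : F, x⁻¹ * (((trF p F x).val : ℕ) : F) = -1 := by
  have hp2 := (Fact.out : p.Prime).two_le
  simp_rw [trF_sum hc, Finset.mul_sum]
  rw [Finset.sum_comm, ← Finset.sum_subset (Finset.singleton_subset_iff.2 (Finset.mem_range.2 hf))]
  · rw [Finset.sum_singleton]
    have h0 : ∀ x : F, x⁻¹ * x ^ p ^ 0 = 1 - (if x = 0 then 1 else 0) := by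
      intro x
      split_ifs with hx
      · simp [hx]
      · simp [hx]
    simp_rw [h0]
    rw [Finset.sum_sub_distrib]
    simp [hc, hf.ne']
  · intro i hi hi0
    simp only [Finset.mem_singleton] at hi0
    have h1 : ∀ x : F, x⁻¹ * x ^ p ^ i = x ^ (p ^ i - 1) := by
      intro x
      have h2 : 1 < p ^ i := Nat.one_lt_pow hi0 (by omega)
      by_cases hx : x = 0
      · subst hx; rw [inv_zero, zero_mul, zero_pow (by omega)]
      · rw [inv_mul_eq_iff_eq_mul₀ hx, ← pow_succ']; congr 1; omega
    simp_rw [h1]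
    apply FiniteField.sum_pow_lt_card_sub_one
    rw [hc]
    have h3 : p ^ i < p ^ f := Nat.pow_lt_pow_right (by omega) (Finset.mem_range.1 hi)
    have h2 : 1 ≤ p ^ i := Nat.one_le_pow _ _ (by omega)
    omega

noncomputable def psiF (p : ℕ) [Fact p.Prime] (F : Type*) [Field F] [CharP F p] {E : Type*} [Field E] {ζ : E}
    (hζ : IsPrimitiveRoot ζ p) : AddChar F E :=
  (AddChar.zmodChar p hζ.pow_eq_one).compAddMonoidHom (trF p F)

variable {p : ℕ} [Fact p.Prime] {F : Type*} [Field F] [CharP F p] {E : Type*} [Field E] {ζ : E}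
    (hζ : IsPrimitiveRoot ζ p)

lemma psiF_apply (x : F) : psiF p F hζ x = ζ ^ (trF p F x).val := by
  simp [psiF, AddChar.zmodChar_apply]

lemma psiF_frob [Fintype F] (x : F) : psiF p F hζ (x ^ p) = psiF p F hζ x := by
  rw [psiF_apply, trF_frob, psiF_apply]

lemma psiF_ne_one [Fintype F] : psiF p F hζ ≠ 1 := by
  obtain ⟨x, hx⟩ := trF_surj p F
  intro h
  have h1 : psiF p F hζ x = 1 := by rw [h]; rfl
  rw [psiF_apply] at h1
  have h2 := hζ.dvd_of_pow_eq_one _ h1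
  have h3 := ZMod.val_lt (trF p F x)
  have h4 : (trF p F x).val = 0 := Nat.eq_zero_of_dvd_of_lt h2 h3
  exact hx ((ZMod.val_eq_zero _).1 h4)

lemma psiF_prim [Fintype F] : (psiF p F hζ).IsPrimitive := AddChar.IsPrimitive.of_ne_one (psiF_ne_one hζ)

lemma gauss_frob [Fintype F] (ω : MulChar F E) (k : ℕ) :
    gaussSum (ω ^ (p * k)) (psiF p F hζ) = gaussSum (ω ^ k) (psiF p F hζ) := by
  unfold gaussSum
  rw [← Equiv.sum_comp (frobeniusEquiv F p).toEquiv (fun x => (ω ^ k) x * (psiF p F hζ) x)]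
  apply Finset.sum_congr rfl
  intro x _
  simp only [RingEquiv.toEquiv_eq_coe, EquivLike.coe_coe, frobeniusEquiv_apply, frobenius_def]
  rw [psiF_frob, map_pow, mul_comm p k, pow_mul, MulChar.pow_apply' _ (Fact.out : p.Prime).ne_zero]

end PartI

section PartJ

variable {E : Type*} [NormedField E] [IsUltrametricDist E]

lemma norm_zeta {ζ : E} {n : ℕ} (hn : n ≠ 0) (h : ζ ^ n = 1) : ‖ζ‖ = 1 := by
  have : ‖ζ‖ ^ n = 1 := by rw [← norm_pow, h, norm_one]
  exact (pow_eq_one_iff_of_nonneg (norm_nonneg _) hn).1 this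

lemma ultra_sum {ι : Type*} (s : Finset ι) (f : ι → E) (h : ∀ i ∈ s, ‖f i‖ ≤ 1) : ‖∑ i ∈ s, f i‖ ≤ 1 :=
  IsUltrametricDist.norm_sum_le_of_forall_le_of_nonneg zero_le_one h

lemma norm_one_sub_pow_le {ζ : E} (h : ‖ζ‖ = 1) (i : ℕ) : ‖1 - ζ ^ i‖ ≤ ‖1 - ζ‖ := by
  rw [← mul_neg_geom_sum, norm_mul]
  have : ‖∑ j ∈ Finset.range i, ζ ^ j‖ ≤ 1 := ultra_sum _ _ (fun j _ => by rw [norm_pow, h, one_pow])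
  nlinarith [norm_nonneg (1 - ζ)]

lemma norm_pi {p : ℕ} [Fact p.Prime] {ζ : E} (hζ : IsPrimitiveRoot ζ p) :
    ‖1 - ζ‖ ^ (p - 1) = ‖(p : E)‖ := by
  have hp := (Fact.out : p.Prime)
  have h1 := Polynomial.eval_one_cyclotomic_prime (R := E) (p := p)
  rw [Polynomial.cyclotomic_eq_prod_X_sub_primitiveRoots hζ, Polynomial.eval_prod] at h1
  rw [← h1, norm_prod]
  rw [Finset.prod_congr rfl (g := fun _ => ‖1 - ζ‖)]
  · rw [Finset.prod_const, hζ.card_primitiveRoots, Nat.totient_prime hp]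
  · intro μ hμ
    have hμ' := (mem_primitiveRoots hp.pos).1 hμ
    simp only [Polynomial.eval_sub, Polynomial.eval_X, Polynomial.eval_C]
    obtain ⟨i, _, hi⟩ := hζ.eq_pow_of_pow_eq_one hμ'.pow_eq_one
    obtain ⟨j, _, hj⟩ := hμ'.eq_pow_of_pow_eq_one hζ.pow_eq_one
    apply le_antisymm
    · rw [← hi]; exact norm_one_sub_pow_le (norm_zeta hp.ne_zero hζ.pow_eq_one) i
    · conv_lhs => rw [← hj]
      exact norm_one_sub_pow_le (norm_zeta hp.ne_zero hμ'.pow_eq_one) j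

lemma norm_pi_lt {p : ℕ} [Fact p.Prime] {ζ : E} (hζ : IsPrimitiveRoot ζ p) (hp : ‖(p : E)‖ < 1) :
    ‖1 - ζ‖ < 1 := by
  by_contra! h
  have := one_le_pow₀ h (n := p - 1)
  rw [norm_pi hζ] at this
  linarith

lemma norm_pi_pos {p : ℕ} [Fact p.Prime] {ζ : E} (hζ : IsPrimitiveRoot ζ p) :
    0 < ‖1 - ζ‖ := by
  rw [norm_pos_iff, sub_ne_zero]
  exact (hζ.ne_one (Fact.out : p.Prime).one_lt).symm

lemma zeta_expand {ζ : E} (h : ‖ζ‖ = 1) (t : ℕ) :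
    ∃ r : E, ‖r‖ ≤ 1 ∧ ζ ^ t = 1 - t * (1 - ζ) + (1 - ζ) ^ 2 * r := by
  have hn : ∀ n : ℕ, ‖(n : E)‖ ≤ 1 := fun n => IsUltrametricDist.norm_natCast_le_one E n
  induction t with
  | zero => exact ⟨0, by simp, by simp⟩
  | succ t ih =>
    obtain ⟨r, hr, he⟩ := ih
    refine ⟨(t : E) + ζ * r, ?_, ?_⟩
    · refine (IsUltrametricDist.norm_add_le_max _ _).trans (max_le (hn t) ?_)
      rw [norm_mul, h, one_mul]; exact hr
    · rw [pow_succ, he]; push_cast; ring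

variable {p : ℕ} [Fact p.Prime] {F : Type*} [Field F] [Fintype F] [CharP F p] 

lemma mulChar_norm_le (χ : MulChar F E) (x : F) : ‖χ x‖ ≤ 1 := by
  by_cases hx : x = 0
  · rw [hx, MulChar.map_zero]; simp
  · apply (norm_zeta (n := Fintype.card F - 1) _ _).le
    · have := Fintype.one_lt_card (α := F); omega
    · rw [← map_pow, FiniteField.pow_card_sub_one_eq_one x hx, map_one]

lemma psi_norm {ζ : E} (hζ : IsPrimitiveRoot ζ p) (x : F) : ‖psiF p F hζ x‖ = 1 := by
  rw [psiF_apply, norm_pow, norm_zeta (Fact.out : p.Prime).ne_zero hζ.pow_eq_one, one_pow]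

lemma gauss_norm_le {ζ : E} (hζ : IsPrimitiveRoot ζ p) (χ : MulChar F E) : ‖gaussSum χ (psiF p F hζ)‖ ≤ 1 := by
  apply ultra_sum
  intro x _
  rw [norm_mul, psi_norm, mul_one]; exact mulChar_norm_le χ x

lemma gauss_norm_add {ζ : E} (hζ : IsPrimitiveRoot ζ p) (χ φ : MulChar F E) :
    ‖gaussSum χ (psiF p F hζ)‖ * ‖gaussSum φ (psiF p F hζ)‖ ≤ ‖gaussSum (χ * φ) (psiF p F hζ)‖ := by
  by_cases h : χ * φ = 1
  · rw [h, gaussSum_one_left (psiF_ne_one hζ), norm_neg, norm_one]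
    exact mul_le_one₀ (gauss_norm_le hζ _) (norm_nonneg _) (gauss_norm_le hζ _)
  · rw [← norm_mul, ← jacobiSum_mul_nontrivial h, norm_mul]
    have : ‖jacobiSum χ φ‖ ≤ 1 := by
      apply ultra_sum
      intro x _
      rw [norm_mul]
      exact mul_le_one₀ (mulChar_norm_le _ _) (norm_nonneg _) (mulChar_norm_le _ _)
    exact mul_le_of_le_one_right (norm_nonneg _) this

lemma gauss_norm_pow {ζ : E} (hζ : IsPrimitiveRoot ζ p) (χ : MulChar F E) (k : ℕ) :
    ‖gaussSum χ (psiF p F hζ)‖ ^ k ≤ ‖gaussSum (χ ^ k) (psiF p F hζ)‖ := by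
  induction k with
  | zero => rw [pow_zero, pow_zero, gaussSum_one_left (psiF_ne_one hζ), norm_neg, norm_one]
  | succ k ih =>
    rw [pow_succ, pow_succ]
    exact (mul_le_mul_of_nonneg_right ih (norm_nonneg _)).trans (gauss_norm_add hζ _ _)

lemma gauss_norm_digits {ζ : E} (hζ : IsPrimitiveRoot ζ p) (χ : MulChar F E) (k : ℕ) :
    ‖gaussSum χ (psiF p F hζ)‖ ^ (Nat.digits p k).sum ≤ ‖gaussSum (χ ^ k) (psiF p F hζ)‖ := by
  have hp := (Fact.out : p.Prime)
  induction k using Nat.strong_induction_on with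
  | _ k ih =>
  by_cases hk : k = 0
  · subst hk
    rw [pow_zero, gaussSum_one_left (psiF_ne_one hζ), norm_neg, norm_one]; simp
  · rw [Nat.digits_def' hp.one_lt (Nat.pos_of_ne_zero hk), List.sum_cons, pow_add]
    have h1 := ih (k / p) (Nat.div_lt_self (Nat.pos_of_ne_zero hk) hp.one_lt)
    have h2 := gauss_norm_pow hζ χ (k % p)
    have h3 := gauss_norm_add hζ (χ ^ (k % p)) (χ ^ (p * (k / p)))
    rw [gauss_frob, ← pow_add, Nat.mod_add_div] at h3
    exact (mul_le_mul h2 h1 (by positivity) (norm_nonneg _)).trans h3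

lemma gauss_norm_prod {ζ : E} (hζ : IsPrimitiveRoot ζ p) {χ : MulChar F E} (h : χ ≠ 1) :
    ‖gaussSum χ (psiF p F hζ)‖ * ‖gaussSum χ⁻¹ (psiF p F hζ)‖ = ‖(Fintype.card F : E)‖ := by
  rw [← gaussSum_mul_gaussSum_eq_card h (psiF_prim hζ), norm_mul]
  congr 1
  rw [← gaussSum_mulShift χ⁻¹ (psiF p F hζ) (-1), norm_mul]
  have h1 : ‖χ⁻¹ (-1 : Fˣ)‖ = 1 := by
    apply norm_zeta (n := 2) (by norm_num)
    rw [← map_pow]; simp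
  rw [h1, one_mul]
  congr 2
  ext x
  simp [AddChar.inv_apply]

lemma gauss_one_norm [CharZero E] {f : ℕ} (hc : Fintype.card F = p ^ f) (hq : 2 < Fintype.card F)
    {ζ : E} (hζ : IsPrimitiveRoot ζ p) (hp : ‖(p : E)‖ < 1)
    (ω : MulChar F E) (hω : ∀ x, ω x ∈ VV E) (ι : F →+* IsLocalRing.ResidueField (VV E))
    (hι : ∀ x, IsLocalRing.residue (VV E) ⟨ω x, hω x⟩ = ι x) (hne : ω⁻¹ ≠ 1) :
    ‖1 - ζ‖ ≤ ‖gaussSum ω⁻¹ (psiF p F hζ)‖ := by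
  have hf : 0 < f := by
    rcases Nat.eq_zero_or_pos f with h | h
    · rw [h, pow_zero] at hc; omega
    · exact h
  set t : F → ℕ := fun x => (trF p F x).val with ht
  choose r hr1 hr2 using fun x : F => zeta_expand (norm_zeta (Fact.out : p.Prime).ne_zero hζ.pow_eq_one) (t x)
  set A : E := ∑ x : F, ω x⁻¹ * (t x : E) with hA
  set R : E := ∑ x : F, ω x⁻¹ * r x with hR
  have hG : gaussSum ω⁻¹ (psiF p F hζ) = (1 - ζ) ^ 2 * R - (1 - ζ) * A := by
    have h0 : ∑ x : F, ω x⁻¹ = 0 := by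
      rw [← MulChar.sum_eq_zero_of_ne_one hne]
      exact Finset.sum_congr rfl (fun x _ => (MulChar.inv_apply' ω x).symm)
    have : gaussSum ω⁻¹ (psiF p F hζ) = ∑ x : F, (ω x⁻¹ + ((1 - ζ) ^ 2 * (ω x⁻¹ * r x) - (1 - ζ) * (ω x⁻¹ * (t x : E)))) := by
      unfold gaussSum
      apply Finset.sum_congr rfl
      intro x _
      rw [psiF_apply, hr2 x, MulChar.inv_apply']; ring
    rw [this, Finset.sum_add_distrib, h0, Finset.sum_sub_distrib, ← Finset.mul_sum, ← Finset.mul_sum, zero_add]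
  have hR1 : ‖R‖ ≤ 1 := by
    apply ultra_sum
    intro x _
    rw [norm_mul]
    exact mul_le_one₀ (mulChar_norm_le _ _) (norm_nonneg _) (hr1 x)
  have hA1 : ‖A‖ = 1 := by
    set A' : VV E := ∑ x : F, ⟨ω x⁻¹, hω x⁻¹⟩ * (t x : VV E) with hA'
    have e : (A' : E) = A := by
      rw [hA', hA]; push_cast; rfl
    rw [← e, ← res_ne_zero_iff, hA', map_sum]
    simp_rw [map_mul, hι, map_natCast]
    have : ∑ x : F, ι x⁻¹ * (t x : IsLocalRing.ResidueField (VV E)) = ι (-1) := by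
      rw [← sum_inv_tr hc hf, map_sum]
      simp_rw [map_mul, map_natCast]; rfl
    rw [this]; simp
  by_contra! hlt
  have h1 : (1 - ζ) * A = (1 - ζ) ^ 2 * R - gaussSum ω⁻¹ (psiF p F hζ) := by rw [hG]; ring
  have h2 := IsUltrametricDist.norm_add_le_max ((1 - ζ) ^ 2 * R) (-gaussSum ω⁻¹ (psiF p F hζ))
  rw [← sub_eq_add_neg, norm_neg, ← h1, norm_mul, hA1, mul_one] at h2
  have hlt1 := norm_pi_lt hζ hp
  have hpos := norm_pi_pos hζ
  have h3 : ‖(1 - ζ) ^ 2 * R‖ < ‖1 - ζ‖ := by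
    rw [norm_mul, norm_pow]
    have : ‖1 - ζ‖ ^ 2 * ‖R‖ ≤ ‖1 - ζ‖ ^ 2 * 1 := by gcongr
    nlinarith
  exact absurd h2 (not_le.2 (max_lt h3 hlt))
end PartJ

section PartK
open Finset

lemma pow_mul_mod {p f i k : ℕ} (hp : 2 ≤ p) (hi : i ≤ f) (hk : k < p ^ f - 1) :
    p ^ i * k = (p ^ f - 1) * (k / p ^ (f - i)) + (p ^ i * k) % (p ^ f - 1) := by
  have hq : p ^ i * p ^ (f - i) = p ^ f := by rw [← pow_add]; congr 1; omega
  set u := p ^ i with hu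
  set v := p ^ (f - i) with hv
  have hu0 : 0 < u := by positivity
  have hv0 : 0 < v := by positivity
  have h1 := Nat.div_add_mod k v
  set a := k / v with ha
  set b := k % v with hb
  have hbv : b < v := Nat.mod_lt _ hv0
  have hau : a < u := by
    rw [ha, Nat.div_lt_iff_lt_mul hv0, hq]; omega
  have huv : 1 ≤ p ^ f := Nat.one_le_pow _ _ (by omega)
  rw [← hq] at hk huv ⊢
  have e : u * k = (u * v - 1) * a + (a + u * b) := by
    zify [huv]
    rw [← h1]; push_cast; ring
  have hlt : a + u * b < u * v - 1 := by
    by_contra! hge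
    have h2 : u * b + u ≤ u * v := by nlinarith
    have h3 : a + u * b + 1 ≤ u * v := by omega
    have h4 : a + u * b + 1 = u * v := by omega
    have h5 : u * b + u = u * v := by omega
    have h6 : b + 1 = v := by nlinarith
    have h7 : a + 1 = u := by nlinarith
    have : k + 1 = u * v := by rw [← h1, ← h6, ← h7]; ring
    omega
  rw [e, Nat.mul_add_mod, Nat.mod_eq_of_lt hlt]

lemma digit_floor {p : ℕ} (hp : 2 ≤ p) (f k : ℕ) (hk : k < p ^ f) :
    (p - 1) * ∑ i ∈ range f, k / p ^ (i + 1) + (Nat.digits p k).sum = k := by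
  induction f generalizing k with
  | zero =>
    have : k = 0 := by simpa using hk
    subst this; simp
  | succ f ih =>
    rcases Nat.eq_zero_or_pos k with h0 | h0
    · subst h0; simp
    have h1 := ih (k / p) (by rw [Nat.div_lt_iff_lt_mul (by omega)]; rwa [pow_succ] at hk)
    rw [sum_range_succ', Nat.digits_def' (by omega) h0, List.sum_cons]
    have h2 : ∀ i, k / p ^ (i + 1 + 1) = k / p / p ^ (i + 1) := by
      intro i; rw [Nat.div_div_eq_div_mul, pow_succ' p (i + 1)]
    simp_rw [h2]
    simp only [zero_add, pow_one]
    have h3 := Nat.div_add_mod k p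
    obtain ⟨c, hc⟩ : ∃ c, p = c + 1 := ⟨p - 1, by omega⟩
    have hc' : p - 1 = c := by omega
    rw [hc'] at h1 ⊢
    have h4 : p * (k / p) = c * (k / p) + k / p := by
      calc p * (k / p) = (c + 1) * (k / p) := by rw [← hc]
        _ = _ := by ring
    rw [mul_add]
    omega

lemma digit_sum {p f k : ℕ} (hp : 2 ≤ p) (hk : k < p ^ f - 1) :
    (p ^ f - 1) * (Nat.digits p k).sum = (p - 1) * ∑ i ∈ range f, (p ^ i * k) % (p ^ f - 1) := by
  have h1 := digit_floor hp f k (by omega)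
  have h2 : ∑ i ∈ range f, p ^ i * k = (p ^ f - 1) * ∑ i ∈ range f, k / p ^ (i + 1) + ∑ i ∈ range f, (p ^ i * k) % (p ^ f - 1) := by
    rw [← sum_range_reflect (fun i => k / p ^ (i + 1)), mul_sum, ← sum_add_distrib]
    apply sum_congr rfl
    intro i hi
    have hi' := mem_range.1 hi
    have := pow_mul_mod hp hi'.le hk
    rw [show f - 1 - i + 1 = f - i by omega]
    exact this
  rw [← sum_mul] at h2
  have h3 : (p - 1) * ∑ i ∈ range f, p ^ i = p ^ f - 1 := by
    have := Nat.geomSum_eq hp f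
    rw [this]
    apply Nat.mul_div_cancel'
    simpa using Nat.sub_dvd_pow_sub_pow p 1 f
  set q := p ^ f - 1
  set A := ∑ i ∈ range f, k / p ^ (i + 1)
  set B := ∑ i ∈ range f, (p ^ i * k) % q
  set s := (Nat.digits p k).sum
  have h4 : q * k = (p - 1) * (q * A + B) := by rw [← h2, ← h3]; ring
  have h5 : q * k = q * ((p - 1) * A) + q * s := by rw [← mul_add, h1]
  have h6 : (p - 1) * (q * A + B) = q * ((p - 1) * A) + (p - 1) * B := by ring
  omega

lemma mod_compl {n a b : ℕ} (hab : n ∣ a + b) (ha : ¬ n ∣ a) : a % n + b % n = n := by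
  have hn : 0 < n := by
    rcases Nat.eq_zero_or_pos n with h | h
    · subst h; exfalso; apply ha; simp at hab; simp [hab]
    · exact h
  have h1 := Nat.mod_lt a hn
  have h2 := Nat.mod_lt b hn
  have h3 : (a % n + b % n) % n = 0 := by rw [← Nat.add_mod]; exact Nat.mod_eq_zero_of_dvd hab
  have h4 : a % n ≠ 0 := fun h => ha (Nat.dvd_of_mod_eq_zero h)
  obtain ⟨c, hc⟩ := Nat.dvd_of_mod_eq_zero h3
  have : c = 1 := by
    have : c < 2 := by nlinarith
    have : 0 < c := by
      rcases Nat.eq_zero_or_pos c with h | h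
      · subst h; omega
      · exact h
    omega
  rw [hc, this, mul_one]

lemma digit_compl {p f k : ℕ} (hp : 2 ≤ p) (hk0 : 0 < k) (hk : k < p ^ f - 1) :
    (Nat.digits p k).sum + (Nat.digits p (p ^ f - 1 - k)).sum = (p - 1) * f := by
  have h1 := digit_sum hp hk
  have h2 := digit_sum hp (k := p ^ f - 1 - k) (f := f) (by omega)
  have hq : 0 < p ^ f - 1 := by omega
  have h3 : ∀ i ∈ range f, (p ^ i * k) % (p ^ f - 1) + (p ^ i * (p ^ f - 1 - k)) % (p ^ f - 1) = p ^ f - 1 := by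
    intro i hi
    apply mod_compl
    · rw [← mul_add]; rw [show k + (p ^ f - 1 - k) = p ^ f - 1 by omega]; exact Dvd.intro_left _ rfl
    · intro h
      have hco : Nat.Coprime (p ^ f - 1) (p ^ i) := by
        have : Nat.Coprime (p ^ f - 1) (p ^ f) := by
          rw [Nat.coprime_comm]
          have := Nat.coprime_self_sub_right (n := p ^ f) (m := 1) (by omega)
          rw [this]; simp
        exact Nat.Coprime.coprime_dvd_right (pow_dvd_pow p (mem_range.1 hi).le) this
      have := Nat.le_of_dvd hk0 (hco.dvd_of_dvd_mul_left h)
      omega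
  have h4 := sum_congr rfl h3
  rw [sum_add_distrib, sum_const, card_range, smul_eq_mul] at h4
  have : (p ^ f - 1) * ((Nat.digits p k).sum + (Nat.digits p (p ^ f - 1 - k)).sum) = (p ^ f - 1) * ((p - 1) * f) := by
    rw [mul_add, h1, h2, ← mul_add, h4]; ring
  exact Nat.eq_of_mul_eq_mul_left hq this

theorem stickelberger {E : Type*} [NormedField E] [IsUltrametricDist E] [IsAlgClosed E] [CharZero E]
    {p f : ℕ} [Fact p.Prime] (hp : ‖(p : E)‖ < 1) {ζ : E} (hζ : IsPrimitiveRoot ζ p) (F : Type*) [Field F] [Fintype F]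
    [CharP F p] (hc : Fintype.card F = p ^ f) (hq : 2 < Fintype.card F) :
    ∃ ω : MulChar F E, (∀ k : ℕ, ω ^ k = 1 → p ^ f - 1 ∣ k) ∧ ∀ k : ℕ, 0 < k → k < p ^ f - 1 →
      ‖gaussSum (ω ^ k) (psiF p F hζ)‖ = ‖1 - ζ‖ ^ (Nat.digits p k).sum := by
  have hp2 := (Fact.out : p.Prime).two_le
  obtain ⟨ω, hω, ι, hι⟩ := teich (E := E) p hp F
  have hord : ∀ k : ℕ, (ω⁻¹) ^ k = 1 → p ^ f - 1 ∣ k := by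
    intro k hk
    have hk' : ω ^ k = 1 := by rw [inv_pow] at hk; exact inv_eq_one.1 hk
    obtain ⟨γ, hγ⟩ := IsCyclic.exists_generator (α := Fˣ)
    have h1 : orderOf γ = p ^ f - 1 := by
      rw [orderOf_eq_card_of_forall_mem_zpowers hγ, Nat.card_eq_fintype_card, Fintype.card_units, hc]
    rw [← h1]
    apply orderOf_dvd_of_pow_eq_one
    have h2 : ω (γ : F) ^ k = 1 := by rw [← MulChar.pow_apply_coe, hk', MulChar.one_apply_coe]
    have h3 : (⟨ω γ, hω γ⟩ : VV E) ^ k = 1 := Subtype.ext (by simpa using h2)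
    have h4 := congrArg (IsLocalRing.residue (VV E)) h3
    rw [map_pow, hι, map_one, ← map_pow] at h4
    have h5 : (γ : F) ^ k = 1 := ι.injective (by rw [h4, map_one])
    exact Units.ext (by simpa using h5)
  refine ⟨ω⁻¹, hord, ?_⟩
  have hne : ω⁻¹ ≠ 1 := by
    intro h
    have := Nat.le_of_dvd one_pos (hord 1 (by rw [pow_one]; exact h))
    omega
  have h1 := gauss_one_norm hc hq hζ hp ω hω ι hι hne
  have hlow : ∀ k : ℕ, ‖1 - ζ‖ ^ (Nat.digits p k).sum ≤ ‖gaussSum (ω⁻¹ ^ k) (psiF p F hζ)‖ := by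
    intro k
    exact (pow_le_pow_left₀ (norm_nonneg _) h1 _).trans (gauss_norm_digits hζ _ k)
  intro k hk0 hk
  have hnek : ω⁻¹ ^ k ≠ 1 := by
    intro h
    have := Nat.le_of_dvd hk0 (hord k h)
    omega
  have hprod := gauss_norm_prod hζ hnek
  have hinv : (ω⁻¹ ^ k)⁻¹ = ω⁻¹ ^ (p ^ f - 1 - k) := by
    rw [inv_eq_iff_mul_eq_one, ← pow_add, show k + (p ^ f - 1 - k) = p ^ f - 1 by omega]
    have := MulChar.pow_card_eq_one (ω⁻¹)
    rw [Fintype.card_units, hc] at this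
    exact this
  rw [hinv, hc] at hprod
  have hq' : ‖((p ^ f : ℕ) : E)‖ = ‖1 - ζ‖ ^ (Nat.digits p k).sum * ‖1 - ζ‖ ^ (Nat.digits p (p ^ f - 1 - k)).sum := by
    rw [← pow_add, digit_compl hp2 hk0 hk, pow_mul, norm_pi hζ]; push_cast; rw [norm_pow]
  rw [hq'] at hprod
  have ha := hlow k
  have hb := hlow (p ^ f - 1 - k)
  have hpos := norm_pi_pos hζ
  refine le_antisymm ?_ ha
  by_contra! hlt
  have : ‖1 - ζ‖ ^ (Nat.digits p k).sum * ‖1 - ζ‖ ^ (Nat.digits p (p ^ f - 1 - k)).sum <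
     ‖gaussSum (ω⁻¹ ^ k) (psiF p F hζ)‖ * ‖gaussSum (ω⁻¹ ^ (p ^ f - 1 - k)) (psiF p F hζ)‖ :=
    mul_lt_mul hlt hb (by positivity) (norm_nonneg _)
  linarith
end PartK

section PartL
open Finset NumberTheorySymbols

lemma jval {d N : ℕ} [NeZero N] (hdN : d ∣ N) (a : ℤ) : J((((a : ZMod N).val : ℕ) : ℤ) | d) = J(a | d) := by
  rw [ZMod.val_intCast, jacobiSym.mod_left (a % (N : ℤ)), Int.emod_emod_of_dvd a (Int.natCast_dvd_natCast.2 hdN), ← jacobiSym.mod_left]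

lemma jval_mul {d N : ℕ} [NeZero N] (hdN : d ∣ N) (a b : ZMod N) :
    J(((a * b).val : ℤ) | d) = J((a.val : ℤ) | d) * J((b.val : ℤ) | d) := by
  have h := jval hdN ((a.val : ℤ) * (b.val : ℤ))
  rw [← jacobiSym.mul_left, ← h]
  simp

lemma jval_pow {d N : ℕ} [NeZero N] (hdN : d ∣ N) (a : ZMod N) (i : ℕ) :
    J(((a ^ i).val : ℤ) | d) = J((a.val : ℤ) | d) ^ i := by
  induction i with
  | zero => 
    have := jval hdN 1
    simpa using this
  | succ i ih => rw [pow_succ, jval_mul hdN, ih, pow_succ]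

lemma jval_nat {d N : ℕ} [NeZero N] (hdN : d ∣ N) (a : ℕ) :
    J((((a : ZMod N).val : ℕ) : ℤ) | d) = J((a : ℤ) | d) := by
  rw [← jval hdN a]; simp

lemma jval_neg {d N : ℕ} [NeZero N] (hdN : d ∣ N) (hd : d % 4 = 3) (a : ZMod N) :
    J((((-a).val : ℕ) : ℤ) | d) = - J((a.val : ℤ) | d) := by
  have h1 := jval hdN (-1)
  rw [jacobiSym.at_neg_one (Nat.odd_iff.2 (by omega)), ZMod.χ₄_nat_three_mod_four hd] at h1
  rw [← neg_one_mul a, jval_mul hdN]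
  push_cast at h1
  rw [h1]; ring

lemma unit_of_order {n : ℕ} {x : ZMod n} (h : orderOf x ≠ 0) : IsUnit x := by
  have h1 := pow_orderOf_eq_one x
  exact IsUnit.of_pow_eq_one h1 h

lemma nonres {ℓ n p : ℕ} (hℓ : ℓ.Prime) (h2 : ℓ ≠ 2) (hn : 1 ≤ n)
    (ho : orderOf ((p : ZMod (ℓ ^ n))) = Nat.totient (ℓ ^ n)) : J((p : ℤ) | ℓ) = -1 := by
  have := Fact.mk hℓ
  have hN : NeZero (ℓ ^ n) := ⟨pow_ne_zero _ hℓ.ne_zero⟩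
  have hdv : ℓ ∣ ℓ ^ n := dvd_pow_self ℓ (by omega)
  have hpos : 0 < Nat.totient (ℓ ^ n) := Nat.totient_pos.2 (NeZero.pos _)
  obtain ⟨u, hu⟩ := unit_of_order (x := (p : ZMod (ℓ ^ n))) (by omega)
  have hou : orderOf u = Nat.card (ZMod (ℓ ^ n))ˣ := by
    rw [Nat.card_eq_fintype_card, ZMod.card_units_eq_totient, ← ho, ← hu, orderOf_units]
  obtain ⟨a, ha⟩ := quadraticChar_exists_neg_one (F := ZMod ℓ) (by rwa [ZMod.ringChar_zmod_n])
  have ha0 : a ≠ 0 := by rintro rfl; simp at ha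
  have hJa : J((a.val : ℤ) | ℓ) = -1 := by
    rw [← jacobiSym.legendreSym.to_jacobiSym, legendreSym]; simpa using ha
  have hcop : Nat.Coprime a.val (ℓ ^ n) := by
    apply Nat.Coprime.pow_right
    rw [Nat.coprime_comm, hℓ.coprime_iff_not_dvd]
    intro h
    apply ha0
    have := Nat.eq_zero_of_dvd_of_lt h (ZMod.val_lt a)
    exact (ZMod.val_eq_zero a).1 this
  obtain ⟨k, hk⟩ : ∃ k : ℕ, u ^ k = ZMod.unitOfCoprime a.val hcop := by
    have hm : ZMod.unitOfCoprime a.val hcop ∈ Subgroup.zpowers u := by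
      rw [Subgroup.eq_top_of_card_eq (Subgroup.zpowers u) (by rw [Nat.card_zpowers, hou])]; trivial
    exact (mem_powers_iff_mem_zpowers).2 hm
  have h3 := congrArg Units.val hk
  rw [Units.val_pow_eq_pow_val, hu, ZMod.coe_unitOfCoprime] at h3
  have h4 := jval_pow hdv (p : ZMod (ℓ ^ n)) k
  rw [h3, jval_nat hdv, jval_nat hdv, hJa] at h4
  rcases jacobiSym.trichotomy (p : ℤ) ℓ with h | h | h
  · rw [h] at h4
    rcases Nat.eq_zero_or_pos k with hk | hk
    · subst hk; norm_num at h4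
    · rw [zero_pow hk.ne'] at h4; norm_num at h4
  · rw [h, one_pow] at h4; norm_num at h4
  · exact h

lemma jval_unit {N d : ℕ} [NeZero N] (hdN : d ∣ N) (u : (ZMod N)ˣ) :
    J(((u : ZMod N).val : ℤ) | d) = 1 ∨ J(((u : ZMod N).val : ℤ) | d) = -1 := by
  have h := jval_mul hdN (u : ZMod N) ((u⁻¹ : (ZMod N)ˣ) : ZMod N)
  have h1 := jval hdN 1
  rw [Units.mul_inv] at h
  push_cast at h1
  rw [h1, jacobiSym.one_left] at h
  exact Int.isUnit_iff.1 (IsUnit.of_mul_eq_one _ h.symm)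

/-- all units are `± p^i j`, each exactly once -/
lemma units_enum {N d p f : ℕ} [NeZero N] (hdN : d ∣ N) (hd : d % 4 = 3) (hJ : J((p : ℤ) | d) = 1)
    (hford : 2 * f = Nat.totient N) (P : (ZMod N)ˣ) (hP : (P : ZMod N) = p) (hf : f = orderOf P) (j : (ZMod N)ˣ) :
    Function.Bijective (fun x : Fin f × Bool => (if x.2 then P ^ (x.1 : ℕ) * j else -(P ^ (x.1 : ℕ) * j))) := by
  rw [Fintype.bijective_iff_injective_and_card]
  constructor
  · have hχ : ∀ i : ℕ, J((((P ^ i * j : (ZMod N)ˣ) : ZMod N).val : ℤ) | d) = J(((j : ZMod N).val : ℤ) | d) := by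
      intro i
      rw [Units.val_mul, Units.val_pow_eq_pow_val, hP, jval_mul hdN, jval_pow hdN, jval_nat hdN, hJ, one_pow, one_mul]
    have hχn : ∀ i : ℕ, J((((-(P ^ i * j) : (ZMod N)ˣ) : ZMod N).val : ℤ) | d) = - J(((j : ZMod N).val : ℤ) | d) := by
      intro i
      rw [Units.val_neg, jval_neg hdN hd, hχ]
    have hinj : ∀ a b : Fin f, P ^ (a : ℕ) * j = P ^ (b : ℕ) * j → a = b := by
      intro a b h
      have h1 := mul_right_cancel h
      have h2 : (a : ℕ) = b := pow_injOn_Iio_orderOf (by rw [← hf]; exact a.2) (by rw [← hf]; exact b.2) h1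
      exact Fin.ext h2
    have hne := jval_unit hdN j
    rintro ⟨a, x⟩ ⟨b, y⟩ hab
    simp only at hab
    cases x <;> cases y <;> simp only [if_true, Bool.false_eq_true, if_false] at hab
    · rw [hinj a b (neg_injective hab)]
    · exfalso
      have h1 := hχn a
      rw [hab, hχ b] at h1
      omega
    · exfalso
      have h1 := hχn b
      rw [← hab, hχ a] at h1
      omega
    · rw [hinj a b hab]
  · rw [Fintype.card_prod, Fintype.card_fin, Fintype.card_bool, ZMod.card_units_eq_totient, ← hford]; ring

lemma units_sum {N d p f : ℕ} [NeZero N] (hdN : d ∣ N) (hd : d % 4 = 3) (hJ : J((p : ℤ) | d) = 1)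
    (hford : 2 * f = Nat.totient N) (P : (ZMod N)ˣ) (hP : (P : ZMod N) = p) (hf : f = orderOf P) (j : (ZMod N)ˣ)
    {A : Type*} [AddCommMonoid A] (g : (ZMod N)ˣ → A) :
    ∑ u, g u = ∑ i ∈ range f, (g (P ^ i * j) + g (-(P ^ i * j))) := by
  rw [← (units_enum hdN hd hJ hford P hP hf j).sum_comp, Fintype.sum_prod_type, ← Fin.sum_univ_eq_sum_range
    (fun i => g (P ^ i * j) + g (-(P ^ i * j)))]
  apply Finset.sum_congr rfl
  intro i _
  simp

lemma units_cover {N d p f : ℕ} [NeZero N] (hdN : d ∣ N) (hd : d % 4 = 3) (hJ : J((p : ℤ) | d) = 1)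
    (hford : 2 * f = Nat.totient N) (P : (ZMod N)ˣ) (hP : (P : ZMod N) = p) (hf : f = orderOf P) (j u : (ZMod N)ˣ) :
    ∃ i : ℕ, u = P ^ i * j ∨ u = -(P ^ i * j) := by
  obtain ⟨⟨i, b⟩, h⟩ := (units_enum hdN hd hJ hford P hP hf j).2 u
  refine ⟨i, ?_⟩
  cases b
  · right; simpa using h.symm
  · left; simpa using h.symm

lemma units_sum_eq {N : ℕ} [NeZero N] {A : Type*} [AddCommMonoid A] (g : ZMod N → A) (hg : ∀ x, ¬ IsUnit x → g x = 0) :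
    ∑ u : (ZMod N)ˣ, g u = ∑ x, g x := by
  symm
  rw [← Finset.sum_subset (Finset.subset_univ (univ.image (Units.val : (ZMod N)ˣ → ZMod N)))]
  · rw [Finset.sum_image (fun a _ b _ h => Units.ext h)]
  · intro x _ hx
    apply hg
    rintro ⟨u, rfl⟩
    exact hx (Finset.mem_image_of_mem _ (mem_univ _))

lemma T_red {d Q : ℕ} (hd : d % 4 = 3) :
    ∑ u ∈ range (d * Q), J((u : ℤ) | d) * (u : ℤ) = Q * ∑ b ∈ range d, J((b : ℤ) | d) * (b : ℤ) := by
  have h0 : ∑ b ∈ range d, J((b : ℤ) | d) = 0 := by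
    have : NeZero d := ⟨by omega⟩
    have h1 : ∑ b ∈ range d, J((b : ℤ) | d) = ∑ x : ZMod d, J((x.val : ℤ) | d) := by
      obtain ⟨d', rfl⟩ : ∃ d', d = d' + 1 := ⟨d - 1, by omega⟩
      rw [← Fin.sum_univ_eq_sum_range (fun b => J((b : ℤ) | d' + 1))]
      rfl
    rw [h1]
    have h2 := Equiv.sum_comp (Equiv.neg (ZMod d)) (fun x => J((x.val : ℤ) | d))
    simp only [Equiv.neg_apply] at h2
    simp_rw [jval_neg (dvd_refl d) hd] at h2
    rw [Finset.sum_neg_distrib] at h2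
    omega
  induction Q with
  | zero => simp
  | succ Q ih =>
    rw [mul_add, mul_one, Finset.sum_range_add, ih]
    have : ∀ x, J(((d * Q + x : ℕ) : ℤ) | d) * ((d * Q + x : ℕ) : ℤ) = d * Q * J((x : ℤ) | d) + J((x : ℤ) | d) * x := by
      intro x
      have : J(((d * Q + x : ℕ) : ℤ) | d) = J((x : ℤ) | d) := by
        rw [jacobiSym.mod_left, jacobiSym.mod_left (x : ℤ)]; congr 1; push_cast; simp
      rw [this]; push_cast; ring
    simp_rw [this]
    rw [Finset.sum_add_distrib, ← Finset.mul_sum, h0]; push_cast; ring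

lemma coset_sum {N d p f Q h : ℕ} [NeZero N] (hNd : N = d * Q) (hd : d % 4 = 3) (hJ : J((p : ℤ) | d) = 1)
    (hrad : ∀ x : ZMod N, ¬ IsUnit x → J((x.val : ℤ) | d) = 0)
    (hford : 2 * f = Nat.totient N) (P : (ZMod N)ˣ) (hP : (P : ZMod N) = p) (hf : f = orderOf P)
    (hcl : |∑ b ∈ range d, J((b : ℤ) | d) * (b : ℤ)| ≤ d * h) (j : (ZMod N)ˣ) (hN1 : N ≠ 1) :
    (N : ℤ) * ((f : ℤ) - h) ≤ 2 * ∑ i ∈ range f, (((P ^ i * j : (ZMod N)ˣ) : ZMod N).val : ℤ) := by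
  have hdN : d ∣ N := ⟨Q, hNd⟩
  have h1 := units_sum hdN hd hJ hford P hP hf j (fun u => J((((u : (ZMod N)ˣ) : ZMod N).val : ℤ) | d) * (((u : ZMod N).val : ℕ) : ℤ))
  rw [units_sum_eq (fun x : ZMod N => J((x.val : ℤ) | d) * ((x.val : ℕ) : ℤ)) (by intro x hx; beta_reduce; rw [hrad x hx, zero_mul])] at h1
  have h2 : ∑ x : ZMod N, J((x.val : ℤ) | d) * ((x.val : ℕ) : ℤ) = ∑ u ∈ range N, J((u : ℤ) | d) * (u : ℤ) := by
    obtain ⟨N', rfl⟩ : ∃ N', N = N' + 1 := ⟨N - 1, by have := NeZero.pos N; omega⟩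
    rw [← Fin.sum_univ_eq_sum_range (fun b => J((b : ℤ) | d) * (b : ℤ))]
    rfl
  have h2' : ∑ u ∈ range N, J((u : ℤ) | d) * (u : ℤ) = Q * ∑ b ∈ range d, J((b : ℤ) | d) * (b : ℤ) := by
    have := T_red (Q := Q) hd
    rwa [← hNd] at this
  rw [h2, h2'] at h1
  have hχ : ∀ i : ℕ, J((((P ^ i * j : (ZMod N)ˣ) : ZMod N).val : ℤ) | d) = J(((j : ZMod N).val : ℤ) | d) := by
    intro i
    rw [Units.val_mul, Units.val_pow_eq_pow_val, hP, jval_mul hdN, jval_pow hdN, jval_nat hdN, hJ, one_pow, one_mul]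
  have hval : ∀ i : ℕ, ((((-(P ^ i * j) : (ZMod N)ˣ) : ZMod N).val : ℕ) : ℤ) = N - (((P ^ i * j : (ZMod N)ˣ) : ZMod N).val : ℤ) := by
    intro i
    have hnt : Nontrivial (ZMod N) := ZMod.nontrivial_iff.2 hN1
    have : NeZero (((P ^ i * j : (ZMod N)ˣ) : ZMod N)) := ⟨Units.ne_zero _⟩
    rw [Units.val_neg, ZMod.val_neg_of_ne_zero, Nat.cast_sub (ZMod.val_lt _).le]
  have h3 : ∀ i ∈ range f, (J((((P ^ i * j : (ZMod N)ˣ) : ZMod N).val : ℤ) | d) * ((((P ^ i * j : (ZMod N)ˣ) : ZMod N).val : ℕ) : ℤ) + J((((-(P ^ i * j) : (ZMod N)ˣ) : ZMod N).val : ℤ) | d) * ((((-(P ^ i * j) : (ZMod N)ˣ) : ZMod N).val : ℕ) : ℤ)) = J(((j : ZMod N).val : ℤ) | d) * (2 * (((P ^ i * j : (ZMod N)ˣ) : ZMod N).val : ℤ) - N) := by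
    intro i _
    have e : J((((-(P ^ i * j) : (ZMod N)ˣ) : ZMod N).val : ℤ) | d) = - J(((j : ZMod N).val : ℤ) | d) := by
      rw [Units.val_neg, jval_neg hdN hd, hχ]
    rw [e, hχ, hval]; ring
  rw [Finset.sum_congr rfl h3, ← Finset.mul_sum, Finset.sum_sub_distrib, ← Finset.mul_sum] at h1
  set S := ∑ i ∈ range f, (((P ^ i * j : (ZMod N)ˣ) : ZMod N).val : ℤ)
  set T := ∑ b ∈ range d, J((b : ℤ) | d) * (b : ℤ)
  simp only [sum_const, card_range, nsmul_eq_mul] at h1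
  have hNz : (N : ℤ) = d * Q := by exact_mod_cast hNd
  have hb : |(Q : ℤ) * T| ≤ N * h := by
    rw [abs_mul, hNz, abs_of_nonneg (by positivity)]
    calc (Q : ℤ) * |T| ≤ Q * (d * h) := by gcongr
      _ = _ := by ring
  rw [h1] at hb
  have hb' := abs_le.1 hb
  rcases jval_unit hdN j with hj | hj <;> rw [hj] at hb' <;> linarith [hb'.1, hb'.2]
end PartL

section PartM

lemma pm_small {ℓ : ℕ} (h : 2 < ℓ) {x y : ℤ} (hx : x = 1 ∨ x = -1) (hy : y = 1 ∨ y = -1) (hd : (ℓ : ℤ) ∣ x - y) : x = y := by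
  have h1 : (2 : ℤ) < ℓ := by exact_mod_cast h
  by_contra hne
  have := Int.le_of_dvd (by rcases hx with rfl | rfl <;> rcases hy with rfl | rfl <;> simp_all) 
    ((dvd_abs _ _).2 hd)
  rcases hx with rfl | rfl <;> rcases hy with rfl | rfl <;> simp_all <;> omega

lemma int_fin {p1 p2 c δ y P R n00 n10 n01 n11 n12 : ℤ} (hc : c = 1 ∨ c = -1) (hδ : δ = 1 ∨ δ = -1)
    (hy : y = 1 ∨ y = -1) (h1 : p1 = 2 * R + c) (h2 : p2 = 2 * R - c) (hd : 0 < p1 * p2)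
    (E00 : 2 * (p1 * p2) * n00 = -2 + 2 * (p2 - 1) * (δ * (P * R)) + 2 * (p1 - 1) * (-δ * (P * R)) + (p1 - 1) * (p2 - 1) * (P * (-δ * c)))
    (E10 : 2 * (p1 * p2) * n10 = -2 + 2 * (p2 - 1) * (δ * (P * R)) - 2 * (-δ * (P * R)) - (p2 - 1) * (P * (-δ * c)))
    (E01 : 2 * (p1 * p2) * n01 = -2 - 2 * (δ * (P * R)) + 2 * (p1 - 1) * (-δ * (P * R)) - (p1 - 1) * (P * (-δ * c)))
    (E11 : 2 * (p1 * p2) * n11 = -2 - 2 * (δ * (P * R)) - 2 * (-δ * (P * R)) + (P * (-δ * c)) + p1 * p2 * (P * y))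
    (E12 : 2 * (p1 * p2) * n12 = -2 - 2 * (δ * (P * R)) - 2 * (-δ * (P * R)) + (P * (-δ * c)) - p1 * p2 * (P * y)) :
    (n00 = n11 ∨ n00 = n12) ∧ (n10 = n11 ∨ n10 = n12) ∧ (n01 = n11 ∨ n01 = n12) := by
  have key : ∀ a b : ℤ, 2 * (p1 * p2) * a = 2 * (p1 * p2) * b → a = b := fun a b h =>
    mul_left_cancel₀ (by positivity) h
  refine ⟨?_, ?_, ?_⟩
  · rcases hc with rfl | rfl <;> rcases hδ with rfl | rfl <;> rcases hy with rfl | rfl <;>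
    first
    | (refine Or.inl (key _ _ ?_); rw [E00, E11, h1, h2]; ring1)
    | (refine Or.inr (key _ _ ?_); rw [E00, E12, h1, h2]; ring1)
  · rcases hc with rfl | rfl <;> rcases hδ with rfl | rfl <;> rcases hy with rfl | rfl <;>
    first
    | (refine Or.inl (key _ _ ?_); rw [E10, E11, h1, h2]; ring1)
    | (refine Or.inr (key _ _ ?_); rw [E10, E12, h1, h2]; ring1)
  · rcases hc with rfl | rfl <;> rcases hδ with rfl | rfl <;> rcases hy with rfl | rfl <;>
    first
    | (refine Or.inl (key _ _ ?_); rw [E01, E11, h1, h2]; ring1)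
    | (refine Or.inr (key _ _ ?_); rw [E01, E12, h1, h2]; ring1)

set_option maxHeartbeats 1000000 in
lemma int_core {p p1 p2 e s : ℕ} {c δ : ℤ} (hp : p.Prime) (hp1 : p1.Prime) (hp2 : p2.Prime)
    (hc : c = 1 ∨ c = -1) (hδ : δ = 1 ∨ δ = -1) (h1 : (p1 : ℤ) = 2 * (p : ℤ) ^ e + c)
    (h2 : (p2 : ℤ) = 2 * (p : ℤ) ^ e - c) (h31 : 2 < p1) (h32 : 2 < p2)
    (hs1 : (p1 : ℤ) ∣ (p : ℤ) ^ s - δ) (hs2 : (p2 : ℤ) ∣ (p : ℤ) ^ s + δ)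
    {g1 g2 X Z n00 n10 n01 n11 n12 : ℤ}
    (E00 : 2 * (p1 * p2) * n00 = -2 + 2 * (p2 - 1) * g2 + 2 * (p1 - 1) * g1 + (p1 - 1) * (p2 - 1) * X)
    (E10 : 2 * (p1 * p2) * n10 = -2 + 2 * (p2 - 1) * g2 - 2 * g1 - (p2 - 1) * X)
    (E01 : 2 * (p1 * p2) * n01 = -2 - 2 * g2 + 2 * (p1 - 1) * g1 - (p1 - 1) * X)
    (E11 : 2 * (p1 * p2) * n11 = -2 - 2 * g2 - 2 * g1 + X + Z)
    (E12 : 2 * (p1 * p2) * n12 = -2 - 2 * g2 - 2 * g1 + X - Z)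
    (hg1 : g1 ^ 2 = ((p : ℤ) ^ s) ^ 2) (hg2 : g2 ^ 2 = ((p : ℤ) ^ s) ^ 2)
    (hZ : Z ^ 2 = p1 * p2 * (4 * ((p : ℤ) ^ s) ^ 2 - X ^ 2)) (hX : (p : ℤ) ^ (s - e) ∣ X) :
    (n00 = n11 ∨ n00 = n12) ∧ (n10 = n11 ∨ n10 = n12) ∧ (n01 = n11 ∨ n01 = n12) := by
  have P1 : Prime (p1 : ℤ) := Nat.prime_iff_prime_int.1 hp1
  have P2 : Prime (p2 : ℤ) := Nat.prime_iff_prime_int.1 hp2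
  have PP : Prime (p : ℤ) := Nat.prime_iff_prime_int.1 hp
  have hz1 : (2 : ℤ) < p1 := by exact_mod_cast h31
  have hz2 : (2 : ℤ) < p2 := by exact_mod_cast h32
  have hdδ : IsUnit δ := by rcases hδ with rfl | rfl <;> simp
  have two1 : ¬ (p1 : ℤ) ∣ 2 := fun h => by have := Int.le_of_dvd (by norm_num) h; omega
  have two2 : ¬ (p2 : ℤ) ∣ 2 := fun h => by have := Int.le_of_dvd (by norm_num) h; omega
  -- p ^ s units
  have np1 : ¬ (p1 : ℤ) ∣ (p : ℤ) ^ s := fun h => by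
    have : (p1 : ℤ) ∣ δ := by have := dvd_sub h hs1; simpa using this
    exact P1.not_isUnit (isUnit_of_dvd_unit this hdδ)
  have np2 : ¬ (p2 : ℤ) ∣ (p : ℤ) ^ s := fun h => by
    have : (p2 : ℤ) ∣ δ := by have := dvd_sub hs2 h; simpa using this
    exact P2.not_isUnit (isUnit_of_dvd_unit this hdδ)
  -- congruences
  have c2 : (p2 : ℤ) * (n00 + (p1 - 1) * n10) = -1 + (p2 - 1) * g2 := by
    have : (2 * p1 : ℤ) * ((p2 : ℤ) * (n00 + (p1 - 1) * n10)) = 2 * p1 * (-1 + (p2 - 1) * g2) := by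
      linear_combination E00 + (p1 - 1) * E10
    exact mul_left_cancel₀ (by positivity) this
  have c1 : (p1 : ℤ) * (n00 + (p2 - 1) * n01) = -1 + (p1 - 1) * g1 := by
    have : (2 * p2 : ℤ) * ((p1 : ℤ) * (n00 + (p2 - 1) * n01)) = 2 * p2 * (-1 + (p1 - 1) * g1) := by
      linear_combination E00 + (p2 - 1) * E01
    exact mul_left_cancel₀ (by positivity) this
  have k2 : (p2 : ℤ) ∣ g2 + 1 := ⟨g2 - (n00 + (p1 - 1) * n10), by linear_combination c2⟩
  have k1 : (p1 : ℤ) ∣ g1 + 1 := ⟨g1 - (n00 + (p2 - 1) * n01), by linear_combination c1⟩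
  -- signs
  have G1 : g1 = -δ * (p : ℤ) ^ s := by
    obtain ⟨t, ht, hg⟩ : ∃ t : ℤ, (t = 1 ∨ t = -1) ∧ g1 = t * (p : ℤ) ^ s := by
      rcases sq_eq_sq_iff_eq_or_eq_neg.1 hg1 with h | h
      · exact ⟨1, Or.inl rfl, by rw [h]; ring⟩
      · exact ⟨-1, Or.inr rfl, by rw [h]; ring⟩
    have h3 : (p1 : ℤ) ∣ t * δ - (-1) := by
      have := dvd_sub k1 (Dvd.dvd.mul_left hs1 t)
      rw [hg] at this; ring_nf at this ⊢; exact this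
    have := pm_small h31 (by rcases ht with rfl | rfl <;> rcases hδ with rfl | rfl <;> simp) (Or.inr rfl) h3
    rw [hg]; congr 1
    clear * - this ht hδ
    rcases ht with rfl | rfl <;> rcases hδ with rfl | rfl <;> simp_all
  have G2 : g2 = δ * (p : ℤ) ^ s := by
    obtain ⟨t, ht, hg⟩ : ∃ t : ℤ, (t = 1 ∨ t = -1) ∧ g2 = t * (p : ℤ) ^ s := by
      rcases sq_eq_sq_iff_eq_or_eq_neg.1 hg2 with h | h
      · exact ⟨1, Or.inl rfl, by rw [h]; ring⟩
      · exact ⟨-1, Or.inr rfl, by rw [h]; ring⟩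
    have h3 : (p2 : ℤ) ∣ 1 - t * δ := by
      have := dvd_sub k2 (Dvd.dvd.mul_left hs2 t)
      rw [hg] at this; ring_nf at this ⊢; exact this
    have := pm_small h32 (Or.inl rfl) (by rcases ht with rfl | rfl <;> rcases hδ with rfl | rfl <;> simp) h3
    rw [hg]; congr 1
    clear * - this ht hδ
    rcases ht with rfl | rfl <;> rcases hδ with rfl | rfl <;> simp_all
  have X1 : (p1 : ℤ) ∣ X - 2 * g2 := by
    have h3 : (p1 : ℤ) ∣ (p2 - 1) * (X - 2 * g2) := by
      have : (p2 - 1) * (X - 2 * g2) = - (2 * (g1 + 1)) - p1 * (2 * p2 * n10) := by linear_combination E10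
      rw [this]
      exact dvd_sub ((Dvd.dvd.mul_left k1 2).neg_right) (dvd_mul_right _ _)
    refine (P1.dvd_or_dvd h3).resolve_left ?_
    intro h4
    have h5 : (p1 : ℤ) ∣ 2 * c + 1 := by
      have := dvd_sub (dvd_refl (p1 : ℤ)) h4
      have e : (p1 : ℤ) - (p2 - 1) = 2 * c + 1 := by rw [h1, h2]; ring
      rwa [e] at this
    rcases hc with rfl | rfl
    · have := Int.le_of_dvd (by norm_num) h5
      have : (p : ℤ) ^ e = 1 := by omega
      omega
    · have := Int.le_of_dvd (by norm_num) ((dvd_abs _ _).2 h5)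
      norm_num at this; omega
  have X2 : (p2 : ℤ) ∣ X - 2 * g1 := by
    have h3 : (p2 : ℤ) ∣ (p1 - 1) * (X - 2 * g1) := by
      have : (p1 - 1) * (X - 2 * g1) = - (2 * (g2 + 1)) - p2 * (2 * p1 * n01) := by linear_combination E01
      rw [this]
      exact dvd_sub ((Dvd.dvd.mul_left k2 2).neg_right) (dvd_mul_right _ _)
    refine (P2.dvd_or_dvd h3).resolve_left ?_
    intro h4
    have h5 : (p2 : ℤ) ∣ -2 * c + 1 := by
      have := dvd_sub (dvd_refl (p2 : ℤ)) h4
      have e : (p2 : ℤ) - (p1 - 1) = -2 * c + 1 := by rw [h1, h2]; ring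
      rwa [e] at this
    rcases hc with rfl | rfl
    · have := Int.le_of_dvd (by norm_num) ((dvd_abs _ _).2 h5)
      norm_num at this; omega
    · have := Int.le_of_dvd (by norm_num) h5
      have : (p : ℤ) ^ e = 1 := by omega
      omega
  rw [G2] at X1
  rw [G1] at X2
  have hX0 : X ≠ 0 := by
    rintro rfl
    have : (p1 : ℤ) ∣ 2 * (δ * (p : ℤ) ^ s) := by simpa using X1
    rcases P1.dvd_or_dvd this with h | h
    · exact two1 h
    · exact np1 ((hdδ.dvd_mul_left).1 h)
  have hZ0 : Z ≠ 0 := by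
    rintro rfl
    have h3 : X ^ 2 = (2 * (p : ℤ) ^ s) ^ 2 := by
      have : (p1 * p2 : ℤ) * (4 * ((p : ℤ) ^ s) ^ 2 - X ^ 2) = 0 := by rw [← hZ]; norm_num
      rcases mul_eq_zero.1 this with h | h
      · have : (0 : ℤ) < p1 * p2 := by positivity
        omega
      · linear_combination -h
    have key1 : ¬ (p1 : ℤ) ∣ 2 * (2 * (p : ℤ) ^ s) := fun h => by
      rcases P1.dvd_or_dvd h with h | h
      · exact two1 h
      rcases P1.dvd_or_dvd h with h | h
      · exact two1 h
      · exact np1 h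
    have key2 : ¬ (p2 : ℤ) ∣ 2 * (2 * (p : ℤ) ^ s) := fun h => by
      rcases P2.dvd_or_dvd h with h | h
      · exact two2 h
      rcases P2.dvd_or_dvd h with h | h
      · exact two2 h
      · exact np2 h
    rcases sq_eq_sq_iff_eq_or_eq_neg.1 h3 with h | h <;> rcases hδ with rfl | rfl <;> rw [h] at X1 X2
    · apply key2; convert X2 using 1; ring
    · apply key1; convert X1 using 1; ring
    · apply key1; have e := (dvd_neg).2 X1; ring_nf at e ⊢; exact e
    · apply key2; have e := (dvd_neg).2 X2; ring_nf at e ⊢; exact e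
  -- Z = d Y
  have hne12 : (p1 : ℤ) ≠ p2 := by rw [h1, h2]; rcases hc with rfl | rfl <;> omega
  have hcop : IsCoprime (p1 : ℤ) (p2 : ℤ) := by
    rw [Nat.isCoprime_iff_coprime, Nat.coprime_primes hp1 hp2]
    intro h; exact hne12 (by rw [h])
  obtain ⟨Y, rfl⟩ : (p1 * p2 : ℤ) ∣ Z := by
    apply hcop.mul_dvd
    · exact P1.dvd_of_dvd_pow (n := 2) (by rw [hZ, mul_assoc]; exact dvd_mul_right _ _)
    · exact P2.dvd_of_dvd_pow (n := 2) (by rw [hZ, mul_comm (p1 : ℤ), mul_assoc]; exact dvd_mul_right _ _)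
  have hdpos : (0 : ℤ) < p1 * p2 := by positivity
  have hY0 : Y ≠ 0 := by rintro rfl; simp at hZ0
  have hXY : X ^ 2 + p1 * p2 * Y ^ 2 = 4 * ((p : ℤ) ^ s) ^ 2 := by
    apply mul_left_cancel₀ hdpos.ne'
    linear_combination hZ
  have hc2 : c ^ 2 = 1 := by rcases hc with rfl | rfl <;> norm_num
  have hδ2 : δ ^ 2 = 1 := by rcases hδ with rfl | rfl <;> norm_num
  have hd : (p1 * p2 : ℤ) + 1 = 4 * ((p : ℤ) ^ e) ^ 2 := by rw [h1, h2]; linear_combination -hc2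
  have hX1 : 1 ≤ X ^ 2 := by have := sq_pos_of_ne_zero hX0; omega
  have hY1 : 1 ≤ Y ^ 2 := by have := sq_pos_of_ne_zero hY0; omega
  have hp1' : (1 : ℤ) < p := by exact_mod_cast hp.one_lt
  have hes : e ≤ s := by
    by_contra hlt
    push Not at hlt
    have : (p : ℤ) ^ s < (p : ℤ) ^ e := pow_lt_pow_right₀ hp1' hlt
    have h0 : (0 : ℤ) < (p : ℤ) ^ s := by positivity
    have h6 := mul_le_mul_of_nonneg_left hY1 hdpos.le
    have h7 : ((p : ℤ) ^ s) ^ 2 < ((p : ℤ) ^ e) ^ 2 := by gcongr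
    linarith
  obtain ⟨t, rfl⟩ : ∃ t, s = t + e := ⟨s - e, by omega⟩
  rw [Nat.add_sub_cancel] at hX
  rw [pow_add] at *
  set P := (p : ℤ) ^ t
  set R := (p : ℤ) ^ e
  have hP0 : 0 < P := by positivity
  have hR0 : 0 < R := by positivity
  obtain ⟨x, rfl⟩ := hX
  have hPY : P ∣ Y := by
    have h3 : P ^ 2 ∣ Y ^ 2 := by
      have h4 : P ^ 2 ∣ (p1 * p2 : ℤ) * Y ^ 2 := ⟨4 * R ^ 2 - x ^ 2, by linear_combination hXY⟩
      refine IsCoprime.dvd_of_dvd_mul_left ?_ h4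
      have : IsCoprime P (p1 * p2 : ℤ) := by
        have a1 : IsCoprime P (p1 : ℤ) := ((P1.coprime_iff_not_dvd).2 (fun h => np1 (h.mul_right _))).symm
        have a2 : IsCoprime P (p2 : ℤ) := ((P2.coprime_iff_not_dvd).2 (fun h => np2 (h.mul_right _))).symm
        exact a1.mul_right a2
      exact this.pow_left
    exact (Int.pow_dvd_pow_iff (by norm_num)).1 h3
  obtain ⟨y, rfl⟩ := hPY
  have hxy : x ^ 2 + p1 * p2 * y ^ 2 = p1 * p2 + 1 := by
    apply mul_left_cancel₀ (pow_ne_zero 2 hP0.ne')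
    rw [hd]; linear_combination hXY
  have hx0 : x ≠ 0 := by rintro rfl; simp at hX0
  have hy0 : y ≠ 0 := by rintro rfl; simp at hY0
  have hx1 : 1 ≤ x ^ 2 := by have := sq_pos_of_ne_zero hx0; omega
  have hy2 : y ^ 2 = 1 := by
    have : 1 ≤ y ^ 2 := by have := sq_pos_of_ne_zero hy0; omega
    by_contra hne
    have h5 : 2 ≤ y ^ 2 := by omega
    have h6 := mul_le_mul_of_nonneg_left h5 hdpos.le
    linarith
  have hx2 : x ^ 2 = 1 := by rw [hy2] at hxy; linarith
  have hxv : x = -δ * c := by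
    have h3 : (p1 : ℤ) ∣ P * (x - (-δ * c)) := by
      have : P * (x - (-δ * c)) = (P * x - 2 * (δ * (P * R))) + p1 * (δ * P) := by rw [h1]; ring
      rw [this]; exact dvd_add X1 (dvd_mul_right _ _)
    have h4 := (P1.dvd_or_dvd h3).resolve_left (fun h => np1 (h.mul_right _))
    exact pm_small h31 (sq_eq_sq_iff_eq_or_eq_neg.1 (hx2.trans (one_pow 2).symm)) (by rcases hc with rfl | rfl <;> rcases hδ with rfl | rfl <;> simp) h4
  have hy1 : y = 1 ∨ y = -1 := sq_eq_sq_iff_eq_or_eq_neg.1 (hy2.trans (one_pow 2).symm)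
  rw [G1, G2, hxv] at E00 E10 E01 E11 E12
  exact int_fin hc hδ hy1 h1 h2 hdpos E00 E10 E01 E11 E12
end PartM

section PartN
open Finset

lemma fin_inv {R E : Type*} [CommRing R] [Fintype R] [Field E] {ψ : AddChar R E} (hψ : ψ.IsPrimitive)
    (k : R → E) (w : R) : (Fintype.card R : E) * k w = ∑ z, ψ (-(z * w)) * ∑ v, ψ (z * v) * k v := by
  have : ∀ z : R, ψ (-(z * w)) * ∑ v, ψ (z * v) * k v = ∑ v, ψ (z * (v - w)) * k v := by
    intro z
    rw [mul_sum]
    refine sum_congr rfl fun v _ => ?_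
    rw [← mul_assoc, ← AddChar.map_add_eq_mul]; congr 2; ring
  simp_rw [this]
  rw [sum_comm]
  simp_rw [← sum_mul, AddChar.sum_mulShift _ hψ, sub_eq_zero]
  simp

/-- the quadratic character with values in `E` -/
noncomputable def qch (ℓ : ℕ) [Fact ℓ.Prime] (E : Type*) [Field E] : MulChar (ZMod ℓ) E :=
  (quadraticChar (ZMod ℓ)).ringHomComp (Int.castRingHom E)

lemma qch_apply (ℓ : ℕ) [Fact ℓ.Prime] (E : Type*) [Field E] (x : ZMod ℓ) :
    qch ℓ E x = ((quadraticChar (ZMod ℓ) x : ℤ) : E) := rfl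

lemma qch_tau {ℓ : ℕ} [Fact ℓ.Prime] (h2 : ℓ ≠ 2) {E : Type*} [Field E] [CharZero E] {ψ : AddChar (ZMod ℓ) E}
    (hψ : ψ.IsPrimitive) : gaussSum (qch ℓ E) ψ ^ 2 = qch ℓ E (-1) * ℓ := by
  rw [gaussSum_sq _ _ hψ, ZMod.card]
  · intro h
    obtain ⟨a, ha⟩ := quadraticChar_exists_neg_one (F := ZMod ℓ) (by rwa [ZMod.ringChar_zmod_n])
    have ha0 : a ≠ 0 := by rintro rfl; simp at ha
    have h3 := qch_apply ℓ E a
    rw [h, ha, MulChar.one_apply (isUnit_iff_ne_zero.2 ha0)] at h3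
    norm_num at h3
  · exact (quadraticChar_isQuadratic (ZMod ℓ)).comp _

lemma qch_sum {ℓ : ℕ} [Fact ℓ.Prime] {E : Type*} [Field E] [CharZero E] {ψ : AddChar (ZMod ℓ) E} (h2 : ℓ ≠ 2)
    (w : ZMod ℓ) : ∑ z, ψ (-(z * w)) * qch ℓ E z = qch ℓ E (-w) * gaussSum (qch ℓ E) ψ := by
  by_cases hw : w = 0
  · subst hw
    simp only [mul_zero, neg_zero, AddChar.map_zero_eq_one, one_mul, MulChar.map_zero, zero_mul]
    simp_rw [qch_apply]
    rw [← Int.cast_sum, quadraticChar_sum_zero (by rwa [ZMod.ringChar_zmod_n]), Int.cast_zero]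
  · have hw' : -w ≠ 0 := neg_ne_zero.2 hw
    have h := gaussSum_mulShift (qch ℓ E) ψ (Units.mk0 (-w) hw')
    have h3 : qch ℓ E (-w) * qch ℓ E (-w) = 1 := by
      rw [qch_apply, ← Int.cast_mul, ← pow_two, quadraticChar_sq_one hw', Int.cast_one]
    rw [← h, ← mul_assoc, Units.val_mk0, h3, one_mul]
    unfold gaussSum
    refine sum_congr rfl fun z _ => ?_
    rw [mul_comm, AddChar.mulShift_apply]; congr 2; ring

lemma del_sum {ℓ : ℕ} [Fact ℓ.Prime] {E : Type*} [Field E] {ψ : AddChar (ZMod ℓ) E} (hψ : ψ.IsPrimitive) 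
    (w : ZMod ℓ) : ∑ z, ψ (-(z * w)) * (1 - if z = 0 then 1 else 0) = (if w = 0 then (ℓ : E) else 0) - 1 := by
  simp_rw [mul_sub, sum_sub_distrib, mul_one]
  congr 1
  · have := AddChar.sum_mulShift (-w) hψ
    simp only [mul_neg, neg_eq_zero, ZMod.card] at this
    rw [this]; push_cast; rfl
  · simp

lemma core_formula {p1 p2 : ℕ} [Fact p1.Prime] [Fact p2.Prime] (h1 : p1 ≠ 2) (h2 : p2 ≠ 2)
    {E : Type*} [Field E] [CharZero E]
    {e1 : AddChar (ZMod p1) E} {e2 : AddChar (ZMod p2) E} (he1 : e1.IsPrimitive) (he2 : e2.IsPrimitive)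
    (n : ZMod p1 → ZMod p2 → ℤ) (G : ZMod p1 → ZMod p2 → E)
    (hG : ∀ z1 z2, G z1 z2 = ∑ v1, ∑ v2, e1 (z1 * v1) * (e2 (z2 * v2) * n v1 v2))
    {g1 g2 X D : E} 
    (hGv : ∀ z1 z2, G z1 z2 = - ((if z1 = 0 then 1 else 0) * (if z2 = 0 then 1 else 0))
      + g2 * ((if z1 = 0 then 1 else 0) * (1 - if z2 = 0 then 1 else 0))
      + g1 * ((1 - if z1 = 0 then 1 else 0) * (if z2 = 0 then 1 else 0))
      + X / 2 * ((1 - if z1 = 0 then 1 else 0) * (1 - if z2 = 0 then 1 else 0))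
      + D / 2 * (qch p1 E z1 * qch p2 E z2)) (w1 : ZMod p1) (w2 : ZMod p2) :
    (p1 * p2 : E) * n w1 w2 = -1 + g2 * ((if w2 = 0 then (p2 : E) else 0) - 1)
      + g1 * ((if w1 = 0 then (p1 : E) else 0) - 1)
      + X / 2 * (((if w1 = 0 then (p1 : E) else 0) - 1) * ((if w2 = 0 then (p2 : E) else 0) - 1))
      + D / 2 * ((qch p1 E (-w1) * gaussSum (qch p1 E) e1) * (qch p2 E (-w2) * gaussSum (qch p2 E) e2)) := by
  have hinv : (p1 * p2 : E) * n w1 w2 = ∑ z1, ∑ z2, (e1 (-(z1 * w1)) * e2 (-(z2 * w2))) * G z1 z2 := by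
    have a1 := fin_inv he2 (fun v2 => (n w1 v2 : E)) w2
    rw [ZMod.card] at a1
    rw [mul_assoc, a1, mul_sum, sum_comm]
    refine sum_congr rfl fun z2 _ => ?_
    have a2 := fin_inv he1 (fun v1 => ∑ v2, e2 (z2 * v2) * (n v1 v2 : E)) w1
    rw [ZMod.card] at a2
    rw [mul_left_comm, a2, mul_sum]
    refine sum_congr rfl fun z1 _ => ?_
    rw [hG]
    simp_rw [← mul_sum]
    ring
  have hprod : ∀ (a : ZMod p1 → E) (b : ZMod p2 → E), ∑ z1, ∑ z2, (e1 (-(z1 * w1)) * e2 (-(z2 * w2))) * (a z1 * b z2)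
      = (∑ z1, e1 (-(z1 * w1)) * a z1) * (∑ z2, e2 (-(z2 * w2)) * b z2) := by
    intro a b
    rw [Finset.sum_mul_sum]
    refine sum_congr rfl fun z1 _ => sum_congr rfl fun z2 _ => ?_
    ring
  have d1 : ∑ z : ZMod p1, e1 (-(z * w1)) * (if z = 0 then 1 else 0) = 1 := by simp
  have d2 : ∑ z : ZMod p2, e2 (-(z * w2)) * (if z = 0 then 1 else 0) = 1 := by simp
  have f1 := hprod (fun z => if z = 0 then 1 else 0) (fun z => if z = 0 then 1 else 0)
  have f2 := hprod (fun z => if z = 0 then 1 else 0) (fun z => 1 - if z = 0 then 1 else 0)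
  have f3 := hprod (fun z => 1 - if z = 0 then 1 else 0) (fun z => if z = 0 then 1 else 0)
  have f4 := hprod (fun z => 1 - if z = 0 then 1 else 0) (fun z => 1 - if z = 0 then 1 else 0)
  have f5 := hprod (fun z => qch p1 E z) (fun z => qch p2 E z)
  rw [d1, d2] at f1
  rw [d1, del_sum he2] at f2
  rw [d2, del_sum he1] at f3
  rw [del_sum he1, del_sum he2] at f4
  rw [qch_sum h1, qch_sum h2] at f5
  rw [hinv]
  rw [← f5, ← f4]
  have g2' : g2 * ((if w2 = 0 then (p2 : E) else 0) - 1) = g2 * (1 * ((if w2 = 0 then (p2 : E) else 0) - 1)) := by rw [one_mul]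
  have g1' : g1 * ((if w1 = 0 then (p1 : E) else 0) - 1) = g1 * (((if w1 = 0 then (p1 : E) else 0) - 1) * 1) := by rw [mul_one]
  have g0' : (-1 : E) = -(1 * 1) := by rw [mul_one]
  rw [g2', g1', g0', ← f2, ← f3, ← f1]
  simp_rw [mul_sum, ← sum_neg_distrib, ← sum_add_distrib]
  refine sum_congr rfl fun z1 _ => sum_congr rfl fun z2 _ => ?_
  rw [hGv]; ring
end PartN

section PartO
open Finset

lemma sign_of_sq {E : Type*} [Field E] {x : E} {a : ℤ} (h : x * x = ((a : E)) ^ 2) : ∃ g : ℤ, x = g ∧ g ^ 2 = a ^ 2 := by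
  rw [← pow_two] at h
  rcases sq_eq_sq_iff_eq_or_eq_neg.1 h with h | h
  · exact ⟨a, h, rfl⟩
  · exact ⟨-a, by rw [h]; push_cast; rfl, by ring⟩

set_option maxHeartbeats 1000000 in
lemma core {p p1 p2 e s : ℕ} [F1 : Fact p1.Prime] [F2 : Fact p2.Prime] {c δ : ℤ} (hp : p.Prime)
    (hc : c = 1 ∨ c = -1) (hδ : δ = 1 ∨ δ = -1) (h1 : (p1 : ℤ) = 2 * (p : ℤ) ^ e + c)
    (h2 : (p2 : ℤ) = 2 * (p : ℤ) ^ e - c) (h31 : 2 < p1) (h32 : 2 < p2)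
    (hs1 : (p1 : ℤ) ∣ (p : ℤ) ^ s - δ) (hs2 : (p2 : ℤ) ∣ (p : ℤ) ^ s + δ)
    (hneg : quadraticChar (ZMod p1) (-1) * quadraticChar (ZMod p2) (-1) = -1)
    {E : Type*} [Field E] [CharZero E]
    {e1 : AddChar (ZMod p1) E} {e2 : AddChar (ZMod p2) E} (he1 : e1.IsPrimitive) (he2 : e2.IsPrimitive)
    (n : ZMod p1 → ZMod p2 → ℤ) (G : ZMod p1 → ZMod p2 → E)
    (hG : ∀ z1 z2, G z1 z2 = ∑ v1, ∑ v2, e1 (z1 * v1) * (e2 (z2 * v2) * n v1 v2))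
    (h00 : G 0 0 = -1)
    (hq : ∀ z1 z2, (z1 ≠ 0 ∨ z2 ≠ 0) → G z1 z2 * G (-z1) (-z2) = ((p : E) ^ s) ^ 2)
    (h0 : ∀ z, z ≠ 0 → G 0 z = G 0 1) (h0' : ∀ z, z ≠ 0 → G z 0 = G 1 0)
    (hpos : ∀ z1 z2, quadraticChar (ZMod p1) z1 * quadraticChar (ZMod p2) z2 = 1 → G z1 z2 = G 1 1)
    (hmin : ∀ z1 z2, quadraticChar (ZMod p1) z1 * quadraticChar (ZMod p2) z2 = -1 → G z1 z2 = G (-1) (-1))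
    (hX : ∀ X : ℤ, G 1 1 + G (-1) (-1) = X → (p : ℤ) ^ (s - e) ∣ X) :
    ∃ r t : ℤ, ∀ w1 w2, n w1 w2 = r ∨ n w1 w2 = t := by
  have hd0 : (2 * (p1 * p2) : E) ≠ 0 := by
    have a : (p1 : E) ≠ 0 := Nat.cast_ne_zero.2 F1.out.ne_zero
    have b : (p2 : E) ≠ 0 := Nat.cast_ne_zero.2 F2.out.ne_zero
    simp [a, b]
  obtain ⟨g2, hg2, hg2'⟩ := sign_of_sq (x := G 0 1) (a := (p : ℤ) ^ s) (by
    have := hq 0 1 (Or.inr one_ne_zero)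
    rw [neg_zero, h0 (-1) (by simp)] at this
    rw [this]; push_cast; rfl)
  obtain ⟨g1, hg1, hg1'⟩ := sign_of_sq (x := G 1 0) (a := (p : ℤ) ^ s) (by
    have := hq 1 0 (Or.inl one_ne_zero)
    rw [neg_zero, h0' (-1) (by simp)] at this
    rw [this]; push_cast; rfl)
  have q1 : qch p1 E 0 = 0 := MulChar.map_zero _
  have q2 : qch p2 E 0 = 0 := MulChar.map_zero _
  have key := core_formula (by omega) (by omega) he1 he2 n G hG (g1 := g1) (g2 := g2)
    (X := G 1 1 + G (-1) (-1)) (D := G 1 1 - G (-1) (-1)) (by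
      intro z1 z2
      by_cases hz1 : z1 = 0 <;> by_cases hz2 : z2 = 0
      · subst hz1 hz2; simp [h00, q1]
      · subst hz1; simp [hz2, h0 z2 hz2, hg2, q1]
      · subst hz2; simp [hz1, h0' z1 hz1, hg1, q2]
      · simp only [hz1, hz2, if_false, qch_apply, ← Int.cast_mul]
        have hu : IsUnit (quadraticChar (ZMod p1) z1 * quadraticChar (ZMod p2) z2) := by
          apply IsUnit.mul
          · exact (isUnit_iff_ne_zero.2 hz1).map _
          · exact (isUnit_iff_ne_zero.2 hz2).map _
        rcases Int.isUnit_iff.1 hu with h | h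
        · rw [h, hpos z1 z2 h]; push_cast; ring
        · rw [h, hmin z1 z2 h]; push_cast; ring)
  set XE := G 1 1 + G (-1) (-1) with hXE
  set T := gaussSum (qch p1 E) e1 * gaussSum (qch p2 E) e2 with hT
  have hcE : (c : E) * c = 1 := by rcases hc with rfl | rfl <;> norm_num
  have P1 : (p1 : E) = 2 * (p : E) ^ e + c := by exact_mod_cast congrArg (Int.cast : ℤ → E) h1
  have P2 : (p2 : E) = 2 * (p : E) ^ e - c := by exact_mod_cast congrArg (Int.cast : ℤ → E) h2
  have hnegE : qch p1 E (-1) * qch p2 E (-1) = -1 := by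
    rw [qch_apply, qch_apply, ← Int.cast_mul, hneg]; norm_num
  -- values
  have v00 := key 0 0
  obtain ⟨X, hXX⟩ : ∃ X : ℤ, XE = X := by
    refine ⟨c * (p1 * g1 - p2 * g2 - p1 * p2 * (n 0 1 - n 1 0)), ?_⟩
    have a := key 1 0
    have b := key 0 1
    simp only [if_true, one_ne_zero, if_false, neg_zero, q1, q2, zero_mul, mul_zero, add_zero] at a b
    push_cast
    have hpc : (p1 : E) - p2 = 2 * c := by rw [P1, P2]; ring
    linear_combination (-XE) * hcE - c * XE / 2 * hpc + c * b - c * a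
  have hXd := hX X hXX
  rw [hXX] at key v00
  have hχ : ∀ w1 w2, (qch p1 E (-w1) * gaussSum (qch p1 E) e1) * (qch p2 E (-w2) * gaussSum (qch p2 E) e2)
      = -(((quadraticChar (ZMod p1) w1 * quadraticChar (ZMod p2) w2 : ℤ) : E)) * T := by
    intro w1 w2
    rw [← neg_one_mul w1, ← neg_one_mul w2, map_mul, map_mul, hT]
    push_cast
    rw [← qch_apply, ← qch_apply]
    linear_combination (qch p1 E w1 * qch p2 E w2 * gaussSum (qch p1 E) e1 * gaussSum (qch p2 E) e2) * hnegE
  simp_rw [hχ] at key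
  set D := G 1 1 - G (-1) (-1) with hD
  obtain ⟨Z, hZ⟩ : ∃ Z : ℤ, -D * T = Z := by
    refine ⟨2 * (p1 * p2) * n 1 1 + 2 + 2 * g1 + 2 * g2 - X, ?_⟩
    have a := key 1 1
    simp only [one_ne_zero, if_false, map_one, mul_one, Int.cast_one] at a
    push_cast
    linear_combination (-2) * a
  have hZ2 : Z ^ 2 = p1 * p2 * (4 * ((p : ℤ) ^ s) ^ 2 - X ^ 2) := by
    have hT2 : T ^ 2 = -(p1 * p2) := by
      rw [hT, mul_pow, qch_tau (by omega) he1, qch_tau (by omega) he2]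
      linear_combination (p1 * p2 : E) * hnegE
    have hgg := hq 1 1 (Or.inl one_ne_zero)
    have : ((Z : E)) ^ 2 = p1 * p2 * (4 * ((p : E) ^ s) ^ 2 - (X : E) ^ 2) := by
      rw [← hZ, ← hXX, hXE, ← hgg, hD, mul_pow, hT2]; ring
    exact_mod_cast this
  have E00 : 2 * (p1 * p2) * n 0 0 = -2 + 2 * (p2 - 1) * g2 + 2 * (p1 - 1) * g1 + (p1 - 1) * (p2 - 1) * X := by
    have a := key 0 0
    simp only [if_true, MulChar.map_zero, Int.cast_zero, neg_zero, zero_mul, mul_zero, add_zero] at a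
    have : (2 * (p1 * p2) * n 0 0 : E) = -2 + 2 * (p2 - 1) * g2 + 2 * (p1 - 1) * g1 + (p1 - 1) * (p2 - 1) * X := by
      linear_combination 2 * a
    exact_mod_cast this
  have E10 : ∀ w, w ≠ 0 → 2 * (p1 * p2) * n w 0 = -2 + 2 * (p2 - 1) * g2 - 2 * g1 - (p2 - 1) * X := by
    intro w hw
    have a := key w 0
    simp only [if_true, hw, if_false, MulChar.map_zero, Int.cast_zero, neg_zero, zero_mul, mul_zero, add_zero] at a
    have : (2 * (p1 * p2) * n w 0 : E) = -2 + 2 * (p2 - 1) * g2 - 2 * g1 - (p2 - 1) * X := by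
      linear_combination 2 * a
    exact_mod_cast this
  have E01 : ∀ w, w ≠ 0 → 2 * (p1 * p2) * n 0 w = -2 - 2 * g2 + 2 * (p1 - 1) * g1 - (p1 - 1) * X := by
    intro w hw
    have a := key 0 w
    simp only [if_true, hw, if_false, MulChar.map_zero, Int.cast_zero, neg_zero, zero_mul, mul_zero, add_zero] at a
    have : (2 * (p1 * p2) * n 0 w : E) = -2 - 2 * g2 + 2 * (p1 - 1) * g1 - (p1 - 1) * X := by
      linear_combination 2 * a
    exact_mod_cast this
  have E11 : ∀ w1 w2, quadraticChar (ZMod p1) w1 * quadraticChar (ZMod p2) w2 = 1 → 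
      2 * (p1 * p2) * n w1 w2 = -2 - 2 * g2 - 2 * g1 + X + Z := by
    intro w1 w2 hw
    have n1 : w1 ≠ 0 := by rintro rfl; simp at hw
    have n2 : w2 ≠ 0 := by rintro rfl; simp at hw
    have a := key w1 w2
    simp only [n1, n2, if_false, hw, Int.cast_one] at a
    have : (2 * (p1 * p2) * n w1 w2 : E) = -2 - 2 * g2 - 2 * g1 + X + Z := by
      rw [← hZ]; linear_combination 2 * a
    exact_mod_cast this
  have E12 : ∀ w1 w2, quadraticChar (ZMod p1) w1 * quadraticChar (ZMod p2) w2 = -1 → 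
      2 * (p1 * p2) * n w1 w2 = -2 - 2 * g2 - 2 * g1 + X - Z := by
    intro w1 w2 hw
    have n1 : w1 ≠ 0 := by rintro rfl; simp at hw
    have n2 : w2 ≠ 0 := by rintro rfl; simp at hw
    have a := key w1 w2
    simp only [n1, n2, if_false, hw, Int.cast_neg, Int.cast_one] at a
    have : (2 * (p1 * p2) * n w1 w2 : E) = -2 - 2 * g2 - 2 * g1 + X - Z := by
      rw [← hZ]; linear_combination 2 * a
    exact_mod_cast this
  have e11 := E11 1 1 (by simp)
  have e12 := E12 (-1) (-1) hneg
  have hpp : (2 * (p1 * p2) : ℤ) ≠ 0 := by positivity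
  refine ⟨n 1 1, n (-1) (-1), fun w1 w2 => ?_⟩
  by_cases hw1 : w1 = 0 <;> by_cases hw2 : w2 = 0
  · subst hw1 hw2
    exact (int_core hp F1.out F2.out hc hδ h1 h2 h31 h32 hs1 hs2 E00 (E10 1 one_ne_zero) (E01 1 one_ne_zero) e11 e12 hg1' hg2' hZ2 hXd).1
  · subst hw1
    exact (int_core hp F1.out F2.out hc hδ h1 h2 h31 h32 hs1 hs2 E00 (E10 1 one_ne_zero) (E01 w2 hw2) e11 e12 hg1' hg2' hZ2 hXd).2.2
  · subst hw2
    exact (int_core hp F1.out F2.out hc hδ h1 h2 h31 h32 hs1 hs2 E00 (E10 w1 hw1) (E01 1 one_ne_zero) e11 e12 hg1' hg2' hZ2 hXd).2.1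
  · have hu : IsUnit (quadraticChar (ZMod p1) w1 * quadraticChar (ZMod p2) w2) := by
      apply IsUnit.mul
      · exact (isUnit_iff_ne_zero.2 hw1).map _
      · exact (isUnit_iff_ne_zero.2 hw2).map _
    rcases Int.isUnit_iff.1 hu with h | h
    · left; exact mul_left_cancel₀ hpp (by rw [E11 w1 w2 h, e11])
    · right; exact mul_left_cancel₀ hpp (by rw [E12 w1 w2 h, e12])
end PartO

section PartP
set_option linter.unusedSectionVars false
open Finset

/-- the embedding `ZMod ℓ → ZMod (ℓ Q)`, multiplication by `Q` -/
noncomputable def iot (ℓ Q M : ℕ) (hM : M = ℓ * Q) : ZMod ℓ →+ ZMod M :=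
  ZMod.lift ℓ ⟨(AddMonoidHom.mulLeft (Q : ZMod M)).comp (Int.castAddHom (ZMod M)), by
    have : ((ℓ * Q : ℕ) : ZMod M) = 0 := by rw [← hM]; simp
    push_cast at this
    simp [mul_comm, this]⟩

lemma iot_nat {ℓ Q M : ℕ} (hM : M = ℓ * Q) (x : ℕ) : iot ℓ Q M hM (x : ZMod ℓ) = ((Q * x : ℕ) : ZMod M) := by
  have := ZMod.lift_coe ℓ ⟨(AddMonoidHom.mulLeft (Q : ZMod M)).comp (Int.castAddHom (ZMod M)), by
    have : ((ℓ * Q : ℕ) : ZMod M) = 0 := by rw [← hM]; simp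
    push_cast at this
    simp [mul_comm, this]⟩ (x : ℤ)
  rw [iot]
  push_cast at this ⊢
  rw [this]; simp

variable {ℓ Q M : ℕ} (hM : M = ℓ * Q) [Fact ℓ.Prime] [NeZero M] [NeZero Q]

lemma iot_inj : Function.Injective (iot ℓ Q M hM) := by
  rw [injective_iff_map_eq_zero]
  intro a ha
  obtain ⟨x, rfl⟩ := ZMod.natCast_zmod_surjective a
  rw [iot_nat, ZMod.natCast_eq_zero_iff, hM, mul_comm] at ha
  rw [ZMod.natCast_eq_zero_iff]
  exact Nat.dvd_of_mul_dvd_mul_left (NeZero.pos Q) ha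

lemma iot_mul (z : ZMod M) (w : ZMod ℓ) : z * iot ℓ Q M hM w = iot ℓ Q M hM (ZMod.castHom (Dvd.intro _ hM.symm) (ZMod ℓ) z * w) := by
  obtain ⟨x, rfl⟩ := ZMod.natCast_zmod_surjective w
  obtain ⟨y, rfl⟩ := ZMod.natCast_zmod_surjective z
  have h := map_natCast (ZMod.castHom (Dvd.intro _ hM.symm) (ZMod ℓ)) y
  rw [h, ← Nat.cast_mul (α := ZMod ℓ) y x, iot_nat, iot_nat]
  push_cast; ring

lemma iot_ell (y : ZMod M) : (ℓ : ZMod M) * y = 0 ↔ ∃ w, y = iot ℓ Q M hM w := by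
  constructor
  · intro h
    obtain ⟨x, rfl⟩ := ZMod.natCast_zmod_surjective y
    rw [← Nat.cast_mul, ZMod.natCast_eq_zero_iff, hM] at h
    obtain ⟨u, hu⟩ := Nat.dvd_of_mul_dvd_mul_left (Fact.out : ℓ.Prime).pos h
    exact ⟨u, by rw [iot_nat, hu]⟩
  · rintro ⟨w, rfl⟩
    rw [iot_mul]
    simp

variable {E : Type*} [Field E] [CharZero E] {e : AddChar (ZMod M) E}

/-- the induced character -/
noncomputable def eio (e : AddChar (ZMod M) E) : AddChar (ZMod ℓ) E := e.compAddMonoidHom (iot ℓ Q M hM)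

lemma eio_apply (w : ZMod ℓ) : eio hM e w = e (iot ℓ Q M hM w) := rfl

lemma eio_prim (he : e.IsPrimitive) : (eio hM e).IsPrimitive := by
  apply AddChar.IsPrimitive.of_ne_one
  intro h
  have h1 : iot ℓ Q M hM 1 ≠ 0 := by
    intro h0
    have := iot_inj hM (h0.trans (map_zero _).symm)
    exact one_ne_zero this
  apply he h1
  ext y
  rw [AddChar.mulShift_apply, mul_comm, iot_mul, ← eio_apply, h]
  simp

lemma iot_fiber (k : ZMod M → E) (v : ZMod M) :
    ∑ x, (if (ℓ : ZMod M) * (x - v) = 0 then k x else 0) = ∑ w, k (v + iot ℓ Q M hM w) := by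
  rw [← Finset.sum_filter]
  symm
  apply Finset.sum_bij (fun w _ => v + iot ℓ Q M hM w)
  · intro w _
    simp only [mem_filter, mem_univ, true_and, add_sub_cancel_left]
    exact (iot_ell hM _).2 ⟨w, rfl⟩
  · intro a _ b _ h
    exact iot_inj hM (add_left_cancel h)
  · intro x hx
    simp only [mem_filter, mem_univ, true_and] at hx
    obtain ⟨w, hw⟩ := (iot_ell hM _).1 hx
    exact ⟨w, mem_univ _, by rw [← hw]; ring⟩
  · intros; rfl

lemma claimA (he : e.IsPrimitive) (k : ZMod M → E) {z : ZMod M} (hz : ∀ t, ∑ v, e ((z + ℓ * t) * v) * k v = ∑ v, e (z * v) * k v) (v : ZMod M) :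
    ∑ w, e (z * (v + iot ℓ Q M hM w)) * k (v + iot ℓ Q M hM w) = if (ℓ : ZMod M) * v = 0 then ∑ v, e (z * v) * k v else 0 := by
  have hM0 : (M : E) ≠ 0 := Nat.cast_ne_zero.2 (NeZero.ne M)
  apply mul_left_cancel₀ hM0
  rw [← iot_fiber hM (fun x => e (z * x) * k x) v, mul_sum]
  have h1 : ∀ x : ZMod M, (M : E) * (if (ℓ : ZMod M) * (x - v) = 0 then e (z * x) * k x else 0) =
      ∑ t, e (-(t * (ℓ * v))) * (e ((z + ℓ * t) * x) * k x) := by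
    intro x
    have h2 := AddChar.sum_mulShift ((ℓ : ZMod M) * (x - v)) he
    rw [ZMod.card] at h2
    have h3 : ∀ t, e (-(t * (ℓ * v))) * (e ((z + ℓ * t) * x) * k x) = e (t * ((ℓ : ZMod M) * (x - v))) * (e (z * x) * k x) := by
      intro t
      rw [← mul_assoc, ← AddChar.map_add_eq_mul, ← mul_assoc (e (t * _)), ← AddChar.map_add_eq_mul]
      congr 2; ring
    simp_rw [h3, ← sum_mul, h2]
    split_ifs <;> simp
  simp_rw [h1]
  rw [sum_comm]
  simp_rw [← mul_sum, hz, ← sum_mul]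
  have h4 := AddChar.sum_mulShift (-((ℓ : ZMod M) * v)) he
  simp only [mul_neg, neg_eq_zero, ZMod.card] at h4
  rw [h4]
  split_ifs <;> simp

lemma unit_lift (z : ZMod ℓ) (hz : z ≠ 0) : ∃ u : (ZMod M)ˣ, ZMod.castHom (Dvd.intro _ hM.symm) (ZMod ℓ) (u : ZMod M) = z := by
  obtain ⟨u, hu⟩ := ZMod.unitsMap_surjective (Dvd.intro _ hM.symm : ℓ ∣ M) (Units.mk0 z hz)
  refine ⟨u, ?_⟩
  have := congrArg Units.val hu
  rw [ZMod.unitsMap_def] at this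
  simpa using this

lemma claimB (he : e.IsPrimitive) (k : ZMod M → E) (hk : ∀ (z : (ZMod M)ˣ) t, ∑ v, e (((z : ZMod M) + ℓ * t) * v) * k v = ∑ v, e (z * v) * k v)
    {v : ZMod M} (hv : (ℓ : ZMod M) * v ≠ 0) : (ℓ : E) * k v = ∑ w, k (v + iot ℓ Q M hM w) := by
  have h := fin_inv (eio_prim hM he) (fun w => k (v + iot ℓ Q M hM w)) 0
  rw [ZMod.card, map_zero, add_zero] at h
  rw [h, Finset.sum_eq_single 0]
  · simp
  · intro z _ hz
    obtain ⟨u, hu⟩ := unit_lift hM z hz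
    have h1 := claimA hM he k (hk u) v
    rw [if_neg hv] at h1
    have h2 : ∑ w, e ((u : ZMod M) * (v + iot ℓ Q M hM w)) * k (v + iot ℓ Q M hM w) =
        e (u * v) * ∑ w, eio hM e (z * w) * k (v + iot ℓ Q M hM w) := by
      rw [mul_sum]
      refine sum_congr rfl fun w _ => ?_
      rw [mul_add, AddChar.map_add_eq_mul, iot_mul, hu, eio_apply]; ring
    rw [h2] at h1
    rcases mul_eq_zero.1 h1 with h3 | h3
    · exact absurd h3 (by
        intro h4
        have := AddChar.map_add_eq_mul e ((u : ZMod M) * v) (-(u * v))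
        rw [add_neg_cancel, h4, AddChar.map_zero_eq_one, zero_mul] at this
        exact one_ne_zero this)
    · rw [h3, mul_zero]
  · intro h; exact absurd (mem_univ _) h

lemma claimC (he : e.IsPrimitive) (k : ZMod M → E) (hk : ∀ (z : (ZMod M)ˣ) t, ∑ v, e (((z : ZMod M) + ℓ * t) * v) * k v = ∑ v, e (z * v) * k v)
    (u : (ZMod M)ˣ) : ∑ w, eio hM e (ZMod.castHom (Dvd.intro _ hM.symm) (ZMod ℓ) (u : ZMod M) * w) * k (iot ℓ Q M hM w) = ∑ v, e (u * v) * k v := by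
  have h1 := claimA hM he k (hk u) 0
  simp only [mul_zero, if_true, zero_add, iot_mul hM] at h1
  exact h1

lemma iot_i0 (b : (ZMod M)ˣ) (a : ZMod M) : ∃ i0, i0 < Q ∧ ∃ w, a + (i0 : ZMod M) * b = iot ℓ Q M hM w := by
  set x : ZMod M := -a * ((b⁻¹ : (ZMod M)ˣ) : ZMod M)
  refine ⟨x.val % Q, Nat.mod_lt _ (NeZero.pos Q), ?_⟩
  apply (iot_ell hM _).1
  have h1 : (ℓ : ZMod M) * ((x.val % Q : ℕ) : ZMod M) = ℓ * x := by
    conv_rhs => rw [← ZMod.natCast_zmod_val x, ← Nat.mod_add_div x.val Q]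
    have : ((ℓ * Q : ℕ) : ZMod M) = 0 := by rw [← hM]; simp
    push_cast at this ⊢
    rw [mul_add, ← mul_assoc (ℓ : ZMod M) Q, this, zero_mul, add_zero]
  have h2 : x * b = -a := by simp only [x, mul_assoc, Units.inv_mul, mul_one]
  rw [mul_add, ← mul_assoc, h1, mul_assoc, h2]; ring

lemma iot_bij (b : (ZMod M)ˣ) (a : ZMod M) :
    Function.Bijective (fun x : Fin Q × ZMod ℓ => a + ((x.1 : ℕ) : ZMod M) * b + iot ℓ Q M hM x.2) := by
  rw [Fintype.bijective_iff_injective_and_card]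
  constructor
  · rintro ⟨i, w⟩ ⟨j, y⟩ h
    simp only at h
    have h1 := congrArg (fun x => (ℓ : ZMod M) * x * ((b⁻¹ : (ZMod M)ˣ) : ZMod M)) h
    simp only [mul_add, (iot_ell hM _).2 ⟨_, rfl⟩, add_zero, add_mul] at h1
    have h2 := add_left_cancel h1
    simp only [mul_assoc, Units.mul_inv, mul_one] at h2
    rw [← Nat.cast_mul, ← Nat.cast_mul, ZMod.natCast_eq_natCast_iff] at h2
    have h3 : (i : ℕ) ≡ j [MOD Q] := by
      have h4 : ℓ * (i : ℕ) ≡ ℓ * j [MOD ℓ * Q] := by rwa [← hM]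
      exact Nat.ModEq.mul_left_cancel' (Fact.out : ℓ.Prime).ne_zero h4
    have h5 : i = j := Fin.ext (Nat.ModEq.eq_of_lt_of_lt h3 i.2 j.2)
    subst h5
    rw [iot_inj hM (add_left_cancel h)]
  · rw [Fintype.card_prod, Fintype.card_fin, ZMod.card, ZMod.card, hM, mul_comm]

lemma red_sum (he : e.IsPrimitive) (k : ZMod M → E) (hk : ∀ (z : (ZMod M)ˣ) t, ∑ v, e (((z : ZMod M) + ℓ * t) * v) * k v = ∑ v, e (z * v) * k v)
    (b : (ZMod M)ˣ) (a : ZMod M) {i0 : ℕ} (hi0 : i0 < Q) {w : ZMod ℓ} (hw : a + (i0 : ZMod M) * b = iot ℓ Q M hM w) :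
    (ℓ : E) * ∑ i ∈ range Q, k (a + i * b) = ℓ * k (iot ℓ Q M hM w) - ∑ y, k (iot ℓ Q M hM y) + ∑ v, k v := by
  have h1 : ∑ v, k v = ∑ i ∈ range Q, ∑ y, k (a + i * b + iot ℓ Q M hM y) := by
    rw [← (iot_bij hM b a).sum_comp, Fintype.sum_prod_type, ← Fin.sum_univ_eq_sum_range (fun i => ∑ y, k (a + i * b + iot ℓ Q M hM y))]
  rw [h1, mul_sum, ← Finset.add_sum_erase _ _ (mem_range.2 hi0), ← Finset.add_sum_erase (range Q) (fun i : ℕ => ∑ y, k (a + i * b + iot ℓ Q M hM y)) (mem_range.2 hi0), hw]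
  have h2 : ∑ y, k (iot ℓ Q M hM w + iot ℓ Q M hM y) = ∑ y, k (iot ℓ Q M hM y) := by
    simp_rw [← map_add]
    exact Equiv.sum_comp (Equiv.addLeft w) (fun y => k (iot ℓ Q M hM y))
  have h3 : ∑ i ∈ (range Q).erase i0, (ℓ : E) * k (a + i * b) = ∑ i ∈ (range Q).erase i0, ∑ y, k (a + i * b + iot ℓ Q M hM y) := by
    refine sum_congr rfl fun i hi => ?_
    apply claimB hM he k hk
    intro h0
    obtain ⟨y, hy⟩ := (iot_ell hM _).1 h0
    have hi' := mem_erase.1 hi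
    have := (iot_bij hM b a).1 (a₁ := (⟨i, mem_range.1 hi'.2⟩, -y)) (a₂ := (⟨i0, hi0⟩, -w)) (by
      simp only [map_neg]; rw [hy, hw]; simp)
    simp only [Prod.mk.injEq, Fin.mk.injEq] at this
    exact hi'.1 this.1
  rw [h2, h3]; ring
end PartP

section PartQ
open Finset

lemma reduced {p p1 p2 e s Q M : ℕ} [Fact p1.Prime] [Fact p2.Prime] [NeZero M] [NeZero Q] (hM : M = p1 * Q)
    {c δ : ℤ} (hp : p.Prime) (hc : c = 1 ∨ c = -1)
    (hδ : δ = 1 ∨ δ = -1) (h1 : (p1 : ℤ) = 2 * p ^ e + c) (h2 : (p2 : ℤ) = 2 * p ^ e - c) (h31 : 2 < p1) (h32 : 2 < p2)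
    (hs1 : (p1 : ℤ) ∣ p ^ s - δ) (hs2 : (p2 : ℤ) ∣ p ^ s + δ)
    (hneg : quadraticChar (ZMod p1) (-1) * quadraticChar (ZMod p2) (-1) = -1)
    {E : Type*} [Field E] [CharZero E] {e1 : AddChar (ZMod M) E} {e2 : AddChar (ZMod p2) E}
    (he1 : e1.IsPrimitive) (he2 : e2.IsPrimitive)
    (hunit : ∀ z : ZMod M, ZMod.castHom (Dvd.intro _ hM.symm) (ZMod p1) z ≠ 0 → IsUnit z)
    (n : ZMod M → ZMod p2 → ℤ) (gs : ZMod M → ZMod p2 → E)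
    (hgs : ∀ z1 z2, gs z1 z2 = ∑ v1, ∑ v2, e1 (z1 * v1) * (e2 (z2 * v2) * n v1 v2))
    (h00 : gs 0 0 = -1)
    (hq : ∀ z1 z2, (z1 ≠ 0 ∨ z2 ≠ 0) → gs z1 z2 * gs (-z1) (-z2) = ((p : E) ^ s) ^ 2)
    (h0 : ∀ z, z ≠ 0 → gs 0 z = gs 0 1) (h0' : ∀ z, IsUnit z → gs z 0 = gs 1 0)
    (hpos : ∀ z1 z2, IsUnit z1 → quadraticChar (ZMod p1) (ZMod.castHom (Dvd.intro _ hM.symm) (ZMod p1) z1) * quadraticChar (ZMod p2) z2 = 1 → gs z1 z2 = gs 1 1)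
    (hmin : ∀ z1 z2, IsUnit z1 → quadraticChar (ZMod p1) (ZMod.castHom (Dvd.intro _ hM.symm) (ZMod p1) z1) * quadraticChar (ZMod p2) z2 = -1 → gs z1 z2 = gs (-1) (-1))
    (hX : ∀ X : ℤ, gs 1 1 + gs (-1) (-1) = X → (p : ℤ) ^ (s - e) ∣ X) (b : (ZMod M)ˣ) :
    ∃ r t : ℤ, ∀ a v, (∑ i ∈ range Q, n (a + i * b) v = r) ∨ (∑ i ∈ range Q, n (a + i * b) v = t) := by
  set π := ZMod.castHom (Dvd.intro _ hM.symm) (ZMod p1) with hπ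
  have hp10 : (p1 : E) ≠ 0 := Nat.cast_ne_zero.2 (Fact.out : p1.Prime).ne_zero
  have hp20 : (p2 : E) ≠ 0 := Nat.cast_ne_zero.2 (Fact.out : p2.Prime).ne_zero
  have hπu : ∀ z : ZMod M, IsUnit z → π z ≠ 0 := fun z hz => (hz.map π).ne_zero
  have hπp : π (p1 : ZMod M) = 0 := by rw [map_natCast]; simp
  have key : ∀ (z : (ZMod M)ˣ) t j, gs ((z : ZMod M) + p1 * t) j = gs z j := by
    intro z t j
    have hπe : π ((z : ZMod M) + p1 * t) = π z := by rw [map_add, map_mul, hπp]; simp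
    have hu : IsUnit ((z : ZMod M) + p1 * t) := hunit _ (by rw [hπe]; exact hπu _ z.isUnit)
    by_cases hj : j = 0
    · rw [hj, h0' _ hu, h0' _ z.isUnit]
    · have hu2 : IsUnit (quadraticChar (ZMod p1) (π z) * quadraticChar (ZMod p2) j) :=
        ((isUnit_iff_ne_zero.2 (hπu _ z.isUnit)).map _).mul ((isUnit_iff_ne_zero.2 hj).map _)
      rcases Int.isUnit_iff.1 hu2 with h | h
      · rw [hpos _ _ hu (by rw [hπe]; exact h), hpos _ _ z.isUnit h]
      · rw [hmin _ _ hu (by rw [hπe]; exact h), hmin _ _ z.isUnit h]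
  have hgs' : ∀ z j, gs z j = ∑ w, e2 (j * w) * ∑ v, e1 (z * v) * (n v w : E) := by
    intro z j
    rw [hgs, sum_comm]
    refine sum_congr rfl fun w _ => ?_
    rw [mul_sum]
    refine sum_congr rfl fun v _ => ?_
    ring
  have hk : ∀ w, ∀ (z : (ZMod M)ˣ) t, ∑ v, e1 (((z : ZMod M) + p1 * t) * v) * (n v w : E) = ∑ v, e1 (z * v) * (n v w : E) := by
    intro w z t
    have a1 := fin_inv he2 (fun w => ∑ v, e1 (((z : ZMod M) + p1 * t) * v) * (n v w : E)) w
    have a2 := fin_inv he2 (fun w => ∑ v, e1 ((z : ZMod M) * v) * (n v w : E)) w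
    simp_rw [← hgs'] at a1 a2
    simp_rw [key] at a1
    rw [← a2, ZMod.card] at a1
    exact mul_left_cancel₀ hp20 a1
  set n' : ZMod p1 → ZMod p2 → ℤ := fun w v => ∑ i ∈ range Q, n (iot p1 Q M hM w + i * b) v with hn'
  have hn'E : ∀ w v, (p1 : E) * (n' w v : E) = p1 * (n (iot p1 Q M hM w) v : E) - ∑ y, (n (iot p1 Q M hM y) v : E) + ∑ y, (n y v : E) := by
    intro w v
    have := red_sum hM he1 (fun a => (n a v : E)) (hk v) b (iot p1 Q M hM w) (i0 := 0) (NeZero.pos Q) (w := w) (by simp)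
    rw [← this]; simp [hn']
  have hred : ∀ a v, ∃ w, ∑ i ∈ range Q, n (a + i * b) v = n' w v := by
    intro a v
    obtain ⟨i0, hi0, w, hw⟩ := iot_i0 hM b a
    refine ⟨w, ?_⟩
    have := red_sum hM he1 (fun a => (n a v : E)) (hk v) b a hi0 hw
    rw [← hn'E] at this
    have := mul_left_cancel₀ hp10 this
    exact_mod_cast this
  have he' := eio_prim hM he1
  have hA0 : ∀ v, ∑ w, (n' w v : E) = ∑ y, (n y v : E) := by
    intro v
    apply mul_left_cancel₀ hp10
    rw [mul_sum]; simp_rw [hn'E]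
    rw [sum_add_distrib, sum_sub_distrib, ← mul_sum]
    simp [ZMod.card]
  have hA1 : ∀ (u : (ZMod M)ˣ) v, ∑ w, eio hM e1 (π u * w) * (n' w v : E) = ∑ y, e1 (u * y) * (n y v : E) := by
    intro u v
    apply mul_left_cancel₀ hp10
    rw [← claimC hM he1 (fun a => (n a v : E)) (hk v) u, mul_sum, mul_sum]
    have hz : ∑ w, eio hM e1 (π u * w) = 0 := by
      have := AddChar.sum_mulShift (π u) he'
      rw [if_neg (hπu _ u.isUnit)] at this
      simpa [mul_comm] using this
    have : ∀ w, (p1 : E) * (eio hM e1 (π u * w) * (n' w v : E)) = p1 * (eio hM e1 (π u * w) * (n (iot p1 Q M hM w) v : E)) +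
        eio hM e1 (π u * w) * (- ∑ y, (n (iot p1 Q M hM y) v : E) + ∑ y, (n y v : E)) := by
      intro w
      rw [mul_left_comm, hn'E]; ring
    simp_rw [this]
    rw [sum_add_distrib, ← sum_mul, hz, zero_mul, add_zero]
  set G : ZMod p1 → ZMod p2 → E := fun z1 z2 => ∑ v1, ∑ v2, eio hM e1 (z1 * v1) * (e2 (z2 * v2) * n' v1 v2) with hG
  have hG' : ∀ z j, G z j = ∑ w, e2 (j * w) * ∑ v, eio hM e1 (z * v) * (n' v w : E) := by
    intro z j
    rw [hG]; simp only
    rw [sum_comm]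
    refine sum_congr rfl fun w _ => ?_
    rw [mul_sum]
    refine sum_congr rfl fun v _ => ?_
    ring
  have hG0 : ∀ j, G 0 j = gs 0 j := by
    intro j
    rw [hG', hgs']
    simp only [zero_mul, AddChar.map_zero_eq_one, one_mul, hA0]
  have hG1 : ∀ (u : (ZMod M)ˣ) j, G (π u) j = gs u j := by
    intro u j
    rw [hG', hgs']
    simp only [hA1]
  have hG11 : ∀ j, G 1 j = gs 1 j := by
    intro j; have := hG1 1 j; simpa using this
  have hGm1 : ∀ j, G (-1) j = gs (-1) j := by
    intro j; have := hG1 (-1) j; simpa using this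
  have hl : ∀ z, z ≠ 0 → ∃ u : (ZMod M)ˣ, π u = z := fun z hz => unit_lift hM z hz
  obtain ⟨r, t, hrt⟩ := core hp hc hδ h1 h2 h31 h32 hs1 hs2 hneg he' he2 n' G (fun _ _ => rfl) (by rw [hG0, h00])
    (by
      intro z1 z2 hz
      by_cases hz1 : z1 = 0
      · rw [hz1, neg_zero, hG0, hG0]
        have := hq 0 z2 (Or.inr (by tauto))
        rwa [neg_zero] at this
      · obtain ⟨u, rfl⟩ := hl z1 hz1
        have := hG1 (-u) (-z2)
        rw [Units.val_neg, map_neg] at this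
        rw [hG1, this]
        exact hq _ _ (Or.inl (by rintro h; exact hz1 (by rw [h, map_zero]))))
    (by intro z hz; rw [hG0, hG0, h0 z hz])
    (by
      intro z hz
      obtain ⟨u, rfl⟩ := hl z hz
      rw [hG1, hG11, h0' _ u.isUnit])
    (by
      intro z1 z2 hz
      have hz1 : z1 ≠ 0 := by rintro rfl; simp at hz
      obtain ⟨u, rfl⟩ := hl z1 hz1
      rw [hG1, hG11, hpos _ _ u.isUnit hz])
    (by
      intro z1 z2 hz
      have hz1 : z1 ≠ 0 := by rintro rfl; simp at hz
      obtain ⟨u, rfl⟩ := hl z1 hz1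
      rw [hG1, hGm1, hmin _ _ u.isUnit hz])
    (by rw [hG11, hGm1]; exact hX)
  refine ⟨r, t, fun a v => ?_⟩
  obtain ⟨w, hw⟩ := hred a v
  rw [hw]; exact hrt w v
end PartQ

section PartR
set_option linter.unusedSectionVars false
open Finset

lemma sum_field_units {F E : Type*} [Field F] [Fintype F] [AddCommMonoid E] (g : F → E) :
    ∑ x, g x = g 0 + ∑ u : Fˣ, g u := by
  rw [Fintype.sum_eq_add_sum_subtype_ne g 0]
  congr 1
  symm
  exact Fintype.sum_equiv unitsEquivNeZero _ _ (fun x => rfl)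

variable {F : Type*} [Field F] [Fintype F] {E : Type*} [Field E] [CharZero E] {N : ℕ} [NeZero N]
  (lg : Fˣ →* Multiplicative (ZMod N)) (e : AddChar (ZMod N) E) (ψ : AddChar F E)

/-- Gauss periods -/
noncomputable def per (v : ZMod N) : E := ∑ x : Fˣ, if (lg x).toAdd = v then ψ x else 0

/-- Gauss sums, indexed by `ZMod N` -/
noncomputable def gsN (j : ZMod N) : E := ∑ x : Fˣ, e (j * (lg x).toAdd) * ψ x

lemma gs_per (j : ZMod N) : gsN lg e ψ j = ∑ v, e (j * v) * per lg ψ v := by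
  simp_rw [gsN, per, mul_sum]
  rw [sum_comm]
  refine sum_congr rfl fun x _ => ?_
  simp

lemma gs_gauss (χ : MulChar F E) (hχ : ∀ x : Fˣ, χ x = e (lg x).toAdd) (j : ZMod N) :
    gsN lg e ψ j = gaussSum (χ ^ j.val) ψ := by
  by_cases hj : j = 0
  · subst hj
    rw [gaussSum, sum_field_units, gsN]
    have : (1 : MulChar F E) 0 = 0 := MulChar.map_zero 1
    simp [this]
  · rw [gaussSum, sum_field_units, gsN, MulChar.pow_apply' _ (by rwa [Ne, ZMod.val_eq_zero])]
    have : χ 0 = 0 := MulChar.map_zero χ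
    rw [this, zero_pow (by rwa [Ne, ZMod.val_eq_zero]), zero_mul, zero_add]
    refine sum_congr rfl fun x _ => ?_
    rw [MulChar.pow_apply_coe, hχ, ← AddChar.map_nsmul_eq_pow, nsmul_eq_mul, ZMod.natCast_zmod_val]

lemma gs_zero (hψ : ψ ≠ 1) : gsN lg e ψ 0 = -1 := by
  have := AddChar.sum_eq_zero_of_ne_one hψ
  rw [sum_field_units] at this
  simp only [AddChar.map_zero_eq_one] at this
  simp only [gsN, zero_mul, AddChar.map_zero_eq_one, one_mul]
  linear_combination this

lemma lg_neg (hN : Odd N) (x : Fˣ) : lg (-x) = lg x := by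
  have h1 : (lg (-1)).toAdd = 0 := by
    have h2 : (lg (-1)) ^ 2 = 1 := by rw [← map_pow]; simp
    have h3 : ((2 : ℕ) : ZMod N) * (lg (-1)).toAdd = 0 := by
      have := congrArg Multiplicative.toAdd h2
      simpa using this
    have h4 : IsUnit ((2 : ℕ) : ZMod N) := by
      rw [ZMod.isUnit_iff_coprime]
      exact (Nat.coprime_two_left).2 hN
    exact (h4.mul_right_eq_zero).1 h3
  rw [← neg_one_mul, map_mul]
  have : lg (-1) = 1 := h1
  rw [this, one_mul]

lemma gs_mul (hN : Odd N) (χ : MulChar F E) (hχ : ∀ x : Fˣ, χ x = e (lg x).toAdd) (hψ : ψ.IsPrimitive)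
    (hord : ∀ k : ℕ, χ ^ k = 1 → N ∣ k) (j : ZMod N) (hj : j ≠ 0) :
    gsN lg e ψ j * gsN lg e ψ (-j) = Fintype.card F := by
  have h1 : χ ^ j.val ≠ 1 := by
    intro h
    have := Nat.eq_zero_of_dvd_of_lt (hord _ h) (ZMod.val_lt j)
    exact hj ((ZMod.val_eq_zero j).1 this)
  have h2 : (χ ^ j.val)⁻¹ = χ ^ (-j).val := by
    rw [inv_eq_iff_mul_eq_one]
    rw [← pow_add]
    ext x
    rw [MulChar.pow_apply_coe, hχ, ← AddChar.map_nsmul_eq_pow, nsmul_eq_mul]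
    simp
  rw [gs_gauss lg e ψ χ hχ j, ← gaussSum_mul_gaussSum_eq_card h1 hψ, h2]
  congr 1
  have h3 : gaussSum (χ ^ (-j).val) ψ⁻¹ = gsN lg e ψ⁻¹ (-j) := (gs_gauss lg e ψ⁻¹ χ hχ (-j)).symm
  rw [h3, gsN, gsN]
  refine Fintype.sum_equiv (Equiv.neg Fˣ) _ _ (fun x => ?_)
  simp only [Equiv.neg_apply, lg_neg lg hN, AddChar.inv_apply]
  simp

lemma gs_frob {p : ℕ} [Fact p.Prime] [CharP F p] (hψ : ∀ x, ψ (x ^ p) = ψ x) (j : ZMod N) :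
    gsN lg e ψ (p * j) = gsN lg e ψ j := by
  have hb : Function.Bijective (fun x : Fˣ => x ^ p) := by
    rw [← Finite.injective_iff_bijective]
    intro x y h
    have := congrArg Units.val h
    simp only [Units.val_pow_eq_pow_val] at this
    exact Units.ext (frobenius_inj F p this)
  conv_rhs => rw [gsN, ← hb.sum_comp]
  rw [gsN]
  refine sum_congr rfl fun x _ => ?_
  rw [Units.val_pow_eq_pow_val, hψ, map_pow, toAdd_pow, nsmul_eq_mul]
  congr 2; ring

lemma gs_frob_pow {p : ℕ} [Fact p.Prime] [CharP F p] (hψ : ∀ x, ψ (x ^ p) = ψ x) (i : ℕ) (j : ZMod N) :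
    gsN lg e ψ ((p : ZMod N) ^ i * j) = gsN lg e ψ j := by
  induction i with
  | zero => simp
  | succ i ih => rw [pow_succ', mul_assoc, gs_frob lg e ψ hψ, ih]

lemma per_int {p : ℕ} [Fact p.Prime] [CharP F p] {ζ : E} (hζ : IsPrimitiveRoot ζ p) (hcop : Nat.Coprime (p - 1) N) (v : ZMod N) :
    ∃ a : ℤ, per lg (psiF p F hζ) v = a := by
  set cn : ZMod p → ℕ := fun t => (univ.filter (fun x : Fˣ => (lg x).toAdd = v ∧ trF p F x = t)).card with hcn
  have h1 : per lg (psiF p F hζ) v = ∑ t : ZMod p, (cn t : E) * ζ ^ t.val := by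
    have : ∀ x : Fˣ, (if (lg x).toAdd = v then psiF p F hζ x else 0) =
        ∑ t : ZMod p, (if (lg x).toAdd = v ∧ trF p F x = t then 1 else 0) * ζ ^ t.val := by
      intro x
      rw [psiF_apply]
      by_cases h : (lg x).toAdd = v <;> simp [h]
    simp_rw [per, this]
    rw [sum_comm]
    refine sum_congr rfl fun t _ => ?_
    rw [← sum_mul, sum_boole]
  have h2 : ∀ t : ZMod p, t ≠ 0 → cn t = cn 1 := by
    intro t ht
    set c : Fˣ := Units.mk0 ((t.val : ℕ) : F) (by
      rw [Ne, CharP.cast_eq_zero_iff F p]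
      intro h
      have := Nat.eq_zero_of_dvd_of_lt h (ZMod.val_lt t)
      exact ht ((ZMod.val_eq_zero t).1 this)) with hc
    have hlc : lg c = 1 := by
      have hc1 : c ^ (p - 1) = 1 := by
        ext
        rw [Units.val_pow_eq_pow_val]
        simp only [hc, Units.val_mk0, Units.val_one]
        have h := ZMod.pow_card_sub_one_eq_one ht
        have h' := congrArg (ZMod.castHom dvd_rfl F) h
        rw [map_pow, map_one] at h'
        rw [← h']
        congr 1
        conv_rhs => rw [← ZMod.natCast_zmod_val t]
        rw [map_natCast]
      have h3 : ((p - 1 : ℕ) : ZMod N) * (lg c).toAdd = 0 := by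
        have := congrArg (fun x => (lg x).toAdd) hc1
        simpa using this
      have h4 : IsUnit ((p - 1 : ℕ) : ZMod N) := by
        rw [ZMod.isUnit_iff_coprime]; exact hcop
      exact (h4.mul_right_eq_zero).1 h3
    symm
    apply Finset.card_bij (fun x _ => c * x)
    · intro x hx
      simp only [mem_filter, mem_univ, true_and] at hx ⊢
      rw [map_mul, hlc, one_mul, Units.val_mul]
      refine ⟨hx.1, ?_⟩
      simp only [hc, Units.val_mk0]
      rw [trF_smul, hx.2, mul_one, ZMod.natCast_zmod_val]
    · intro a _ b _ h; exact mul_left_cancel h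
    · intro x hx
      simp only [mem_filter, mem_univ, true_and] at hx
      refine ⟨c⁻¹ * x, ?_, by simp⟩
      simp only [mem_filter, mem_univ, true_and]
      refine ⟨by rw [map_mul, map_inv, hlc]; simpa using hx.1, ?_⟩
      have : trF p F ((t.val : F) * ((c⁻¹ * x : Fˣ) : F)) = t := by
        have h5 : (t.val : F) * ((c⁻¹ * x : Fˣ) : F) = x := by
          have : (c : F) = (t.val : F) := rfl
          rw [← this, ← Units.val_mul]; simp
        rw [h5, hx.2]
      rw [trF_smul, ZMod.natCast_zmod_val] at this
      exact mul_left_cancel₀ ht (by rw [this, mul_one])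
  have h3 : ∑ t : ZMod p, ζ ^ t.val = 0 := by
    have hp := (Fact.out : p.Prime)
    have := hζ.geom_sum_eq_zero hp.one_lt
    rw [← this]
    apply Finset.sum_bij (fun t _ => t.val)
    · intro t _; exact mem_range.2 (ZMod.val_lt t)
    · intro a _ b _ h; exact ZMod.val_injective p h
    · intro b hb; exact ⟨b, mem_univ _, ZMod.val_cast_of_lt (mem_range.1 hb)⟩
    · intros; rfl
  refine ⟨(cn 0 : ℤ) - cn 1, ?_⟩
  rw [h1]
  have h4 : ∀ t : ZMod p, (cn t : E) * ζ ^ t.val = (cn 1 : E) * ζ ^ t.val + if t = 0 then (cn 0 : E) - cn 1 else 0 := by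
    intro t
    by_cases ht : t = 0
    · subst ht; simp
    · rw [h2 t ht, if_neg ht, add_zero]
  simp_rw [h4]
  rw [sum_add_distrib, ← mul_sum, h3]
  simp
end PartR

section PartS
set_option linter.unusedSectionVars false
open Finset

lemma gs_norm {E : Type*} [NormedField E] [CharZero E] [IsUltrametricDist E] {p f N Mq s e0 : ℕ} [Fact p.Prime] [NeZero N]
    (hp : ‖(p : E)‖ < 1) {ζ : E} (hζ : IsPrimitiveRoot ζ p) {F : Type*} [Field F] [Fintype F] [CharP F p]
    {ω : MulChar F E} (hω : ∀ k, 0 < k → k < p ^ f - 1 → ‖gaussSum (ω ^ k) (psiF p F hζ)‖ = ‖1 - ζ‖ ^ (Nat.digits p k).sum)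
    (hNM : Mq * N = p ^ f - 1) (hMq : 0 < Mq) (hN1 : N ≠ 1) (lg : Fˣ →* Multiplicative (ZMod N)) (e : AddChar (ZMod N) E)
    (hχ : ∀ x : Fˣ, (ω ^ Mq) x = e (lg x).toAdd) (P : (ZMod N)ˣ) (hP : (P : ZMod N) = p) (j : (ZMod N)ˣ)
    (hf : f = 2 * s)
    (hc : (N : ℤ) * ((f : ℤ) - (2 * e0 : ℕ)) ≤ 2 * ∑ i ∈ range f, (((P ^ i * j : (ZMod N)ˣ) : ZMod N).val : ℤ)) :
    ‖gsN lg e (psiF p F hζ) j‖ ≤ ‖(p : E)‖ ^ (s - e0) := by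
  have hpp := (Fact.out : p.Prime)
  have hNpos : 0 < N := NeZero.pos N
  have hj0 : (j : ZMod N).val ≠ 0 := by
    rw [Ne, ZMod.val_eq_zero]
    have : Nontrivial (ZMod N) := ZMod.nontrivial_iff.2 hN1
    exact j.ne_zero
  set k := Mq * (j : ZMod N).val with hk
  have hk0 : 0 < k := Nat.mul_pos hMq (Nat.pos_of_ne_zero hj0)
  have hk1 : k < p ^ f - 1 := by
    rw [← hNM]; exact Nat.mul_lt_mul_of_pos_left (ZMod.val_lt _) hMq
  rw [gs_gauss lg e _ (ω ^ Mq) hχ, ← pow_mul, hω k hk0 hk1, ← norm_pi hζ, ← pow_mul]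
  set S := (Nat.digits p k).sum with hS
  have h1 := digit_sum hpp.two_le hk1
  have h2 : ∀ i, (p ^ i * k) % (p ^ f - 1) = Mq * ((P ^ i * j : (ZMod N)ˣ) : ZMod N).val := by
    intro i
    rw [← hNM, hk, show p ^ i * (Mq * (j : ZMod N).val) = Mq * (p ^ i * (j : ZMod N).val) by ring, Nat.mul_mod_mul_left]
    congr 1
    rw [← ZMod.val_natCast]
    congr 1
    push_cast
    rw [hP, ZMod.natCast_zmod_val]
  simp_rw [h2] at h1
  rw [← mul_sum, ← hNM, ← hS] at h1
  have h3 : N * S = (p - 1) * ∑ i ∈ range f, ((P ^ i * j : (ZMod N)ˣ) : ZMod N).val := by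
    apply Nat.eq_of_mul_eq_mul_left hMq
    rw [← mul_assoc, h1]; ring
  set T := ∑ i ∈ range f, ((P ^ i * j : (ZMod N)ˣ) : ZMod N).val with hT
  have h4 : (p - 1) * (s - e0) ≤ S := by
    rcases le_or_gt s e0 with h | h
    · rw [Nat.sub_eq_zero_of_le h]; simp
    · have hc' : N * (s - e0) ≤ T := by
        have : (N : ℤ) * ((2 * s : ℕ) - (2 * e0 : ℕ)) ≤ 2 * (T : ℤ) := by
          rw [hT]; push_cast; push_cast at hc; rw [hf] at hc ⊢; push_cast at hc; exact hc
        zify [h.le]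
        push_cast at this
        linarith
      apply Nat.le_of_mul_le_mul_left _ hNpos
      rw [h3, mul_left_comm]
      exact Nat.mul_le_mul_left _ hc'
  exact pow_le_pow_of_le_one (norm_nonneg _) (norm_pi_lt hζ hp).le h4

lemma padic_dvd {p : ℕ} [Fact p.Prime] (X : ℤ) (n : ℕ) (h : ‖(X : PadicAlgCl p)‖ ≤ ‖(p : PadicAlgCl p)‖ ^ n) : (p : ℤ) ^ n ∣ X := by
  have h1 : ‖(X : PadicAlgCl p)‖ = ‖(X : ℚ_[p])‖ := by
    rw [← PadicAlgCl.norm_extends]; simp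
  have h2 : ‖(p : PadicAlgCl p)‖ = ‖(p : ℚ_[p])‖ := by
    rw [← PadicAlgCl.norm_extends]; simp
  rw [h1, h2, Padic.norm_p] at h
  have := (Padic.norm_int_le_pow_iff_dvd X n (p := p)).1 (by rwa [zpow_neg, zpow_natCast, ← inv_pow])
  exact_mod_cast this
end PartS

section PartT
open Finset NumberTheorySymbols

lemma nonres2 {ℓ n p : ℕ} (hℓ : ℓ.Prime) (h2 : ℓ ≠ 2) (hJ : J((p : ℤ) | ℓ) = -1) :
    haveI := Fact.mk hℓ
    quadraticChar (ZMod ℓ) (p : ZMod ℓ) = -1 ∧ (p : ZMod ℓ) ^ (ℓ / 2) = -1 ∧ Nat.Coprime (p - 1) (ℓ ^ n) := by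
  haveI := Fact.mk hℓ
  rw [← jacobiSym.legendreSym.to_jacobiSym] at hJ
  have h1 : quadraticChar (ZMod ℓ) (p : ZMod ℓ) = -1 := by
    have := hJ
    rw [legendreSym] at this
    simpa using this
  refine ⟨h1, ?_, ?_⟩
  · have := legendreSym.eq_pow ℓ p
    rw [hJ] at this
    simpa using this.symm
  · apply Nat.Coprime.pow_right
    rw [Nat.coprime_comm, hℓ.coprime_iff_not_dvd]
    intro h
    have hp : 1 ≤ p := by
      rcases Nat.eq_zero_or_pos p with h0 | h0
      · subst h0; simp at h1
      · exact h0
    have : (p : ZMod ℓ) = 1 := by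
      have h3 := (ZMod.natCast_eq_zero_iff (p - 1) ℓ).2 h
      rw [Nat.cast_sub hp] at h3
      simpa [sub_eq_zero] using h3
    rw [this, map_one] at h1
    norm_num at h1

lemma qneg {p1 p2 : ℕ} [Fact p1.Prime] [Fact p2.Prime] (hmod : (p1 % 4 = 1 ∧ p2 % 4 = 3) ∨ (p1 % 4 = 3 ∧ p2 % 4 = 1)) :
    quadraticChar (ZMod p1) (-1) * quadraticChar (ZMod p2) (-1) = -1 := by
  have h : ∀ (l : ℕ) [Fact l.Prime], l % 2 = 1 → quadraticChar (ZMod l) (-1) = ZMod.χ₄ l := by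
    intro l _ hl
    have := legendreSym.at_neg_one (p := l) (by omega)
    rw [legendreSym] at this
    simpa using this
  rw [h p1 (by omega), h p2 (by omega)]
  rcases hmod with ⟨a, b⟩ | ⟨a, b⟩
  · rw [ZMod.χ₄_nat_one_mod_four a, ZMod.χ₄_nat_three_mod_four b]; rfl
  · rw [ZMod.χ₄_nat_three_mod_four a, ZMod.χ₄_nat_one_mod_four b]; rfl

lemma delta_ex {p p1 p2 Q s : ℕ} [Fact p1.Prime] [Fact p2.Prime] (hmod : (p1 % 4 = 1 ∧ p2 % 4 = 3) ∨ (p1 % 4 = 3 ∧ p2 % 4 = 1))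
    (hQ : Odd Q) (hs : s = Q * (p1 / 2) * (p2 / 2)) (h1 : (p : ZMod p1) ^ (p1 / 2) = -1) (h2 : (p : ZMod p2) ^ (p2 / 2) = -1) :
    ∃ δ : ℤ, (δ = 1 ∨ δ = -1) ∧ (p1 : ℤ) ∣ p ^ s - δ ∧ (p2 : ℤ) ∣ p ^ s + δ := by
  have e1 : (p : ZMod p1) ^ s = (-1) ^ (Q * (p2 / 2)) := by
    rw [← h1, ← pow_mul, hs]; congr 1; ring
  have e2 : (p : ZMod p2) ^ s = (-1) ^ (Q * (p1 / 2)) := by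
    rw [← h2, ← pow_mul, hs]; congr 1; ring
  rcases hmod with ⟨a, b⟩ | ⟨a, b⟩
  · have o1 : Odd (Q * (p2 / 2)) := hQ.mul (Nat.odd_iff.2 (by omega))
    have o2 : Even (Q * (p1 / 2)) := (Nat.even_iff.2 (by omega : p1 / 2 % 2 = 0)).mul_left _
    rw [o1.neg_one_pow] at e1
    rw [o2.neg_one_pow] at e2
    refine ⟨-1, Or.inr rfl, ?_, ?_⟩
    · rw [← ZMod.intCast_zmod_eq_zero_iff_dvd]; push_cast; rw [e1]; ring
    · rw [← ZMod.intCast_zmod_eq_zero_iff_dvd]; push_cast; rw [e2]; ring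
  · have o1 : Even (Q * (p2 / 2)) := (Nat.even_iff.2 (by omega : p2 / 2 % 2 = 0)).mul_left _
    have o2 : Odd (Q * (p1 / 2)) := hQ.mul (Nat.odd_iff.2 (by omega))
    rw [o1.neg_one_pow] at e1
    rw [o2.neg_one_pow] at e2
    refine ⟨1, Or.inl rfl, ?_, ?_⟩
    · rw [← ZMod.intCast_zmod_eq_zero_iff_dvd]; push_cast; rw [e1]; ring
    · rw [← ZMod.intCast_zmod_eq_zero_iff_dvd]; push_cast; rw [e2]; ring

lemma f_even {p1 p2 m f : ℕ} (hp1 : p1.Prime) (hp2 : p2.Prime) (ho1 : p1 % 2 = 1) (ho2 : p2 % 2 = 1) (hne : p1 ≠ p2) (hm : 1 ≤ m)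
    (hford : 2 * f = Nat.totient (p1 ^ m * p2)) : f = 2 * (p1 ^ (m - 1) * (p1 / 2) * (p2 / 2)) := by
  have hc : Nat.Coprime (p1 ^ m) p2 := Nat.Coprime.pow_left _ ((Nat.coprime_primes hp1 hp2).2 hne)
  rw [Nat.totient_mul hc, Nat.totient_prime_pow hp1 hm, Nat.totient_prime hp2] at hford
  obtain ⟨a, ha⟩ : ∃ a, p1 = 2 * a + 1 := ⟨p1 / 2, by omega⟩
  obtain ⟨b, hb⟩ : ∃ b, p2 = 2 * b + 1 := ⟨p2 / 2, by omega⟩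
  have ha' : p1 / 2 = a := by omega
  have hb' : p2 / 2 = b := by omega
  have ha'' : p1 - 1 = 2 * a := by omega
  have hb'' : p2 - 1 = 2 * b := by omega
  rw [ha', hb']
  rw [ha'', hb''] at hford
  linarith

/-- every unit is a power of a generator -/
lemma gen_pow {M p : ℕ} [NeZero M] (ho : orderOf (p : ZMod M) = Nat.totient M) (z : ZMod M) (hz : IsUnit z) :
    ∃ i : ℕ, z = (p : ZMod M) ^ i := by
  have h0 : orderOf (p : ZMod M) ≠ 0 := by
    rw [ho]; exact (Nat.totient_pos.2 (NeZero.pos M)).ne'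
  obtain ⟨P, hP⟩ := unit_of_order h0
  obtain ⟨u, rfl⟩ := hz
  have h1 : orderOf P = Nat.card (ZMod M)ˣ := by
    rw [← orderOf_units, hP, ho, Nat.card_eq_fintype_card, ZMod.card_units_eq_totient]
  have h2 : u ∈ Subgroup.zpowers P := by
    have := (Subgroup.eq_top_of_card_eq (Subgroup.zpowers P) (by rw [Nat.card_zpowers, h1]))
    rw [this]; trivial
  rw [← mem_powers_iff_mem_zpowers] at h2
  obtain ⟨i, hi⟩ := h2
  refine ⟨i, ?_⟩
  rw [← hP, ← hi]; simp

lemma unit_primepow {ℓ Q M m : ℕ} [Fact ℓ.Prime] (hM : M = ℓ * Q) (hm : M = ℓ ^ m) (z : ZMod M)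
    [NeZero M] (hz : ZMod.castHom (Dvd.intro _ hM.symm) (ZMod ℓ) z ≠ 0) : IsUnit z := by
  obtain ⟨x, rfl⟩ := ZMod.natCast_zmod_surjective z
  have h := map_natCast (ZMod.castHom (Dvd.intro _ hM.symm) (ZMod ℓ)) x
  rw [h, Ne, ZMod.natCast_eq_zero_iff] at hz
  rw [ZMod.isUnit_iff_coprime, hm]
  exact (((Fact.out : ℓ.Prime).coprime_iff_not_dvd.2 hz).symm).pow_right _
end PartT

section PartU
open Finset NumberTheorySymbols

lemma assemble {p p1 p2 e s Q M m : ℕ} [Fact p1.Prime] [Fact p2.Prime] [NeZero M] [NeZero Q] (hM : M = p1 * Q)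
    (hMm : M = p1 ^ m) (hcop : Nat.Coprime M p2)
    {c δ : ℤ} (hp : p.Prime) (hc : c = 1 ∨ c = -1)
    (hδ : δ = 1 ∨ δ = -1) (h1 : (p1 : ℤ) = 2 * p ^ e + c) (h2 : (p2 : ℤ) = 2 * p ^ e - c) (h31 : 2 < p1) (h32 : 2 < p2)
    (hs1 : (p1 : ℤ) ∣ p ^ s - δ) (hs2 : (p2 : ℤ) ∣ p ^ s + δ)
    (hneg : quadraticChar (ZMod p1) (-1) * quadraticChar (ZMod p2) (-1) = -1)
    (hqp1 : quadraticChar (ZMod p1) (p : ZMod p1) = -1) (hqp2 : quadraticChar (ZMod p2) (p : ZMod p2) = -1)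
    (hg1 : ∀ z : ZMod M, IsUnit z → ∃ i : ℕ, z = (p : ZMod M) ^ i)
    (hg2 : ∀ z : ZMod p2, IsUnit z → ∃ i : ℕ, z = (p : ZMod p2) ^ i)
    (hcov : ∀ z : ZMod (M * p2), IsUnit z → ∃ i : ℕ, z = (p : ZMod (M * p2)) ^ i ∨ z = - (p : ZMod (M * p2)) ^ i)
    {E : Type*} [Field E] [CharZero E] {ee : AddChar (ZMod (M * p2)) E} (he : ee.IsPrimitive)
    (nn : ZMod (M * p2) → ℤ) (g : ZMod (M * p2) → E) [NeZero (M * p2)]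
    (hg : ∀ j, g j = ∑ v, ee (j * v) * (nn v : E)) (hg0 : g 0 = -1)
    (hq : ∀ j, j ≠ 0 → g j * g (-j) = ((p : E) ^ s) ^ 2)
    (hfr : ∀ (i : ℕ) j, g ((p : ZMod (M * p2)) ^ i * j) = g j)
    (hX : ∀ X : ℤ, g 1 + g (-1) = X → (p : ℤ) ^ (s - e) ∣ X) :
    ∃ r t : ℤ, ∀ a, (∑ i ∈ range Q, nn (a + i * p2) = r) ∨ (∑ i ∈ range Q, nn (a + i * p2) = t) := by
  set Φ := ZMod.chineseRemainder hcop with hΦ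
  have hΦp : ∀ (i : ℕ), Φ ((p : ZMod (M * p2)) ^ i) = ((p : ZMod M) ^ i, (p : ZMod p2) ^ i) := by
    intro i; rw [map_pow, map_natCast]; rfl
  have hΦs : ∀ (i : ℕ) a b, Φ.symm ((p : ZMod M) ^ i * a, (p : ZMod p2) ^ i * b) = (p : ZMod (M * p2)) ^ i * Φ.symm (a, b) := by
    intro i a b
    apply Φ.injective
    rw [map_mul, hΦp]; simp
  set e1 : AddChar (ZMod M) E := ee.compAddMonoidHom
    ((Φ.symm : ZMod M × ZMod p2 →+ ZMod (M * p2)).comp (AddMonoidHom.inl (ZMod M) (ZMod p2))) with he1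
  set e2 : AddChar (ZMod p2) E := ee.compAddMonoidHom
    ((Φ.symm : ZMod M × ZMod p2 →+ ZMod (M * p2)).comp (AddMonoidHom.inr (ZMod M) (ZMod p2))) with he2
  have he1a : ∀ x, e1 x = ee (Φ.symm (x, 0)) := fun x => rfl
  have he2a : ∀ x, e2 x = ee (Φ.symm (0, x)) := fun x => rfl
  have he1p : e1.IsPrimitive := by
    intro z hz h
    refine he (a := Φ.symm (z, 0)) (by
      intro h0
      rw [map_eq_zero_iff _ Φ.symm.injective, Prod.mk_eq_zero] at h0
      exact hz h0.1) ?_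
    ext y
    have h3 := DFunLike.congr_fun h (Φ y).1
    rw [AddChar.mulShift_apply, he1a] at h3
    rw [AddChar.mulShift_apply]
    have h4 : Φ.symm (z, 0) * y = Φ.symm (z * (Φ y).1, 0) := by
      apply Φ.injective; rw [map_mul]; ext <;> simp
    rw [h4, h3]; simp
  have he2p : e2.IsPrimitive := by
    intro z hz h
    refine he (a := Φ.symm (0, z)) (by
      intro h0
      rw [map_eq_zero_iff _ Φ.symm.injective, Prod.mk_eq_zero] at h0
      exact hz h0.2) ?_
    ext y
    have h3 := DFunLike.congr_fun h (Φ y).2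
    rw [AddChar.mulShift_apply, he2a] at h3
    rw [AddChar.mulShift_apply]
    have h4 : Φ.symm (0, z) * y = Φ.symm (0, z * (Φ y).2) := by
      apply Φ.injective; rw [map_mul]; ext <;> simp
    rw [h4, h3]; simp
  have hcast : ZMod.castHom (Dvd.intro _ hM.symm) (ZMod p1) (p : ZMod M) = p := map_natCast _ _
  have hz2 : ∀ z1 z2, IsUnit z1 → z2 ≠ 0 → IsUnit (Φ.symm (z1, z2)) := by
    intro z1 z2 hz1 hz2
    apply IsUnit.map Φ.symm
    exact Prod.isUnit_iff.2 ⟨hz1, isUnit_iff_ne_zero.2 hz2⟩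
  have hΦ1 : Φ.symm (1, 1) = 1 := map_one Φ.symm
  have hΦm1 : Φ.symm (-1, -1) = -1 := by rw [← hΦ1, ← map_neg]; rfl
  have qpow : ∀ i : ℕ, quadraticChar (ZMod p1) ((p : ZMod p1) ^ i) * quadraticChar (ZMod p2) ((p : ZMod p2) ^ i) = 1 := by
    intro i
    rw [map_pow, map_pow, hqp1, hqp2, ← mul_pow]; norm_num
  -- the key dichotomy
  have dich : ∀ z1 z2, IsUnit z1 → z2 ≠ 0 →
      (quadraticChar (ZMod p1) (ZMod.castHom (Dvd.intro _ hM.symm) (ZMod p1) z1) * quadraticChar (ZMod p2) z2 = 1 ∧ g (Φ.symm (z1, z2)) = g 1) ∨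
      (quadraticChar (ZMod p1) (ZMod.castHom (Dvd.intro _ hM.symm) (ZMod p1) z1) * quadraticChar (ZMod p2) z2 = -1 ∧ g (Φ.symm (z1, z2)) = g (-1)) := by
    intro z1 z2 hz1 hz2'
    obtain ⟨i, hi⟩ := hcov _ (hz2 z1 z2 hz1 hz2')
    rcases hi with hi | hi
    · left
      have h3 := congrArg Φ hi
      rw [RingEquiv.apply_symm_apply, hΦp, Prod.mk.injEq] at h3
      refine ⟨?_, ?_⟩
      · rw [h3.1, h3.2, map_pow (ZMod.castHom _ _), hcast, qpow]
      · rw [hi, ← hfr i 1, mul_one]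
    · right
      have h3 := congrArg Φ hi
      rw [RingEquiv.apply_symm_apply, map_neg, hΦp, Prod.neg_mk, Prod.mk.injEq] at h3
      refine ⟨?_, ?_⟩
      · rw [h3.1, h3.2, map_neg (ZMod.castHom _ _), map_pow (ZMod.castHom _ _), hcast, ← neg_one_mul, ← neg_one_mul ((p : ZMod p2) ^ i),
          map_mul, map_mul]
        have := qpow i
        linear_combination (quadraticChar (ZMod p1) ((p : ZMod p1) ^ i) * quadraticChar (ZMod p2) ((p : ZMod p2) ^ i)) * hneg - this
      · rw [hi, ← hfr i (-1), mul_neg, mul_one]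
  have hb : IsUnit ((p2 : ℕ) : ZMod M) := (ZMod.isUnit_iff_coprime _ _).2 hcop.symm
  obtain ⟨b, hb⟩ := hb
  obtain ⟨r, t, hrt⟩ := reduced hM hp hc hδ h1 h2 h31 h32 hs1 hs2 hneg he1p he2p
    (fun z hz => unit_primepow hM hMm z hz) (fun v1 v2 => nn (Φ.symm (v1, v2))) (fun z1 z2 => g (Φ.symm (z1, z2)))
    (by
      intro z1 z2
      rw [hg, ← Φ.symm.toEquiv.sum_comp, Fintype.sum_prod_type]
      refine sum_congr rfl fun v1 _ => sum_congr rfl fun v2 _ => ?_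
      rw [he1a, he2a, ← mul_assoc, ← AddChar.map_add_eq_mul, ← map_add]
      simp only [RingEquiv.toEquiv_eq_coe, EquivLike.coe_coe]
      rw [← map_mul]; simp)
    (by
      have : ((0, 0) : ZMod M × ZMod p2) = 0 := rfl
      simp only [this, map_zero, hg0])
    (by
      intro z1 z2 hz
      have h3 : Φ.symm (-z1, -z2) = - Φ.symm (z1, z2) := by rw [← map_neg]; rfl
      simp only [h3]
      apply hq
      intro h0
      rw [map_eq_zero_iff _ Φ.symm.injective, Prod.mk_eq_zero] at h0
      tauto)
    (by
      intro z hz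
      obtain ⟨i, rfl⟩ := hg2 z (isUnit_iff_ne_zero.2 hz)
      have := hΦs i 0 1
      rw [mul_zero, mul_one] at this
      simp only [this, hfr])
    (by
      intro z hz
      obtain ⟨i, rfl⟩ := hg1 z hz
      have := hΦs i 1 0
      rw [mul_zero, mul_one] at this
      simp only [this, hfr])
    (by
      intro z1 z2 hz1 hz
      have hz2' : z2 ≠ 0 := by rintro rfl; simp at hz
      simp only [hΦ1]
      rcases dich z1 z2 hz1 hz2' with h | h
      · exact h.2
      · rw [hz] at h; norm_num at h)
    (by
      intro z1 z2 hz1 hz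
      have hz2' : z2 ≠ 0 := by rintro rfl; simp at hz
      simp only [hΦm1]
      rcases dich z1 z2 hz1 hz2' with h | h
      · rw [hz] at h; norm_num at h
      · exact h.2)
    (by simp only [hΦ1, hΦm1]; exact hX) b
  refine ⟨r, t, fun a => ?_⟩
  have h3 := hrt (Φ a).1 (Φ a).2
  have h4 : ∀ i : ℕ, Φ.symm ((Φ a).1 + i * b, (Φ a).2) = a + i * p2 := by
    intro i
    apply Φ.injective
    rw [RingEquiv.apply_symm_apply, map_add, map_mul, map_natCast, map_natCast, hb]
    ext <;> simp
  simp only [h4] at h3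
  exact h3
end PartU

section PartV
open Finset NumberTheorySymbols

theorem periods {p p1 p2 m f e0 : ℕ} (hp1 : p1.Prime) (hp2 : p2.Prime)
    (hmod : (p1 % 4 = 1 ∧ p2 % 4 = 3) ∨ (p1 % 4 = 3 ∧ p2 % 4 = 1)) (hm : 1 ≤ m) [Fact p.Prime]
    (hord1 : orderOf ((p : ZMod (p1 ^ m))) = Nat.totient (p1 ^ m)) (hord2 : orderOf ((p : ZMod p2)) = p2 - 1)
    (hf : f = orderOf ((p : ZMod (p1 ^ m * p2)))) (hford : 2 * f = Nat.totient (p1 ^ m * p2))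
    {F : Type*} [Field F] [Fintype F] [CharP F p] (hcard : Fintype.card F = p ^ f) (γ : Fˣ) (hγ : ∀ x : Fˣ, x ∈ Subgroup.zpowers γ)
    (hcl : |∑ b ∈ range (p1 * p2), J((b : ℤ) | (p1 * p2)) * (b : ℤ)| ≤ (p1 * p2 : ℕ) * (2 * e0 : ℕ))
    {c : ℤ} (hc : c = 1 ∨ c = -1) (h1 : (p1 : ℤ) = 2 * p ^ e0 + c) (h2 : (p2 : ℤ) = 2 * p ^ e0 - c) :
    p1 ^ m * p2 ∣ p ^ f - 1 ∧
    ∃ lg : Fˣ →* Multiplicative (ZMod (p1 ^ m * p2)), lg γ = Multiplicative.ofAdd 1 ∧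
      ∃ ψ : AddChar F (PadicAlgCl p), ψ.IsPrimitive ∧ ∃ r t : ℤ, ∀ a : ZMod (p1 ^ m * p2),
        (∑ i ∈ range (p1 ^ (m - 1)), per lg ψ (a + i * p2) = r) ∨ (∑ i ∈ range (p1 ^ (m - 1)), per lg ψ (a + i * p2) = t) := by
  haveI := Fact.mk hp1
  haveI := Fact.mk hp2
  have hp := (Fact.out : p.Prime)
  set M := p1 ^ m with hMdef
  set Q := p1 ^ (m - 1) with hQdef
  haveI : NeZero M := ⟨pow_ne_zero _ hp1.ne_zero⟩
  haveI : NeZero Q := ⟨pow_ne_zero _ hp1.ne_zero⟩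
  haveI : NeZero (M * p2) := ⟨mul_ne_zero (NeZero.ne M) hp2.ne_zero⟩
  have hM : M = p1 * Q := by rw [hMdef, hQdef, ← pow_succ']; congr 1; omega
  have hne : p1 ≠ p2 := by rintro rfl; omega
  have ho1 : p1 % 2 = 1 := by omega
  have ho2 : p2 % 2 = 1 := by omega
  have h31 : 2 < p1 := by have := hp1.two_le; omega
  have h32 : 2 < p2 := by have := hp2.two_le; omega
  have hcop12 : Nat.Coprime p1 p2 := (Nat.coprime_primes hp1 hp2).2 hne
  have hcop : Nat.Coprime M p2 := hcop12.pow_left _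
  have hNodd : Odd (M * p2) := ((Nat.odd_iff.2 ho1).pow).mul (Nat.odd_iff.2 ho2)
  have hQodd : Odd Q := (Nat.odd_iff.2 ho1).pow
  have hMpos : 0 < M := NeZero.pos M
  have hN3 : 2 < M * p2 := by nlinarith
  have hNd : M * p2 = p1 * p2 * Q := by rw [hM]; ring
  have hd : (p1 * p2) % 4 = 3 := by
    rw [Nat.mul_mod]; rcases hmod with ⟨a, b⟩ | ⟨a, b⟩ <;> rw [a, b]
  have hord2' : orderOf ((p : ZMod p2)) = Nat.totient p2 := by rw [hord2, Nat.totient_prime hp2]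
  have hJ1 : J((p : ℤ) | p1) = -1 := nonres hp1 (by omega) hm hord1
  have hJ2 : J((p : ℤ) | p2) = -1 := nonres hp2 (by omega) le_rfl (by rw [pow_one]; exact hord2')
  have hJ : J((p : ℤ) | (p1 * p2)) = 1 := by
    rw [jacobiSym.mul_right, hJ1, hJ2]; norm_num
  obtain ⟨hq1, hr1, hcp1⟩ := nonres2 (n := m) hp1 (by omega) hJ1
  obtain ⟨hq2, hr2, hcp2⟩ := nonres2 (n := 1) hp2 (by omega) hJ2
  have hcp : Nat.Coprime (p - 1) (M * p2) := hcp1.mul_right (by rwa [pow_one] at hcp2)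
  have hs := f_even hp1 hp2 ho1 ho2 hne hm hford
  set s := p1 ^ (m - 1) * (p1 / 2) * (p2 / 2) with hsdef
  obtain ⟨δ, hδ, hs1, hs2⟩ := delta_ex hmod hQodd hsdef hr1 hr2
  have hf0 : f ≠ 0 := by
    have : 0 < Nat.totient (M * p2) := Nat.totient_pos.2 (by omega)
    omega
  obtain ⟨P, hP⟩ := unit_of_order (x := (p : ZMod (M * p2))) (by omega)
  have hfP : f = orderOf P := by rw [← orderOf_units, hP, ← hf]
  have hdvd : M * p2 ∣ p ^ f - 1 := by
    rw [← ZMod.natCast_eq_zero_iff, Nat.cast_sub (Nat.one_le_pow _ _ hp.pos)]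
    push_cast
    rw [hf, pow_orderOf_eq_one]; simp
  refine ⟨hdvd, ?_⟩
  obtain ⟨Mq, hMq⟩ := hdvd
  have hMq' : Mq * (M * p2) = p ^ f - 1 := by rw [hMq]; ring
  have hqf : 1 < p ^ f := Nat.one_lt_pow hf0 hp.one_lt
  have hMqpos : 0 < Mq := by
    rcases Nat.eq_zero_or_pos Mq with h | h
    · rw [h] at hMq'; omega
    · exact h
  have hogam : orderOf γ = p ^ f - 1 := by
    rw [orderOf_eq_card_of_forall_mem_zpowers hγ, Nat.card_eq_fintype_card, Fintype.card_units, hcard]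
  set lg : Fˣ →* Multiplicative (ZMod (M * p2)) := monoidHomOfForallMemZpowers hγ (g' := Multiplicative.ofAdd 1) (by
    rw [orderOf_ofAdd_eq_addOrderOf, ZMod.addOrderOf_one, hogam, hMq]
    exact Dvd.intro _ rfl) with hlg
  have hlgγ : lg γ = Multiplicative.ofAdd 1 := monoidHomOfForallMemZpowers_apply_gen hγ _
  refine ⟨lg, hlgγ, ?_⟩
  have hpn : ‖(p : PadicAlgCl p)‖ < 1 := by
    have h2 : ‖(p : PadicAlgCl p)‖ = ‖(p : ℚ_[p])‖ := by
      rw [← PadicAlgCl.norm_extends]; simp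
    rw [h2]; exact Padic.norm_p_lt_one
  obtain ⟨ζ, hζ⟩ := HasEnoughRootsOfUnity.exists_primitiveRoot (PadicAlgCl p) p
  obtain ⟨ω, hω1, hω2⟩ := stickelberger hpn hζ F hcard (by
    rw [hcard]
    have := Nat.le_of_dvd (by omega : 0 < p ^ f - 1) (Dvd.intro _ hMq.symm)
    omega)
  set ψ := psiF p F hζ with hψ
  refine ⟨ψ, psiF_prim hζ, ?_⟩
  set χ := ω ^ Mq with hχdef
  have hpowγ : ∀ x : Fˣ, ∃ i : ℕ, x = γ ^ i := by
    intro x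
    have := hγ x
    rw [← mem_powers_iff_mem_zpowers] at this
    obtain ⟨i, hi⟩ := this
    exact ⟨i, hi.symm⟩
  have hχk : ∀ k : ℕ, χ ^ k = 1 → M * p2 ∣ k := by
    intro k hk
    have := hω1 (Mq * k) (by rw [pow_mul]; exact hk)
    rw [← hMq'] at this
    exact Nat.dvd_of_mul_dvd_mul_left hMqpos this
  have hχγ : ∀ k : ℕ, (χ γ) ^ k = 1 → χ ^ k = 1 := by
    intro k hk
    ext x
    obtain ⟨i, rfl⟩ := hpowγ x
    rw [MulChar.pow_apply_coe, Units.val_pow_eq_pow_val, map_pow, ← pow_mul, mul_comm, pow_mul, hk]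
    simp
  have hξ : IsPrimitiveRoot (χ γ) (M * p2) := by
    refine ⟨?_, fun l hl => hχk l (hχγ l hl)⟩
    rw [← MulChar.pow_apply_coe, hχdef, ← pow_mul, hMq', MulChar.pow_apply_coe, ← map_pow, ← Units.val_pow_eq_pow_val,
      ← hogam, pow_orderOf_eq_one]
    simp
  set ee := AddChar.zmodChar (M * p2) ((IsPrimitiveRoot.iff_def _ _).mp hξ).left with hee
  have hep : ee.IsPrimitive := AddChar.zmodChar_primitive_of_primitive_root _ hξ
  have hχ : ∀ x : Fˣ, χ x = ee (lg x).toAdd := by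
    intro x
    obtain ⟨i, rfl⟩ := hpowγ x
    rw [map_pow, hlgγ, toAdd_pow, toAdd_ofAdd, nsmul_eq_mul, mul_one, hee, AddChar.zmodChar_apply', Units.val_pow_eq_pow_val, map_pow]
  choose nn hnn using fun v => per_int lg hζ hcp v
  have hrad : ∀ x : ZMod (M * p2), ¬ IsUnit x → J((x.val : ℤ) | (p1 * p2)) = 0 := by
    intro x hx
    haveI : NeZero (p1 * p2) := ⟨mul_ne_zero hp1.ne_zero hp2.ne_zero⟩
    rw [jacobiSym.eq_zero_iff_not_coprime, Int.gcd_natCast_natCast]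
    intro hco
    apply hx
    rw [← ZMod.natCast_zmod_val x, ZMod.isUnit_iff_coprime]
    have hco' : Nat.Coprime x.val (p1 * p2) := hco
    exact ((Nat.Coprime.coprime_mul_right_right hco').pow_right _).mul_right (Nat.Coprime.coprime_mul_left_right hco')
  have hnorm : ∀ j : (ZMod (M * p2))ˣ, ‖gsN lg ee ψ j‖ ≤ ‖(p : PadicAlgCl p)‖ ^ (s - e0) := by
    intro j
    exact gs_norm hpn hζ hω2 hMq' hMqpos (by omega) lg ee hχ P hP j hs
      (coset_sum hNd hd hJ hrad hford P hP hfP hcl j (by omega))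
  obtain ⟨r, t, hrt⟩ := assemble (p := p) (e := e0) (s := s) (E := PadicAlgCl p) hM hMdef hcop hp hc hδ h1 h2 h31 h32 hs1 hs2 (qneg hmod) hq1 hq2
    (gen_pow hord1) (gen_pow hord2')
    (by
      rintro z ⟨u, rfl⟩
      obtain ⟨i, hi⟩ := units_cover (d := p1 * p2) (Dvd.intro _ hNd.symm) hd hJ hford P hP hfP 1 u
      refine ⟨i, ?_⟩
      rw [← hP]
      rcases hi with hi | hi
      · left; rw [hi]; simp
      · right; rw [hi]; simp)
    hep nn (gsN lg ee ψ)
    (by intro j; rw [gs_per]; simp_rw [hψ, hnn])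
    (gs_zero lg ee ψ (psiF_ne_one hζ))
    (by
      intro j hj
      rw [gs_mul lg ee ψ hNodd χ hχ (psiF_prim hζ) hχk j hj, hcard, hs]
      push_cast; ring)
    (fun i j => gs_frob_pow lg ee ψ (psiF_frob hζ) i j)
    (by
      intro X hX
      apply padic_dvd
      rw [← hX]
      refine (IsUltrametricDist.norm_add_le_max _ _).trans (max_le ?_ ?_)
      · simpa using hnorm 1
      · simpa using hnorm (-1))
  refine ⟨r, t, fun a => ?_⟩
  simp_rw [hψ, hnn]
  rcases hrt a with h | h
  · left; rw [← h]; push_cast; rfl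
  · right; rw [← h]; push_cast; rfl
end PartV

section PartW
open Finset

lemma cnt_const {F : Type*} [Field F] [Fintype F] {E : Type*} [Field E] [CharZero E] {ψ : AddChar F E} (hψ : ψ.IsPrimitive)
    (D : Set F) {r t : E} (h : ∀ a, a ≠ 0 → (∑ x, ψ (a * x) * (if x ∈ D then 1 else 0) = r) ∨ (∑ x, ψ (a * x) * (if x ∈ D then 1 else 0) = t)) :
    ∃ κ : E, ∀ g : F, g ≠ 0 → ((univ.filter (fun x => x ∈ D ∧ g - x ∈ D)).card : E) = κ + (r + t) * (if g ∈ D then 1 else 0) := by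
  set ch : F → E := fun x => if x ∈ D then 1 else 0 with hch
  set η : F → E := fun a => ∑ x, ψ (a * x) * ch x with hη
  set cn : F → E := fun g => ((univ.filter (fun x => x ∈ D ∧ g - x ∈ D)).card : E) with hcn
  have hcn' : ∀ g, cn g = ∑ x, ch x * ch (g - x) := by
    intro g
    simp only [hcn, hch]
    rw [← sum_boole]
    refine sum_congr rfl fun x _ => ?_
    by_cases h1 : x ∈ D <;> by_cases h2 : g - x ∈ D <;> simp [h1, h2]
  have hconv : ∀ a, ∑ g, ψ (a * g) * cn g = η a ^ 2 := by
    intro a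
    simp_rw [hcn', mul_sum]
    rw [sum_comm, pow_two]
    simp only [hη]
    rw [sum_mul]
    refine sum_congr rfl fun x _ => ?_
    rw [← Equiv.sum_comp (Equiv.addLeft x), mul_sum]
    refine sum_congr rfl fun y _ => ?_
    simp only [Equiv.coe_addLeft, add_sub_cancel_left]
    rw [mul_add, AddChar.map_add_eq_mul]; ring
  set K : F → E := fun g => cn g - (r + t) * ch g + (if g = 0 then r * t else 0) with hK
  have hKt : ∀ a, ∑ g, ψ (a * g) * K g = (η a - r) * (η a - t) := by
    intro a
    have : ∀ g, ψ (a * g) * K g = ψ (a * g) * cn g - (r + t) * (ψ (a * g) * ch g) + (if g = 0 then ψ (a * g) * (r * t) else 0) := by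
      intro g
      simp only [hK]
      split_ifs <;> ring
    simp_rw [this]
    rw [sum_add_distrib, sum_sub_distrib, hconv, ← mul_sum]
    simp only [sum_ite_eq', mem_univ, if_true, mul_zero, AddChar.map_zero_eq_one]
    simp only [hη]; ring
  have hc0 : (Fintype.card F : E) ≠ 0 := Nat.cast_ne_zero.2 Fintype.card_ne_zero
  refine ⟨(η 0 - r) * (η 0 - t) / Fintype.card F, fun g hg => ?_⟩
  have h1 := fin_inv hψ K g
  simp_rw [hKt] at h1
  rw [Finset.sum_eq_single 0] at h1
  · simp only [zero_mul, neg_zero, AddChar.map_zero_eq_one, one_mul] at h1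
    rw [← h1, mul_div_cancel_left₀ _ hc0]
    simp only [hK, if_neg hg]
    change cn g = _
    simp only [hch]; ring
  · intro z _ hz
    have hz' : (η z - r) * (η z - t) = 0 := by
      rcases h z hz with h | h
      · rw [show η z = r from h]; ring
      · rw [show η z = t from h]; ring
    rw [hz', mul_zero]
  · intro h; exact absurd (mem_univ _) h

lemma srg_of_counts {F : Type*} [Field F] [Fintype F] (D : Set F) (h0 : (0 : F) ∉ D) (hneg : -D = D) {E : Type*} [Field E] [CharZero E] {κ ρ : E}
    (h : ∀ g : F, g ≠ 0 → ((univ.filter (fun x => x ∈ D ∧ g - x ∈ D)).card : E) = κ + ρ * (if g ∈ D then 1 else 0)) :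
    ∃ k lam mu : ℕ, (cayley D).IsSRGWith (Fintype.card F) k lam mu := by
  have hnegm : ∀ x, -x ∈ D ↔ x ∈ D := by
    intro x
    constructor
    · intro hx; rw [← hneg]; exact hx
    · intro hx; rw [← hneg] at hx; exact hx
  have hadj : ∀ x y, (cayley D).Adj x y ↔ x - y ∈ D := by
    intro x y
    rw [cayley, SimpleGraph.fromRel_adj]
    constructor
    · rintro ⟨_, h | h⟩
      · exact h
      · rw [← hnegm]; simpa using h
    · intro h
      refine ⟨?_, Or.inl h⟩
      rintro rfl; simp at h; exact h0 h
  set cn : F → ℕ := fun g => (univ.filter (fun x => x ∈ D ∧ g - x ∈ D)).card with hcn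
  have hcom : ∀ v w, Fintype.card ((cayley D).commonNeighbors v w) = cn (v - w) := by
    intro v w
    rw [← Set.toFinset_card]
    apply Finset.card_bij (fun u _ => v - u)
    · intro u hu
      rw [Set.mem_toFinset, SimpleGraph.mem_commonNeighbors, hadj, hadj] at hu
      simp only [mem_filter, mem_univ, true_and]
      refine ⟨hu.1, ?_⟩
      rw [← hnegm]
      convert hu.2 using 1; ring
    · intro a _ b _ h; simpa using h
    · intro x hx
      simp only [mem_filter, mem_univ, true_and] at hx
      refine ⟨v - x, ?_, by ring⟩
      rw [Set.mem_toFinset, SimpleGraph.mem_commonNeighbors, hadj, hadj]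
      refine ⟨by simpa using hx.1, ?_⟩
      rw [← hnegm]
      convert hx.2 using 1; ring
  have hl : ∃ lam, ∀ g, g ∈ D → cn g = lam := by
    by_cases hD : ∃ g0, g0 ∈ D
    · obtain ⟨g0, hg0⟩ := hD
      refine ⟨cn g0, fun g hg => ?_⟩
      have e1 := h g (by rintro rfl; exact h0 hg)
      have e2 := h g0 (by rintro rfl; exact h0 hg0)
      rw [if_pos hg] at e1
      rw [if_pos hg0] at e2
      exact_mod_cast e1.trans e2.symm
    · exact ⟨0, fun g hg => absurd ⟨g, hg⟩ hD⟩
  have hmu : ∃ mu, ∀ g, g ≠ 0 → g ∉ D → cn g = mu := by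
    by_cases hD : ∃ g0, g0 ≠ 0 ∧ g0 ∉ D
    · obtain ⟨g0, hg00, hg0⟩ := hD
      refine ⟨cn g0, fun g hg0' hg => ?_⟩
      have e1 := h g hg0'
      have e2 := h g0 hg00
      rw [if_neg hg] at e1
      rw [if_neg hg0] at e2
      exact_mod_cast e1.trans e2.symm
    · exact ⟨0, fun g hg0 hg => absurd ⟨g, hg0, hg⟩ hD⟩
  obtain ⟨lam, hlam⟩ := hl
  obtain ⟨mu, hmu⟩ := hmu
  refine ⟨(univ.filter (fun x => x ∈ D)).card, lam, mu, ?_⟩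
  refine ⟨rfl, ?_, ?_, ?_⟩
  · intro v
    rw [← SimpleGraph.card_neighborFinset_eq_degree]
    apply Finset.card_bij (fun u _ => v - u)
    · intro u hu
      rw [SimpleGraph.mem_neighborFinset, hadj] at hu
      simpa using hu
    · intro a _ b _ h; simpa using h
    · intro x hx
      simp only [mem_filter, mem_univ, true_and] at hx
      refine ⟨v - x, ?_, by ring⟩
      rw [SimpleGraph.mem_neighborFinset, hadj]; simpa using hx
  · intro v w hvw
    rw [hcom]; exact hlam _ ((hadj _ _).1 hvw)
  · intro v w hne hvw
    rw [hcom]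
    exact hmu _ (sub_ne_zero.2 hne) (fun hD => hvw ((hadj _ _).2 hD))
end PartW

section PartX
open Finset

lemma mem_cyc {F : Type*} [Field F] {N : ℕ} {γ : Fˣ} (hγ : ∀ x : Fˣ, x ∈ Subgroup.zpowers γ)
    (lg : Fˣ →* Multiplicative (ZMod N)) (hlg : lg γ = Multiplicative.ofAdd 1) (i : ℕ) (u : Fˣ) :
    (u : F) ∈ cycClass γ N i ↔ (lg u).toAdd = i := by
  have hz : ∀ k : ℤ, (lg (γ ^ k)).toAdd = (k : ZMod N) := by
    intro k
    rw [map_zpow, hlg, toAdd_zpow, toAdd_ofAdd]; simp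
  constructor
  · rintro ⟨k, hk⟩
    have : u = γ ^ ((i : ℤ) + (N : ℤ) * k) := Units.ext hk
    rw [this, hz]; simp
  · intro h
    obtain ⟨k, rfl⟩ := Subgroup.mem_zpowers_iff.1 (hγ u)
    rw [hz] at h
    have h1 : ((k - i : ℤ) : ZMod N) = 0 := by push_cast; rw [h]; ring
    rw [ZMod.intCast_zmod_eq_zero_iff_dvd] at h1
    obtain ⟨j, hj⟩ := h1
    refine ⟨j, ?_⟩
    rw [← hj]; simp

lemma eta_eq {F : Type*} [Field F] [Fintype F] {E : Type*} [Field E] [CharZero E] {N Q p2 : ℕ} [NeZero N] (hQ : Q * p2 ≤ N) (hp2 : 0 < p2)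
    {γ : Fˣ} (hγ : ∀ x : Fˣ, x ∈ Subgroup.zpowers γ)
    (lg : Fˣ →* Multiplicative (ZMod N)) (hlg : lg γ = Multiplicative.ofAdd 1) (ψ : AddChar F E)
    (D : Set F) (hD : D = ⋃ i < Q, cycClass γ N (i * p2)) (h0 : (0 : F) ∉ D) (a : Fˣ) :
    ∑ x, ψ ((a : F) * x) * (if x ∈ D then 1 else 0) = ∑ i ∈ range Q, per lg ψ ((lg a).toAdd + i * p2) := by
  rw [sum_field_units, if_neg h0, mul_zero, zero_add]
  have h1 : ∀ u : Fˣ, (if (u : F) ∈ D then (1 : E) else 0) = ∑ i ∈ range Q, if (lg u).toAdd = (i * p2 : ZMod N) then 1 else 0 := by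
    intro u
    have hmem : (u : F) ∈ D ↔ ∃ i < Q, (lg u).toAdd = (i * p2 : ZMod N) := by
      rw [hD]
      simp only [Set.mem_iUnion, mem_cyc hγ lg hlg, exists_prop, Nat.cast_mul]
    by_cases h : (u : F) ∈ D
    · rw [if_pos h]
      obtain ⟨i, hi, hu⟩ := hmem.1 h
      rw [Finset.sum_eq_single i]
      · rw [if_pos hu]
      · intro j hj hji
        rw [if_neg]
        rw [hu]
        intro heq
        apply hji
        rw [← Nat.cast_mul, ← Nat.cast_mul, ZMod.natCast_eq_natCast_iff] at heq
        have hj' := mem_range.1 hj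
        have := Nat.ModEq.eq_of_lt_of_lt heq (lt_of_lt_of_le (Nat.mul_lt_mul_of_pos_right hi hp2) hQ)
          (lt_of_lt_of_le (Nat.mul_lt_mul_of_pos_right hj' hp2) hQ)
        exact (Nat.eq_of_mul_eq_mul_right hp2 this).symm
      · intro hn; exact absurd (mem_range.2 hi) hn
    · rw [if_neg h]
      symm
      apply Finset.sum_eq_zero
      intro i hi
      rw [if_neg]
      intro hu
      exact h (hmem.2 ⟨i, mem_range.1 hi, hu⟩)
  simp_rw [h1, mul_sum]
  rw [sum_comm]
  refine sum_congr rfl fun i _ => ?_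
  conv_rhs => rw [per, ← Equiv.sum_comp (Equiv.mulLeft a)]
  refine sum_congr rfl fun u _ => ?_
  simp only [Equiv.coe_mulLeft, map_mul, toAdd_mul, Units.val_mul, add_right_inj]
  split_ifs <;> simp
end PartX

/-- Theorem 1.2(ii) of the paper. -/
theorem statement_3 (p₁ p₂ m : ℕ) (hp₁ : p₁.Prime) (hp₂ : p₂.Prime)
    (hmod : (p₁ % 4 = 1 ∧ p₂ % 4 = 3) ∨ (p₁ % 4 = 3 ∧ p₂ % 4 = 1))
    (hm : 1 ≤ m) (N : ℕ) (hN : N = p₁ ^ m * p₂)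
    (p : ℕ) (hp : p.Prime)
    (hord₁ : orderOf ((p : ZMod (p₁ ^ m))) = Nat.totient (p₁ ^ m))
    (hord₂ : orderOf ((p : ZMod p₂)) = p₂ - 1)
    (f : ℕ) (hf : f = orderOf ((p : ZMod N))) (hford : 2 * f = Nat.totient N)
    (F : Type*) [Field F] [Fintype F] (hcard : Fintype.card F = p ^ f)
    (γ : Fˣ) (hγ : ∀ x : Fˣ, x ∈ Subgroup.zpowers γ)
    (D : Set F) (hD : D = ⋃ i < p₁ ^ (m - 1), cycClass γ N (i * p₂))
    -- `h` is the class number of `ℚ(√-p₁p₂)`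
    (K : Type*) [Field K] [NumberField K] (α : K)
    (hα : α ^ 2 = -((p₁ : K) * p₂)) (hKα : Algebra.adjoin ℚ {α} = ⊤)
    (h : ℕ) (hh : h = NumberField.classNumber K)
    (hb : ∃ b : ℤ, (b = 1 ∨ b = -1) ∧ ∃ e : ℕ, h = 2 * e ∧
      (p₁ : ℤ) = 2 * (p : ℤ) ^ e + (-1) ^ ((p₁ - 1) / 2) * b ∧
      (p₂ : ℤ) = 2 * (p : ℤ) ^ e - (-1) ^ ((p₁ - 1) / 2) * b)
    (hcl : 1 + p₁ * p₂ = 4 * p ^ h) :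
    (0 : F) ∉ D ∧ -D = D ∧
      ∃ k lam mu : ℕ, (cayley D).IsSRGWith (Fintype.card F) k lam mu := by
  haveI : Fact p.Prime := ⟨hp⟩
  haveI : CharP F p := charP_of_card_eq_prime_pow hcard
  subst hN
  obtain ⟨b, hb1, e, he, hb2, hb3⟩ := hb
  have hd : (p₁ * p₂) % 4 = 3 := by
    rw [Nat.mul_mod]; rcases hmod with ⟨a, b⟩ | ⟨a, b⟩ <;> rw [a, b]
  have hcb := class_bound (K := K) (d := p₁ * p₂) rfl hp₁ hp₂ hd (α := α) (by rw [hα]; push_cast; rfl) hKα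
  rw [← hh, he] at hcb
  have hc : (-1 : ℤ) ^ ((p₁ - 1) / 2) * b = 1 ∨ (-1 : ℤ) ^ ((p₁ - 1) / 2) * b = -1 := by
    rcases neg_one_pow_eq_or ℤ ((p₁ - 1) / 2) with h | h <;> rcases hb1 with h' | h' <;> rw [h, h'] <;> simp
  obtain ⟨hdvd, lg, hlg, ψ, hψ, r, t, hrt⟩ := periods hp₁ hp₂ hmod hm hord₁ hord₂ hf hford hcard γ hγ hcb hc hb2 hb3
  have hNodd : Odd (p₁ ^ m * p₂) := (Odd.pow (Nat.odd_iff.2 (by omega))).mul (Nat.odd_iff.2 (by omega))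
  haveI : NeZero (p₁ ^ m * p₂) := ⟨mul_ne_zero (pow_ne_zero _ hp₁.ne_zero) hp₂.ne_zero⟩
  have h0 : (0 : F) ∉ D := by
    rw [hD]
    simp only [Set.mem_iUnion, not_exists]
    rintro i _ ⟨k, hk⟩
    exact (Units.ne_zero _) hk.symm
  have hmemneg : ∀ u : Fˣ, (u : F) ∈ D → -(u : F) ∈ D := by
    intro u hu
    rw [hD] at hu ⊢
    simp only [Set.mem_iUnion, exists_prop, mem_cyc hγ lg hlg] at hu ⊢
    obtain ⟨i, hi, hu⟩ := hu
    refine ⟨i, hi, ?_⟩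
    rw [← Units.val_neg, mem_cyc hγ lg hlg, lg_neg lg hNodd, hu]
  have hmemneg' : ∀ x : F, x ∈ D → -x ∈ D := by
    intro x hx
    have hx0 : x ≠ 0 := by rintro rfl; exact h0 hx
    exact hmemneg (Units.mk0 x hx0) hx
  have hneg : -D = D := by
    ext x
    rw [Set.mem_neg]
    constructor
    · intro hx; simpa using hmemneg' _ hx
    · exact hmemneg' x
  refine ⟨h0, hneg, ?_⟩
  have hQ : p₁ ^ (m - 1) * p₂ ≤ p₁ ^ m * p₂ :=
    Nat.mul_le_mul_right _ (Nat.pow_le_pow_right hp₁.pos (by omega))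
  obtain ⟨κ, hκ⟩ := cnt_const hψ D (r := (r : PadicAlgCl p)) (t := (t : PadicAlgCl p)) (by
    intro a ha
    have := eta_eq hQ hp₂.pos hγ lg hlg ψ D hD h0 (Units.mk0 a ha)
    rw [Units.val_mk0] at this
    rw [this]
    exact hrt _)
  exact srg_of_counts D h0 hneg hκ
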